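/- arXiv:1809.10938 — 3 statements merged into one kernel-verified Lean document; each statement's English description precedes it below -/
import Mathlib

section
/- For every η > 0 and every positive integer d there exists a positive integer k with the following property: for all positive integers n_1,…,n_d, if V ⊆ 𝒢 is a subspace such that the number of tuples (u_1,…,u_d) with u_i ∈ F_2^{n_i}∖{0} for every i and u_1⊗⋯⊗u_d ∈ V is at least η·(2^{n_1}−1)⋯(2^{n_d}−1), then there exist subspaces H_I ⊆ F_2^I of codimension at most k, one for each nonempty I ⊆ [d], such that ∩_{∅≠I⊆[d]}(H_I⊗F_2^{I^c}) ⊆ V. -/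
open Finset

/-- The space of `d`-tuples `(u_1, …, u_d)` with `u_i ∈ F_2^{n_i}`. -/
abbrev Tup (d : ℕ) (n : Fin d → ℕ) := (i : Fin d) → (Fin (n i) → ZMod 2)

/-- `𝒢 = F_2^{n_1} ⊗ ⋯ ⊗ F_2^{n_d}`, realized as `d`-dimensional arrays. -/
abbrev Arr (d : ℕ) (n : Fin d → ℕ) := ((i : Fin d) → Fin (n i)) → ZMod 2

/-- The rank-one tensor `u_1 ⊗ ⋯ ⊗ u_d`. -/
def tensorOf (d : ℕ) (n : Fin d → ℕ) (u : Tup d n) : Arr d n :=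
  fun x => ∏ i, u i (x i)

/-- `F_2^I = ⊗_{i ∈ I} F_2^{n_i}`, realized as arrays indexed by coordinates in `I`. -/
abbrev F2I (d : ℕ) (n : Fin d → ℕ) (I : Finset (Fin d)) :=
  ((i : {x : Fin d // x ∈ I}) → Fin (n i.1)) → ZMod 2

/-- The `I`-arrSlice of an array `r`, obtained by fixing the coordinates outside `I` to be `z`. -/
def arrSlice (d : ℕ) (n : Fin d → ℕ) (I : Finset (Fin d)) (r : Arr d n)
    (z : (i : {x : Fin d // x ∉ I}) → Fin (n i.1)) : F2I d n I :=
  fun y => r (fun i => if h : i ∈ I then y ⟨i, h⟩ else z ⟨i, h⟩)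

/-- The subspace `H ⊗ F_2^{I^c}` of `𝒢`: arrays all of whose `I`-slices lie in `H`. -/
def cylSub (d : ℕ) (n : Fin d → ℕ) (I : Finset (Fin d))
    (H : Submodule (ZMod 2) (F2I d n I)) : Submodule (ZMod 2) (Arr d n) where
  carrier := {r | ∀ z, arrSlice d n I r z ∈ H}
  add_mem' := fun ha hb z => H.add_mem (ha z) (hb z)
  zero_mem' := fun z => H.zero_mem
  smul_mem' := fun c _ hr z => H.smul_mem c (hr z)

/-- A subset of `𝒢` is `k`-simple if it is a translate of `⋂_{∅ ≠ I ⊆ [d]} (H_I ⊗ F_2^{I^c})`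
for subspaces `H_I ⊆ F_2^I` of codimension at most `k`. -/
def IsKSimple (d : ℕ) (n : Fin d → ℕ) (k : ℕ) (D : Set (Arr d n)) : Prop :=
  ∃ t : Arr d n, ∃ H : (I : Finset (Fin d)) → Submodule (ZMod 2) (F2I d n I),
    (∀ I : Finset (Fin d), I.Nonempty →
      Module.finrank (ZMod 2) (F2I d n I) - Module.finrank (ZMod 2) (H I) ≤ k) ∧
    D = {x | ∃ r : Arr d n,
      (∀ I : Finset (Fin d), I.Nonempty → r ∈ cylSub d n I (H I)) ∧ x = t + r}

/-- The number of pairs `(a, u) ∈ 𝒜 × ℬ'` with `a + u_1 ⊗ ⋯ ⊗ u_d ∈ 𝒜`. -/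
def closedCnt (d : ℕ) (n : Fin d → ℕ) (A : Finset (Arr d n)) (B' : Finset (Tup d n)) : ℕ :=
  ((A ×ˢ B').filter (fun p => p.1 + tensorOf d n p.2 ∈ A)).card


noncomputable section

namespace Prf

/-- sign character -/
def chi (a : ZMod 2) : ℝ := if a = 0 then 1 else -1

lemma chi_add (a b : ZMod 2) : chi (a + b) = chi a * chi b := by
  revert a b
  have h : ∀ a b : ZMod 2, (a = 0 ∨ a = 1) ∧ (b = 0 ∨ b = 1) := by decide
  intro a b
  have h11 : (1 + 1 : ZMod 2) = 0 := by decide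
  obtain ⟨rfl | rfl, rfl | rfl⟩ := h a b <;> simp [chi, h11]

lemma chi_zero : chi 0 = 1 := by simp [chi]

lemma abs_chi (a : ZMod 2) : |chi a| = 1 := by
  unfold chi; split_ifs <;> simp

lemma chi_sum {ι : Type*} (s : Finset ι) (f : ι → ZMod 2) :
    chi (∑ i ∈ s, f i) = ∏ i ∈ s, chi (f i) := by
  classical
  induction s using Finset.induction_on with
  | empty => simp [chi_zero]
  | insert a s ha ih => rw [Finset.sum_insert ha, Finset.prod_insert ha, chi_add, ih]

/-- additive characters sum -/
lemma sum_chi_hom {G : Type*} [AddCommGroup G] [Fintype G] (f : G → ZMod 2)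
    (hf : ∀ a b, f (a + b) = f a + f b) :
    ∑ u, chi (f u) = if ∀ u, f u = 0 then (Fintype.card G : ℝ) else 0 := by
  classical
  split_ifs with h
  · simp [h, chi_zero]
  · push Not at h
    obtain ⟨u0, hu0⟩ := h
    have h1 : ∑ u, chi (f u) = ∑ u, chi (f (u + u0)) :=
      (Equiv.sum_comp (Equiv.addRight u0) (fun u => chi (f u))).symm
    have h2 : ∑ u, chi (f (u + u0)) = - ∑ u, chi (f u) := by
      rw [← Finset.sum_neg_distrib]
      refine Finset.sum_congr rfl fun u _ => ?_
      rw [hf, chi_add]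
      have : chi (f u0) = -1 := by simp [chi, hu0]
      rw [this]; ring
    linarith

section one
variable {d : ℕ} (m : Fin d → ℕ)

/-- multilinear functions in the coordinates `I` -/
def ML (I : Finset (Fin d)) : Submodule (ZMod 2) (Tup d m → ZMod 2) where
  carrier := {f | (∀ i ∈ I, ∀ x a b, f (Function.update x i (a + b))
      = f (Function.update x i a) + f (Function.update x i b)) ∧
      (∀ i ∉ I, ∀ x a, f (Function.update x i a) = f x)}
  add_mem' := by
    rintro f g ⟨hf1, hf2⟩ ⟨hg1, hg2⟩
    refine ⟨fun i hi x a b => ?_, fun i hi x a => ?_⟩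
    · simp only [Pi.add_apply, hf1 i hi x a b, hg1 i hi x a b]; ring
    · simp only [Pi.add_apply, hf2 i hi x a, hg2 i hi x a]
  zero_mem' := by simp
  smul_mem' := by
    rintro c f ⟨hf1, hf2⟩
    refine ⟨fun i hi x a b => ?_, fun i hi x a => ?_⟩
    · simp only [Pi.smul_apply, hf1 i hi x a b, smul_add]
    · simp only [Pi.smul_apply, hf2 i hi x a]

variable {m}

lemma ML_mul {I J : Finset (Fin d)} (h : Disjoint I J) {f g : Tup d m → ZMod 2}
    (hf : f ∈ ML m I) (hg : g ∈ ML m J) : f * g ∈ ML m (I ∪ J) := by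
  obtain ⟨hf1, hf2⟩ := hf
  obtain ⟨hg1, hg2⟩ := hg
  refine ⟨fun i hi x a b => ?_, fun i hi x a => ?_⟩
  · simp only [Pi.mul_apply]
    rcases Finset.mem_union.1 hi with hI | hJ
    · have hJ : i ∉ J := Finset.disjoint_left.1 h hI
      rw [hf1 i hI, hg2 i hJ, hg2 i hJ, hg2 i hJ]; ring
    · have hI : i ∉ I := Finset.disjoint_right.1 h hJ
      rw [hg1 i hJ, hf2 i hI, hf2 i hI, hf2 i hI]; ring
  · simp only [Finset.mem_union, not_or] at hi
    simp only [Pi.mul_apply, hf2 i hi.1, hg2 i hi.2]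

lemma ML_prod {ι : Type*} (S : Finset ι) (L : ι → Finset (Fin d)) (f : ι → Tup d m → ZMod 2)
    (hf : ∀ p ∈ S, f p ∈ ML m (L p)) (hS : (S : Set ι).PairwiseDisjoint L) :
    ∏ p ∈ S, f p ∈ ML m (S.biUnion L) := by
  classical
  induction S using Finset.induction_on with
  | empty =>
    refine ⟨by simp, by simp⟩
  | insert a S ha ih =>
    rw [Finset.prod_insert ha, Finset.biUnion_insert]
    refine ML_mul ?_ (hf a (by simp)) (ih (fun p hp => hf p (by simp [hp])) (hS.subset (by simp)))
    rw [Finset.disjoint_biUnion_right]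
    intro b hb
    exact hS (by simp) (by simp [hb]) (by rintro rfl; exact ha hb)

lemma sum_fiber (i : Fin d) (g : Tup d m → ℝ) :
    ∑ x : Tup d m, ∑ u : Fin (m i) → ZMod 2, g (Function.update x i u)
      = (Fintype.card (Fin (m i) → ZMod 2) : ℝ) * ∑ x, g x := by
  classical
  rw [← Fintype.sum_prod_type']
  have e : ∑ p : Tup d m × (Fin (m i) → ZMod 2), g (Function.update p.1 i p.2)
      = ∑ p : Tup d m × (Fin (m i) → ZMod 2), g p.1 := by
    refine Fintype.sum_bijective (fun p => (Function.update p.1 i p.2, p.1 i)) ?_ _ _ ?_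
    · refine Function.Involutive.bijective ?_
      rintro ⟨x, u⟩
      simp
    · intro p; rfl
  rw [e, Fintype.sum_prod_type]
  simp [Finset.mul_sum]

lemma card_pos' (i : Fin d) : (0:ℝ) < (Fintype.card (Fin (m i) → ZMod 2) : ℝ) := by
  exact_mod_cast Fintype.card_pos

lemma add_upd {I : Finset (Fin d)} {i : Fin d} (hi : i ∈ I) {f : Tup d m → ZMod 2}
    (hf : f ∈ ML m I) (x : Tup d m) :
    ∑ u, chi (f (Function.update x i u))
      = if ∀ u, f (Function.update x i u) = 0 then
        (Fintype.card (Fin (m i) → ZMod 2) : ℝ) else 0 :=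
  sum_chi_hom (fun u => f (Function.update x i u)) (hf.1 i hi x)

lemma bias_eq {I : Finset (Fin d)} {i : Fin d} (hi : i ∈ I) {f : Tup d m → ZMod 2}
    (hf : f ∈ ML m I) :
    ∑ x, chi (f x) = (Finset.card
      (Finset.univ.filter fun x : Tup d m => ∀ u, f (Function.update x i u) = 0) : ℝ) := by
  classical
  have h := sum_fiber (m := m) i (fun x => chi (f x))
  simp only [add_upd hi hf] at h
  rw [← Finset.sum_filter, Finset.sum_const, nsmul_eq_mul, mul_comm] at h
  exact (mul_left_cancel₀ (card_pos' i).ne' h).symm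

/-- one-step linearization -/
lemma bias_step (i : Fin d) (q r : Tup d m → ZMod 2)
    (hq : ∀ x a b, q (Function.update x i (a + b))
      = q (Function.update x i a) + q (Function.update x i b))
    (hr : ∀ x a, r (Function.update x i a) = r x) :
    |∑ x, chi (q x + r x)| ≤ ∑ x, chi (q x) := by
  classical
  have h1 := sum_fiber (m := m) i (fun x => chi (q x + r x))
  have h2 := sum_fiber (m := m) i (fun x => chi (q x))
  have hc := card_pos' (m := m) i
  have key : ∀ x : Tup d m, |∑ u, chi (q (Function.update x i u) + r (Function.update x i u))|
      ≤ ∑ u, chi (q (Function.update x i u)) := by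
    intro x
    have h3 : ∑ u, chi (q (Function.update x i u) + r (Function.update x i u))
      = chi (r x) * ∑ u, chi (q (Function.update x i u)) := by
      rw [Finset.mul_sum]
      refine Finset.sum_congr rfl fun u _ => ?_
      rw [hr, chi_add, mul_comm]
    rw [h3, abs_mul, abs_chi, one_mul, abs_of_nonneg]
    rw [sum_chi_hom (fun u => q (Function.update x i u)) (hq x)]
    split_ifs
    · exact hc.le
    · exact le_rfl
  have h4 : (Fintype.card (Fin (m i) → ZMod 2) : ℝ) * |∑ x, chi (q x + r x)|
      ≤ (Fintype.card (Fin (m i) → ZMod 2) : ℝ) * ∑ x, chi (q x) := by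
    rw [← h2]
    calc _ = |(Fintype.card (Fin (m i) → ZMod 2) : ℝ) * ∑ x, chi (q x + r x)| := by
            rw [abs_mul, abs_of_pos hc]
      _ ≤ _ := by
        rw [← h1]
        exact (Finset.abs_sum_le_sum_abs _ _).trans (Finset.sum_le_sum fun x _ => key x)
  exact le_of_mul_le_mul_left h4 hc

lemma bias_filter {ι : Type*} (C : Finset ι) (L : ι → Finset (Fin d))
    (f : ι → Tup d m → ZMod 2) (hf : ∀ p ∈ C, f p ∈ ML m (L p)) (J : Finset (Fin d)) :
    |∑ x, chi (∑ p ∈ C, f p x)| ≤ |∑ x, chi (∑ p ∈ C.filter (fun p => J ⊆ L p), f p x)| := by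
  classical
  induction J using Finset.induction_on with
  | empty => simp
  | insert i J hi ih =>
    refine ih.trans ?_
    have h := bias_step (m := m) i
      (fun x => ∑ p ∈ (C.filter (fun p => J ⊆ L p)).filter (fun p => i ∈ L p), f p x)
      (fun x => ∑ p ∈ (C.filter (fun p => J ⊆ L p)).filter (fun p => ¬ i ∈ L p), f p x)
      (by
        intro x a b
        rw [← Finset.sum_add_distrib]
        refine Finset.sum_congr rfl fun p hp => ?_
        simp only [Finset.mem_filter] at hp
        exact (hf p hp.1.1).1 i hp.2 x a b)
      (by
        intro x a
        refine Finset.sum_congr rfl fun p hp => ?_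
        simp only [Finset.mem_filter] at hp
        exact (hf p hp.1.1).2 i hp.2 x a)
    simp only [Finset.sum_filter_add_sum_filter_not] at h
    refine h.trans (le_trans (le_abs_self _) (le_of_eq ?_))
    rw [Finset.filter_filter]
    congr! 7
    rw [Finset.insert_subset_iff, and_comm]

end one

end Prf

namespace Prf
open scoped Classical
open Filter

abbrev Seq {d : ℕ} (n : ℕ → Fin d → ℕ) := (k : ℕ) → Tup d (n k) → ZMod 2

abbrev PP {d : ℕ} (n : ℕ → Fin d → ℕ) := Finset (Fin d) × Seq n

section two
variable {d : ℕ} (U : Ultrafilter ℕ) (n : ℕ → Fin d → ℕ)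

def MLs (I : Finset (Fin d)) : Submodule (ZMod 2) (Seq n) where
  carrier := {f | ∀ k, f k ∈ ML (n k) I}
  add_mem' := fun hf hg k => (ML (n k) I).add_mem (hf k) (hg k)
  zero_mem' := fun k => (ML (n k) I).zero_mem
  smul_mem' := fun c _ hf k => (ML (n k) I).smul_mem c (hf k)

def Null : Submodule (ZMod 2) (Seq n) where
  carrier := {f | ∀ᶠ k in (U : Filter ℕ), f k = 0}
  add_mem' := fun hf hg => by
    filter_upwards [hf, hg] with k h1 h2
    simp [h1, h2]
  zero_mem' := by simp
  smul_mem' := fun c _ hf => by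
    filter_upwards [hf] with k h1
    simp [h1]

def Dd (I : Finset (Fin d)) : Submodule (ZMod 2) (Seq n) :=
  Submodule.span (ZMod 2) {f | ∃ J, J ⊂ I ∧ J.Nonempty ∧ ∃ α ∈ MLs n J, ∃ β ∈ MLs n (I \ J),
    f = α * β} ⊔ Null U n

def Lab (I₀ : Finset (Fin d)) (F : Finset (PP n)) : Prop :=
  ∀ p ∈ F, p.1.Nonempty ∧ p.1 ⊆ I₀ ∧ p.2 ∈ MLs n p.1

def Reg (I₀ : Finset (Fin d)) (F : Finset (PP n)) : Prop :=
  Lab n I₀ F ∧ ∀ J, ∀ C ⊆ F, C.Nonempty → (∀ p ∈ C, p.1 = J) → ∑ p ∈ C, p.2 ∉ Dd U n J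

def adm (F : Finset (PP n)) (I : Finset (Fin d)) : Finset (Finset (PP n)) :=
  F.powerset.filter fun S => (S : Set (PP n)).PairwiseDisjoint Prod.fst ∧ S.biUnion Prod.fst = I

def mon (S : Finset (PP n)) : Seq n := ∏ p ∈ S, p.2

def Alg (F : Finset (PP n)) (I : Finset (Fin d)) : Submodule (ZMod 2) (Seq n) :=
  Submodule.span (ZMod 2) (mon n '' (adm n F I : Set (Finset (PP n)))) ⊔ Null U n

variable {U n}

lemma Alg_mono {F F' : Finset (PP n)} (h : F ⊆ F') (I) : Alg U n F I ≤ Alg U n F' I := by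
  refine sup_le_sup_right (Submodule.span_mono (Set.image_mono ?_)) _
  intro S hS
  simp only [adm, Finset.coe_filter, Finset.mem_powerset, Set.mem_ofPred_eq] at hS ⊢
  exact ⟨hS.1.trans h, hS.2⟩

lemma Null_mul {f : Seq n} (g : Seq n) (hf : f ∈ Null U n) : f * g ∈ Null U n := by
  have hf' : ∀ᶠ k in (U : Filter ℕ), f k = 0 := hf
  show ∀ᶠ k in (U : Filter ℕ), (f * g) k = 0
  filter_upwards [hf'] with k h1
  simp [h1]

lemma Alg_mul {I₀ : Finset (Fin d)} {F : Finset (PP n)} (hF : Lab n I₀ F) {I J : Finset (Fin d)}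
    (hIJ : Disjoint I J) {f g : Seq n} (hf : f ∈ Alg U n F I) (hg : g ∈ Alg U n F J) :
    f * g ∈ Alg U n F (I ∪ J) := by
  obtain ⟨f1, hf1, f2, hf2, rfl⟩ := Submodule.mem_sup.1 hf
  obtain ⟨g1, hg1, g2, hg2, rfl⟩ := Submodule.mem_sup.1 hg
  have e : (f1 + f2) * (g1 + g2) = f1 * g1 + (f2 * (g1 + g2) + g2 * f1) := by ring
  rw [e]
  refine Submodule.add_mem _ (Submodule.mem_sup_left ?_) (Submodule.mem_sup_right
    (Submodule.add_mem _ (Null_mul _ hf2) (Null_mul _ hg2)))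
  clear e hf hg hf2 hg2
  induction hf1 using Submodule.span_induction with
  | zero => simp
  | add x y _ _ hx hy => rw [add_mul]; exact Submodule.add_mem _ hx hy
  | smul c x _ hx => rw [smul_mul_assoc]; exact Submodule.smul_mem _ _ hx
  | mem x hx =>
    induction hg1 using Submodule.span_induction with
    | zero => simp
    | add x y _ _ hx hy => rw [mul_add]; exact Submodule.add_mem _ hx hy
    | smul c x _ hx => rw [mul_smul_comm]; exact Submodule.smul_mem _ _ hx
    | mem y hy =>
      obtain ⟨S, hS, rfl⟩ := hx
      obtain ⟨T, hT, rfl⟩ := hy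
      simp only [adm, Finset.coe_filter, Finset.mem_powerset, Set.mem_ofPred_eq] at hS hT
      have hlab : ∀ p ∈ S, ∀ q ∈ T, Disjoint p.1 q.1 := by
        intro p hp q hq
        refine hIJ.mono ?_ ?_
        · rw [← hS.2.2]; exact Finset.subset_biUnion_of_mem Prod.fst hp
        · rw [← hT.2.2]; exact Finset.subset_biUnion_of_mem Prod.fst hq
      have hdis : Disjoint S T := by
        rw [Finset.disjoint_left]
        intro p hp hq
        have h1 := hlab p hp p hq
        rw [disjoint_self] at h1
        exact (hF p (hS.1 hp)).1.ne_empty h1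
      refine Submodule.subset_span ⟨S ∪ T, ?_, ?_⟩
      · simp only [adm, Finset.coe_filter, Finset.mem_powerset, Set.mem_ofPred_eq]
        refine ⟨Finset.union_subset hS.1 hT.1, ?_, ?_⟩
        · rw [Finset.coe_union, Set.pairwiseDisjoint_union]
          exact ⟨hS.2.1, hT.2.1, fun p hp q hq _ => hlab p hp q hq⟩
        · rw [Finset.union_biUnion, hS.2.2, hT.2.2]
      · simp only [mon]; rw [Finset.prod_union hdis]

lemma gen_mem_Alg {F : Finset (PP n)} {p : PP n} (hp : p ∈ F) : p.2 ∈ Alg U n F p.1 := by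
  refine Submodule.mem_sup_left (Submodule.subset_span ⟨{p}, ?_, ?_⟩)
  · simp [adm, hp]
  · simp [mon]

lemma add_self_seq (f : Seq n) : f + f = 0 := by
  funext k x
  exact CharTwo.add_self_eq_zero _

/-- every multilinear sequence is a polynomial in a regular extension -/
lemma extend (I₀ : Finset (Fin d)) (N : ℕ) : ∀ I : Finset (Fin d), I.card = N → I.Nonempty → I ⊆ I₀ →
    ∀ a ∈ MLs n I, ∀ F, Reg U n I₀ F → ∃ F', F ⊆ F' ∧ Reg U n I₀ F' ∧ a ∈ Alg U n F' I := by
  induction N using Nat.strong_induction_on with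
  | _ N ih =>
  intro I hN hI hI0 a ha F hF
  have hD : ∀ b ∈ Dd U n I, ∀ F, Reg U n I₀ F →
      ∃ F', F ⊆ F' ∧ Reg U n I₀ F' ∧ b ∈ Alg U n F' I := by
    intro b hb
    obtain ⟨b1, hb1, b2, hb2, rfl⟩ := Submodule.mem_sup.1 hb
    suffices ∀ F, Reg U n I₀ F → ∃ F', F ⊆ F' ∧ Reg U n I₀ F' ∧ b1 ∈ Alg U n F' I by
      intro F hF
      obtain ⟨F', h1, h2, h3⟩ := this F hF
      exact ⟨F', h1, h2, Submodule.add_mem _ h3 (Submodule.mem_sup_right hb2)⟩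
    clear hb
    induction hb1 using Submodule.span_induction with
    | zero => intro F hF; exact ⟨F, subset_rfl, hF, Submodule.zero_mem _⟩
    | smul c x _ hx =>
      intro F hF
      obtain ⟨F', h1, h2, h3⟩ := hx F hF
      exact ⟨F', h1, h2, Submodule.smul_mem _ _ h3⟩
    | add x y _ _ hx hy =>
      intro F hF
      obtain ⟨F', h1, h2, h3⟩ := hx F hF
      obtain ⟨F'', h1', h2', h3'⟩ := hy F' h2
      exact ⟨F'', h1.trans h1', h2', Submodule.add_mem _ (Alg_mono h1' _ h3) h3'⟩
    | mem x hx =>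
      intro F hF
      obtain ⟨J, hJI, hJ, α, hα, β, hβ, rfl⟩ := hx
      obtain ⟨F', h1, h2, h3⟩ := ih J.card (hN ▸ Finset.card_lt_card hJI) J rfl hJ
        (hJI.1.trans hI0) α hα F hF
      have hne : (I \ J).Nonempty := Finset.sdiff_nonempty.2 hJI.2
      have hlt : (I \ J).card < N := by
        rw [← hN]
        refine Finset.card_lt_card (Finset.sdiff_ssubset hJI.1 hJ)
      obtain ⟨F'', h1', h2', h3'⟩ := ih (I \ J).card hlt (I \ J) rfl hne
        (Finset.sdiff_subset.trans hI0) β hβ F' h2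
      refine ⟨F'', h1.trans h1', h2', ?_⟩
      have := Alg_mul h2'.1 Finset.disjoint_sdiff (Alg_mono h1' _ h3) h3'
      rwa [Finset.union_sdiff_of_subset hJI.1] at this
  by_cases hc : ∃ C ⊆ F, (∀ p ∈ C, p.1 = I) ∧ a + ∑ p ∈ C, p.2 ∈ Dd U n I
  · obtain ⟨C, hCF, hC, hmem⟩ := hc
    obtain ⟨F', h1, h2, h3⟩ := hD _ hmem F hF
    refine ⟨F', h1, h2, ?_⟩
    have h4 : ∑ p ∈ C, p.2 ∈ Alg U n F' I := by
      refine Submodule.sum_mem _ fun p hp => ?_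
      rw [← hC p hp]
      exact gen_mem_Alg (h1 (hCF hp))
    have h5 := Submodule.add_mem _ h3 h4
    rwa [add_assoc, add_self_seq, add_zero] at h5
  · push Not at hc
    have hnot : (I, a) ∉ F := by
      intro h
      refine hc {(I, a)} (by simpa using h) (by simp) ?_
      simp [add_self_seq]
    refine ⟨insert (I, a) F, Finset.subset_insert _ _, ⟨?_, ?_⟩,
      gen_mem_Alg (p := (I, a)) (Finset.mem_insert_self _ _)⟩
    · intro p hp
      rcases Finset.mem_insert.1 hp with rfl | hp
      · exact ⟨hI, hI0, ha⟩
      · exact hF.1 p hp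
    · intro J C hCF hCne hC
      by_cases hin : (I, a) ∈ C
      · have hIJ : I = J := hC _ hin
        subst hIJ
        rw [← Finset.add_sum_erase _ _ hin]
        refine hc (C.erase (I, a)) ?_ (fun p hp => hC p (Finset.mem_of_mem_erase hp))
        rw [← Finset.subset_insert_iff]; exact hCF
      · refine hF.2 J C ?_ hCne hC
        exact (Finset.subset_insert_iff_of_notMem hin).1 hCF

variable (U n) in
/-- bias implies decomposable -/
def BR (J : Finset (Fin d)) : Prop := ∀ f ∈ MLs n J, ∀ η : ℝ, 0 < η →
  (∀ᶠ k in (U : Filter ℕ), η * (Fintype.card (Tup d (n k)) : ℝ) ≤ ∑ x, chi (f k x)) → f ∈ Dd U n J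

lemma card_tup_pos (m : Fin d → ℕ) : (0:ℝ) < (Fintype.card (Tup d m) : ℝ) := by
  exact_mod_cast Fintype.card_pos

lemma char_small {I₀ : Finset (Fin d)} (hBR : ∀ J ⊆ I₀, J.Nonempty → BR U n J)
    {F : Finset (PP n)} (hF : Reg U n I₀ F) {C : Finset (PP n)} (hCF : C ⊆ F) (hC : C.Nonempty)
    {ε : ℝ} (hε : 0 < ε) :
    ∀ᶠ k in (U : Filter ℕ), |∑ x, chi (∑ p ∈ C, p.2 k x)| ≤ ε * (Fintype.card (Tup d (n k)) : ℝ) := by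
  obtain ⟨p0, hp0, hmax⟩ := Finset.exists_max_image C (fun p => p.1.card) hC
  set C' := C.filter (fun p => p0.1 ⊆ p.1) with hC'
  have hlab : ∀ p ∈ C', p.1 = p0.1 := by
    intro p hp
    rw [hC', Finset.mem_filter] at hp
    exact (Finset.eq_of_subset_of_card_le hp.2 (hmax p hp.1)).symm
  have hne : C'.Nonempty := ⟨p0, by simp [hC', hp0]⟩
  have hC'F : C' ⊆ F := (Finset.filter_subset _ _).trans hCF
  have hnot := hF.2 p0.1 C' hC'F hne hlab
  have hml : ∑ p ∈ C', p.2 ∈ MLs n p0.1 := by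
    refine Submodule.sum_mem _ fun p hp => ?_
    rw [← hlab p hp]; exact (hF.1 p (hC'F hp)).2.2
  have h1 := hBR p0.1 (hF.1 p0 (hCF hp0)).2.1 (hF.1 p0 (hCF hp0)).1 _ hml ε hε
  have h2 := mt h1 hnot
  rw [← Ultrafilter.eventually_not] at h2
  filter_upwards [h2] with k hk
  push Not at hk
  have h3 := bias_filter (m := n k) C (fun p => p.1) (fun p => p.2 k)
    (fun p hp => (hF.1 p (hCF hp)).2.2 k) p0.1
  refine h3.trans ?_
  have hi : ∃ i, i ∈ p0.1 := (hF.1 p0 (hCF hp0)).1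
  obtain ⟨i, hi⟩ := hi
  have h4 : ∑ x, chi ((∑ p ∈ C', p.2) k x) = ∑ x, chi (∑ p ∈ C', p.2 k x) := by
    simp [Finset.sum_apply]
  rw [← hC', ← h4, abs_of_nonneg]
  · exact hk.le
  · rw [bias_eq hi (hml k)]; positivity

def val (F : Finset (PP n)) (k : ℕ) (x : Tup d (n k)) : Finset (PP n) :=
  F.filter fun p => p.2 k x = 1

lemma zmod2 (a : ZMod 2) : a = 0 ∨ a = 1 := by revert a; decide

lemma ind_eq (F : Finset (PP n)) (k : ℕ) (x : Tup d (n k)) (v : Finset (PP n)) (hv : v ⊆ F) :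
    (if val F k x = v then (1:ℝ) else 0) * 2 ^ F.card =
      ∑ C ∈ F.powerset, (∏ p ∈ C, chi (if p ∈ v then 1 else 0)) * chi (∑ p ∈ C, p.2 k x) := by
  have h1 : ∑ C ∈ F.powerset, (∏ p ∈ C, chi (if p ∈ v then 1 else 0)) * chi (∑ p ∈ C, p.2 k x)
      = ∏ p ∈ F, (1 + chi (if p ∈ v then 1 else 0) * chi (p.2 k x)) := by
    rw [Finset.prod_one_add]
    refine Finset.sum_congr rfl fun C _ => ?_
    rw [chi_sum, Finset.prod_mul_distrib]
  rw [h1]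
  split_ifs with h
  · rw [one_mul, ← Finset.prod_const]
    refine Finset.prod_congr rfl fun p hp => ?_
    have hm : p ∈ v ↔ p.2 k x = 1 := by rw [← h]; simp [val, hp]
    rcases zmod2 (p.2 k x) with h0 | h0
    · have : p ∉ v := by rw [hm, h0]; decide
      simp [this, h0, chi]; norm_num
    · have : p ∈ v := by rw [hm, h0]
      simp [this, h0, chi]; norm_num
  · rw [zero_mul]
    symm
    have : ∃ p ∈ F, ¬ (p ∈ v ↔ p.2 k x = 1) := by
      by_contra hcon
      push Not at hcon
      apply h
      ext p
      simp only [val, Finset.mem_filter]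
      constructor
      · rintro ⟨hp, h1⟩; exact (hcon p hp).2 h1
      · intro hp; exact ⟨hv hp, (hcon p (hv hp)).1 hp⟩
    obtain ⟨p, hp, hpv⟩ := this
    refine Finset.prod_eq_zero hp ?_
    rcases zmod2 (p.2 k x) with h0 | h0
    · have : p ∈ v := by
        by_contra hh; apply hpv; simp [hh, h0]
      simp [this, h0, chi]
    · have : p ∉ v := by
        intro hh; apply hpv; simp [hh, h0]
      simp [this, h0, chi]

lemma equidist {I₀ : Finset (Fin d)} (hBR : ∀ J ⊆ I₀, J.Nonempty → BR U n J)
    {F : Finset (PP n)} (hF : Reg U n I₀ F) {v : Finset (PP n)} (hv : v ⊆ F)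
    {ε : ℝ} (hε : 0 < ε) :
    ∀ᶠ k in (U : Filter ℕ), ((Finset.univ.filter fun x => val F k x = v).card : ℝ) * 2 ^ F.card
      ≤ (1 + ε) * (Fintype.card (Tup d (n k)) : ℝ) := by
  have h : ∀ᶠ k in (U : Filter ℕ), ∀ C ∈ F.powerset.erase ∅,
      |∑ x, chi (∑ p ∈ C, p.2 k x)| ≤ (ε / 2 ^ F.card) * (Fintype.card (Tup d (n k)) : ℝ) := by
    rw [Filter.eventually_all_finset]
    intro C hC
    simp only [Finset.mem_erase, Finset.mem_powerset] at hC
    exact char_small hBR hF hC.2 (Finset.nonempty_iff_ne_empty.2 hC.1) (by positivity)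
  filter_upwards [h] with k hk
  have h1 : ((Finset.univ.filter fun x => val F k x = v).card : ℝ) * 2 ^ F.card
      = ∑ C ∈ F.powerset, (∏ p ∈ C, chi (if p ∈ v then 1 else 0)) *
        ∑ x, chi (∑ p ∈ C, p.2 k x) := by
    rw [Finset.card_filter]
    push_cast
    rw [Finset.sum_mul]
    simp_rw [ind_eq F k _ v hv, Finset.mul_sum]
    rw [Finset.sum_comm]
  rw [h1, ← Finset.add_sum_erase _ _ (Finset.empty_mem_powerset F)]
  have h2 : ∑ C ∈ F.powerset.erase ∅, (∏ p ∈ C, chi (if p ∈ v then 1 else 0)) *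
        ∑ x, chi (∑ p ∈ C, p.2 k x) ≤ ε * (Fintype.card (Tup d (n k)) : ℝ) := by
    calc _ ≤ ∑ C ∈ F.powerset.erase ∅, (ε / 2 ^ F.card) * (Fintype.card (Tup d (n k)) : ℝ) := by
          refine Finset.sum_le_sum fun C hC => ?_
          refine (le_abs_self _).trans ?_
          rw [abs_mul, Finset.abs_prod]
          simp only [abs_chi, Finset.prod_const_one, one_mul]
          exact hk C hC
      _ = ((F.powerset.erase ∅).card : ℝ) * ((ε / 2 ^ F.card) * (Fintype.card (Tup d (n k)) : ℝ)) := by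
          rw [Finset.sum_const, nsmul_eq_mul]
      _ ≤ (2 ^ F.card : ℝ) * ((ε / 2 ^ F.card) * (Fintype.card (Tup d (n k)) : ℝ)) := by
          refine mul_le_mul_of_nonneg_right ?_ (by positivity)
          have := Finset.card_erase_le (s := F.powerset) (a := ∅)
          rw [Finset.card_powerset] at this
          exact_mod_cast this
      _ = _ := by field_simp
  simp only [Finset.prod_empty, Finset.sum_empty, chi_zero, one_mul, Finset.sum_const,
    Finset.card_univ, nsmul_eq_mul, mul_one]
  linarith

lemma dens_bound {I₀ : Finset (Fin d)} (hBR : ∀ J ⊆ I₀, J.Nonempty → BR U n J)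
    {F : Finset (PP n)} (hF : Reg U n I₀ F) {Z : Finset (Finset (PP n))} (hZ : Z ⊆ F.powerset)
    {ε : ℝ} (hε : 0 < ε) :
    ∀ᶠ k in (U : Filter ℕ), ((Finset.univ.filter fun x => val F k x ∈ Z).card : ℝ) * 2 ^ F.card
      ≤ (Z.card : ℝ) * ((1 + ε) * (Fintype.card (Tup d (n k)) : ℝ)) := by
  have h : ∀ᶠ k in (U : Filter ℕ), ∀ v ∈ Z,
      ((Finset.univ.filter fun x => val F k x = v).card : ℝ) * 2 ^ F.card
      ≤ (1 + ε) * (Fintype.card (Tup d (n k)) : ℝ) := by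
    rw [Filter.eventually_all_finset]
    intro v hv
    exact equidist hBR hF (Finset.mem_powerset.1 (hZ hv)) hε
  filter_upwards [h] with k hk
  have h1 : (Finset.univ.filter fun x => val F k x ∈ Z)
      = Z.biUnion fun v => Finset.univ.filter fun x => val F k x = v := by
    ext x; simp
  have h2 : ((Finset.univ.filter fun x => val F k x ∈ Z).card : ℝ) ≤
      ∑ v ∈ Z, ((Finset.univ.filter fun x => val F k x = v).card : ℝ) := by
    rw [h1]; exact_mod_cast Finset.card_biUnion_le
  calc _ ≤ (∑ v ∈ Z, ((Finset.univ.filter fun x => val F k x = v).card : ℝ)) * 2 ^ F.card := by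
        gcongr
    _ = ∑ v ∈ Z, ((Finset.univ.filter fun x => val F k x = v).card : ℝ) * 2 ^ F.card := by
        rw [Finset.sum_mul]
    _ ≤ ∑ v ∈ Z, (1 + ε) * (Fintype.card (Tup d (n k)) : ℝ) := Finset.sum_le_sum hk
    _ = _ := by rw [Finset.sum_const, nsmul_eq_mul]

end two
end Prf

namespace Prf
open scoped Classical
open Filter

section comb
variable {α : Type*} [DecidableEq α]

lemma parity_ne (v : Finset α) (A : Finset (Finset α)) (c : Finset α → ZMod 2) (S0 : Finset α)
    (hS0 : S0 ∈ A) (hc : c S0 ≠ 0) (hmax : ∀ S ∈ A, S0 ⊆ S → S = S0) :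
    ∃ t ⊆ S0, ∑ S ∈ A, c S * (if S ⊆ symmDiff v t then 1 else 0) ≠ 0 := by
  by_contra hcon
  push Not at hcon
  have h0 : ∑ t ∈ S0.powerset, ∑ S ∈ A, c S * (if S ⊆ symmDiff v t then 1 else 0) = 0 :=
    Finset.sum_eq_zero fun t ht => hcon t (Finset.mem_powerset.1 ht)
  rw [Finset.sum_comm] at h0
  simp_rw [← Finset.mul_sum] at h0
  rw [Finset.sum_eq_single_of_mem S0 hS0] at h0
  · rw [Finset.sum_eq_single_of_mem (S0 \ v) (by simp)] at h0
    · rw [if_pos] at h0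
      · simp at h0; exact hc h0
      · intro x hx
        simp only [Finset.mem_symmDiff, Finset.mem_sdiff]
        tauto
    · intro t ht hne
      rw [if_neg]
      intro hsub
      apply hne
      ext x
      simp only [Finset.mem_powerset] at ht
      have h1 := @hsub x
      have h2 := @ht x
      simp only [Finset.mem_symmDiff, Finset.mem_sdiff] at h1 ⊢
      tauto
  · intro S hS hne
    have : ∃ s ∈ S0, s ∉ S := by
      by_contra hh
      push Not at hh
      exact hne (hmax S hS hh)
    obtain ⟨s, hs, hsS⟩ := this
    have : ∑ t ∈ S0.powerset, (if S ⊆ symmDiff v t then (1 : ZMod 2) else 0) = 0 := by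
      refine Finset.sum_involution (fun t _ => symmDiff t {s}) ?_ ?_ ?_ ?_
      · intro t ht
        have : S ⊆ symmDiff v (symmDiff t {s}) ↔ S ⊆ symmDiff v t := by
          refine forall_congr' fun x => forall_congr' fun hx => ?_
          have hxs : x ≠ s := by rintro rfl; exact hsS hx
          simp only [Finset.mem_symmDiff, Finset.mem_singleton]
          tauto
        simp only [this]
        exact CharTwo.add_self_eq_zero _
      · intro t ht _ heq
        have h1 : s ∈ symmDiff t {s} ↔ s ∈ t := by rw [heq]
        simp only [Finset.mem_symmDiff, Finset.mem_singleton] at h1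
        tauto
      · intro t ht
        simp only [Finset.mem_powerset] at ht ⊢
        intro x hx
        simp only [Finset.mem_symmDiff, Finset.mem_singleton] at hx
        rcases hx with hx | hx
        · exact ht hx.1
        · rw [hx.1]; exact hs
      · intro t ht
        simp
    rw [this, mul_zero]

lemma count_step (F F' : Finset α) (hFF : F ⊆ F') (Z : Finset (Finset α))
    (A : Finset (Finset α)) (c : Finset α → ZMod 2) (S0 : Finset α)
    (hS0 : S0 ∈ A) (hc : c S0 ≠ 0) (hmax : ∀ S ∈ A, S0 ⊆ S → S = S0)
    (hS0F' : S0 ⊆ F') (hdis : Disjoint S0 F) (d : ℕ) (hd : S0.card ≤ d) :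
    ((F'.powerset.filter fun v => v ∩ F ∈ Z ∧
      ∑ S ∈ A, c S * (if S ⊆ v then 1 else 0) = 0).card : ℝ) / 2 ^ F'.card
      ≤ (1 - 1 / 2 ^ d) * ((Z.card : ℝ) / 2 ^ F.card) := by
  set W := F'.powerset.filter fun v => v ∩ F ∈ Z with hW
  have e : (F'.powerset.filter fun v => v ∩ F ∈ Z ∧
      ∑ S ∈ A, c S * (if S ⊆ v then 1 else 0) = 0)
      = W.filter fun v => ∑ S ∈ A, c S * (if S ⊆ v then 1 else 0) = 0 := by
    rw [hW, Finset.filter_filter]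
  rw [e]
  set W1 := W.filter fun v => ¬ ∑ S ∈ A, c S * (if S ⊆ v then 1 else 0) = 0 with hW1
  have h1 : (W.filter fun v => ∑ S ∈ A, c S * (if S ⊆ v then 1 else 0) = 0).card + W1.card
      = W.card := Finset.card_filter_add_card_filter_not _
  have h2 : W.card ≤ Z.card * 2 ^ (F' \ F).card := by
    rw [← Finset.card_powerset, ← Finset.card_product]
    refine Finset.card_le_card_of_injOn (fun v => (v ∩ F, v \ F)) ?_ ?_
    · intro v hv
      simp only [hW, Finset.coe_filter, Finset.mem_powerset, Set.mem_ofPred_eq] at hv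
      simp only [Finset.coe_product, Set.mem_prod, Finset.mem_coe, Finset.mem_powerset]
      exact ⟨hv.2, Finset.sdiff_subset_sdiff hv.1 subset_rfl⟩
    · intro v _ w _ h
      simp only [Prod.mk.injEq] at h
      rw [← Finset.sdiff_union_inter v F, h.1, h.2, Finset.sdiff_union_inter]
  have h3 : W.card ≤ W1.card * 2 ^ S0.card := by
    rw [← Finset.card_powerset, ← Finset.card_product]
    have hsub : W ⊆ (W1 ×ˢ S0.powerset).image (fun p => symmDiff p.1 p.2) := by
      intro v hv
      obtain ⟨t, ht, hpar⟩ := parity_ne v A c S0 hS0 hc hmax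
      rw [Finset.mem_image]
      refine ⟨(symmDiff v t, t), ?_, by simp⟩
      rw [Finset.mem_product]
      refine ⟨?_, Finset.mem_powerset.2 ht⟩
      rw [hW1, Finset.mem_filter]
      refine ⟨?_, hpar⟩
      rw [hW, Finset.mem_filter, Finset.mem_powerset] at hv ⊢
      constructor
      · intro x hx
        rcases Finset.mem_symmDiff.1 hx with h | h
        · exact hv.1 h.1
        · exact hS0F' (ht h.1)
      · have : symmDiff v t ∩ F = v ∩ F := by
          ext x
          have h5 : x ∈ F → x ∉ t := fun hx hxt => Finset.disjoint_left.1 hdis (ht hxt) hx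
          simp only [Finset.mem_inter, Finset.mem_symmDiff]
          tauto
        rw [this]; exact hv.2
    exact (Finset.card_le_card hsub).trans Finset.card_image_le
  have hcard : F'.card = F.card + (F' \ F).card := by
    rw [Finset.card_sdiff_of_subset hFF]; have := Finset.card_le_card hFF; omega
  have h3' : W.card ≤ W1.card * 2 ^ d :=
    h3.trans (Nat.mul_le_mul_left _ (Nat.pow_le_pow_right (by norm_num) hd))
  have h1r : ((W.filter fun v => ∑ S ∈ A, c S * (if S ⊆ v then 1 else 0) = 0).card : ℝ)
      + W1.card = W.card := by exact_mod_cast h1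
  have h2r : (W.card : ℝ) ≤ Z.card * 2 ^ (F' \ F).card := by exact_mod_cast h2
  have h3r : (W.card : ℝ) ≤ W1.card * 2 ^ d := by exact_mod_cast h3'
  have hd0 : (0:ℝ) < 2 ^ d := by positivity
  have h4 : (W.card : ℝ) * (1 / 2 ^ d) ≤ W1.card := by
    rw [mul_one_div, div_le_iff₀ hd0]; exact h3r
  have h5 : (0:ℝ) ≤ 1 - 1 / 2 ^ d := by
    rw [sub_nonneg, div_le_one hd0]; exact one_le_pow₀ (by norm_num)
  have h6 : (1 - 1 / 2 ^ d) * (W.card : ℝ) ≤ (1 - 1 / 2 ^ d) * (Z.card * 2 ^ (F' \ F).card) :=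
    mul_le_mul_of_nonneg_left h2r h5
  rw [div_le_iff₀ (by positivity), hcard, pow_add]
  have h7 : (1 - 1 / (2:ℝ) ^ d) * ((Z.card : ℝ) / 2 ^ F.card) * (2 ^ F.card * 2 ^ (F' \ F).card)
      = (1 - 1 / 2 ^ d) * (Z.card * 2 ^ (F' \ F).card) := by field_simp
  rw [h7]
  linarith
end comb

section three
variable {d : ℕ} {U : Ultrafilter ℕ} {n : ℕ → Fin d → ℕ}

variable (n) in
def Idl (F : Finset (PP n)) (k : ℕ) (I : Finset (Fin d)) :
    Submodule (ZMod 2) (Tup d (n k) → ZMod 2) where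
  carrier := {φ | ∃ g : PP n → Tup d (n k) → ZMod 2, (∀ p ∈ F, g p ∈ ML (n k) (I \ p.1)) ∧
    φ = ∑ p ∈ F, p.2 k * g p}
  add_mem' := by
    rintro _ _ ⟨g, hg, rfl⟩ ⟨h, hh, rfl⟩
    refine ⟨g + h, fun p hp => Submodule.add_mem _ (hg p hp) (hh p hp), ?_⟩
    simp [mul_add, Finset.sum_add_distrib]
  zero_mem' := ⟨0, fun p hp => Submodule.zero_mem _, by simp⟩
  smul_mem' := by
    rintro c _ ⟨g, hg, rfl⟩
    refine ⟨c • g, fun p hp => Submodule.smul_mem _ _ (hg p hp), ?_⟩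
    simp [Finset.smul_sum]

lemma mon_mem_Idl {I₀ I : Finset (Fin d)} {F F' S : Finset (PP n)} (hF' : Lab n I₀ F')
    (hS : S ∈ adm n F' I) {p : PP n} (hpS : p ∈ S) (hpF : p ∈ F) (k : ℕ) :
    mon n S k ∈ Idl n F k I := by
  simp only [adm, Finset.mem_filter, Finset.mem_powerset] at hS
  obtain ⟨hSF, hdis, hun⟩ := hS
  have hml : ∏ q ∈ S.erase p, q.2 k ∈ ML (n k) (I \ p.1) := by
    have h1 := ML_prod (m := n k) (S.erase p) Prod.fst (fun q => q.2 k)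
      (fun q hq => (hF' q (hSF (Finset.mem_of_mem_erase hq))).2.2 k)
      (hdis.subset (by simp))
    have h2 : (S.erase p).biUnion Prod.fst = I \ p.1 := by
      have h3 : Disjoint p.1 ((S.erase p).biUnion Prod.fst) := by
        rw [Finset.disjoint_biUnion_right]
        intro q hq
        exact hdis hpS (Finset.mem_of_mem_erase hq) (Finset.ne_of_mem_erase hq).symm
      rw [← hun]
      conv_rhs => rw [← Finset.insert_erase hpS]
      rw [Finset.biUnion_insert, Finset.union_sdiff_cancel_left h3]
    rwa [h2] at h1
  refine ⟨Pi.single p (∏ q ∈ S.erase p, q.2 k), ?_, ?_⟩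
  · intro q hq
    by_cases h : q = p
    · subst h; simpa using hml
    · rw [Pi.single_eq_of_ne h]; exact Submodule.zero_mem _
  · rw [Finset.sum_eq_single_of_mem p hpF]
    · rw [Pi.single_eq_same, mon, Finset.prod_apply, Finset.mul_prod_erase S (fun q => q.2 k) hpS]
    · intro q _ h
      rw [Pi.single_eq_of_ne h, mul_zero]

lemma mon_val {F' S : Finset (PP n)} (hS : S ⊆ F') (k : ℕ) (x : Tup d (n k)) :
    mon n S k x = if S ⊆ val F' k x then 1 else 0 := by
  rw [mon, Finset.prod_apply, Finset.prod_apply]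
  split_ifs with h
  · refine Finset.prod_eq_one fun p hp => ?_
    have := h hp
    simp only [val, Finset.mem_filter] at this
    exact this.2
  · rw [Finset.not_subset] at h
    obtain ⟨p, hp, hpv⟩ := h
    refine Finset.prod_eq_zero hp ?_
    simp only [val, Finset.mem_filter, not_and] at hpv
    exact (zmod2 _).resolve_right (hpv (hS hp))

/-- the structure theorem for sequences -/
theorem main_seq {I : Finset (Fin d)} (hI : I.Nonempty) (hBR : ∀ J ⊆ I, J.Nonempty → BR U n J)
    (Φ : (k : ℕ) → Set (Tup d (n k) → ZMod 2)) (hΦ : ∀ k, ∀ φ ∈ Φ k, φ ∈ ML (n k) I)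
    {η : ℝ} (hη : 0 < η)
    (hdens : ∀ᶠ k in (U : Filter ℕ), η * (Fintype.card (Tup d (n k)) : ℝ) ≤
      ((Finset.univ.filter fun x => ∀ φ ∈ Φ k, φ x = 0).card : ℝ)) :
    ∃ F : Finset (PP n), Lab n I F ∧ ∀ᶠ k in (U : Filter ℕ), ∀ φ ∈ Φ k, φ ∈ Idl n F k I := by
  by_contra hcon
  push Not at hcon
  have key : ∀ m : ℕ, ∃ F : Finset (PP n), Reg U n I F ∧ ∃ Z ⊆ F.powerset,
      ((Z.card : ℝ) / 2 ^ F.card ≤ (1 - 1 / 2 ^ d) ^ m) ∧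
      ∀ᶠ k in (U : Filter ℕ), ∀ x, (∀ φ ∈ Φ k, φ x = 0) → val F k x ∈ Z := by
    intro m
    induction m with
    | zero =>
      refine ⟨∅, ⟨by simp [Lab], ?_⟩, {∅}, by simp, by simp, ?_⟩
      · intro J C hC hne
        rw [Finset.subset_empty] at hC
        exact absurd hC hne.ne_empty
      · filter_upwards with k x _
        simp [val]
    | succ m ih =>
      obtain ⟨F, hF, Z, hZ, hcard, hval⟩ := ih
      have h1 : ∀ᶠ k in (U : Filter ℕ), ¬ ∀ φ ∈ Φ k, φ ∈ Idl n F k I := by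
        filter_upwards [hcon F hF.1] with k hk h
        obtain ⟨φ, h1, h2⟩ := hk
        exact h2 (h φ h1)
      have h2 : ∀ k, ∃ φ : Tup d (n k) → ZMod 2, φ ∈ ML (n k) I ∧
          ((¬ ∀ φ ∈ Φ k, φ ∈ Idl n F k I) → φ ∈ Φ k ∧ φ ∉ Idl n F k I) := by
        intro k
        by_cases h : ∀ φ ∈ Φ k, φ ∈ Idl n F k I
        · exact ⟨0, Submodule.zero_mem _, fun h' => absurd h h'⟩
        · have h' := h
          push Not at h'
          obtain ⟨φ, hφ, hφ2⟩ := h'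
          exact ⟨φ, hΦ k φ hφ, fun _ => ⟨hφ, hφ2⟩⟩
      choose φ hφML hφ using h2
      obtain ⟨F', hFF, hF', halg⟩ := extend I I.card I rfl hI subset_rfl φ hφML F hF
      obtain ⟨ψ, hψ, ν, hν, hsum⟩ := Submodule.mem_sup.1 halg
      rw [Submodule.mem_span_image_finset_iff_exists_fun'] at hψ
      obtain ⟨c, hc⟩ := hψ
      have hν' : ∀ᶠ k in (U : Filter ℕ), ν k = 0 := hν
      have hφeq : ∀ᶠ k in (U : Filter ℕ), φ k = ∑ S ∈ adm n F' I, c S • mon n S k := by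
        filter_upwards [hν'] with k hk
        rw [← hsum, Pi.add_apply, hk, add_zero, ← hc, Finset.sum_apply]
        rfl
      have hS0 : ∃ S0 ∈ adm n F' I, c S0 ≠ 0 ∧ Disjoint S0 F := by
        by_contra hno
        push Not at hno
        obtain ⟨k, hk1, hk2⟩ := (h1.and hφeq).exists
        apply (hφ k hk1).2
        rw [hk2]
        refine Submodule.sum_mem _ fun S hS => ?_
        by_cases hcS : c S = 0
        · rw [hcS, zero_smul]; exact Submodule.zero_mem _
        · refine Submodule.smul_mem _ _ ?_
          obtain ⟨p, hpS, hpF⟩ := Finset.not_disjoint_iff.1 (hno S hS hcS)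
          exact mon_mem_Idl hF'.1 hS hpS hpF k
      obtain ⟨S0, hS0, hcS0, hdis⟩ := hS0
      have hS0' := hS0
      simp only [adm, Finset.mem_filter, Finset.mem_powerset] at hS0'
      obtain ⟨hS0F', hpd, hun⟩ := hS0'
      have hmax : ∀ S ∈ adm n F' I, S0 ⊆ S → S = S0 := by
        intro S hS hsub
        simp only [adm, Finset.mem_filter, Finset.mem_powerset] at hS
        refine Finset.Subset.antisymm ?_ hsub
        intro p hp
        by_contra hpS0
        obtain ⟨i, hi⟩ := (hF'.1 p (hS.1 hp)).1
        have hiI : i ∈ S0.biUnion Prod.fst := by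
          rw [hun, ← hS.2.2]
          exact Finset.mem_biUnion.2 ⟨p, hp, hi⟩
        obtain ⟨q, hq, hiq⟩ := Finset.mem_biUnion.1 hiI
        have hpq : p ≠ q := by rintro rfl; exact hpS0 hq
        exact Finset.disjoint_left.1 (hS.2.1 hp (hsub hq) hpq) hi hiq
      have hcardS0 : S0.card ≤ d := by
        have h3 : S0.card ≤ (S0.biUnion Prod.fst).card := by
          rw [Finset.card_biUnion (fun p hp q hq hne => hpd hp hq hne), Finset.card_eq_sum_ones]
          refine Finset.sum_le_sum fun p hp => ?_
          exact (hF'.1 p (hS0F' hp)).1.card_pos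
        refine h3.trans ((Finset.card_le_univ _).trans (by simp))
      refine ⟨F', hF', _, Finset.filter_subset _ _, (count_step F F' hFF Z (adm n F' I) c S0 hS0
        hcS0 hmax hS0F' hdis d hcardS0).trans ?_, ?_⟩
      · rw [pow_succ, mul_comm]
        refine mul_le_mul_of_nonneg_right hcard ?_
        rw [sub_nonneg, div_le_one (by positivity)]; exact one_le_pow₀ (by norm_num)
      · filter_upwards [h1, hφeq, hval] with k hk1 hk2 hk3 x hx
        rw [Finset.mem_filter, Finset.mem_powerset]
        refine ⟨Finset.filter_subset _ _, ?_, ?_⟩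
        · have : val F' k x ∩ F = val F k x := by
            ext p
            have := @hFF p
            simp only [val, Finset.mem_inter, Finset.mem_filter]
            tauto
          rw [this]
          exact hk3 x hx
        · have h4 := hx _ (hφ k hk1).1
          rw [hk2, Finset.sum_apply] at h4
          refine Eq.trans (Finset.sum_congr rfl fun S hS => ?_) h4
          simp only [adm, Finset.mem_filter, Finset.mem_powerset] at hS
          rw [Pi.smul_apply, mon_val hS.1, smul_eq_mul]
  have hlt : (1 - 1 / 2 ^ d : ℝ) < 1 := by
    have : (0:ℝ) < 1 / 2 ^ d := by positivity
    linarith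
  obtain ⟨m, hm⟩ := exists_pow_lt_of_lt_one (half_pos hη) hlt
  obtain ⟨F, hF, Z, hZ, hcard, hval⟩ := key m
  obtain ⟨k, ⟨hk1, hk2⟩, hk3⟩ :=
    ((hdens.and hval).and (dens_bound hBR hF hZ (ε := 1) one_pos)).exists
  have h5 : ((Finset.univ.filter fun x => ∀ φ ∈ Φ k, φ x = 0).card : ℝ)
      ≤ ((Finset.univ.filter fun x => val F k x ∈ Z).card : ℝ) := by
    norm_cast
    refine Finset.card_le_card ?_
    intro x hx
    rw [Finset.mem_filter] at hx ⊢
    exact ⟨hx.1, hk2 x hx.2⟩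
  have hT := card_tup_pos (n k)
  have hp : (0:ℝ) < 2 ^ F.card := by positivity
  have h6 : (Z.card : ℝ) < η / 2 * 2 ^ F.card := by
    rw [← div_lt_iff₀ hp]; exact lt_of_le_of_lt hcard hm
  have h7 : η * (Fintype.card (Tup d (n k)) : ℝ) * 2 ^ F.card
      ≤ (Z.card : ℝ) * ((1 + 1) * (Fintype.card (Tup d (n k)) : ℝ)) :=
    (mul_le_mul_of_nonneg_right (hk1.trans h5) hp.le).trans hk3
  have h8 := mul_lt_mul_of_pos_right h6 (mul_pos (show (0:ℝ) < 1 + 1 by norm_num) hT)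
  have h9 : η / 2 * 2 ^ F.card * ((1 + 1) * (Fintype.card (Tup d (n k)) : ℝ))
    = η * (Fintype.card (Tup d (n k)) : ℝ) * 2 ^ F.card := by ring
  linarith

end three
end Prf

namespace Prf
open scoped Classical
open Filter

section four
variable {d : ℕ} {m : Fin d → ℕ}

lemma slice_ML {J : Finset (Fin d)} {i : Fin d} {f : Tup d m → ZMod 2} (hf : f ∈ ML m J)
    (u : Fin (m i) → ZMod 2) : (fun x => f (Function.update x i u)) ∈ ML m (J.erase i) := by
  obtain ⟨hf1, hf2⟩ := hf
  refine ⟨fun j hj x a b => ?_, fun j hj x a => ?_⟩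
  · have hne := Finset.ne_of_mem_erase hj
    simp only [Function.update_comm hne]
    exact hf1 j (Finset.mem_of_mem_erase hj) _ a b
  · by_cases hne : j = i
    · subst hne
      simp
    · simp only [Function.update_comm hne]
      exact hf2 j (fun h => hj (Finset.mem_erase.2 ⟨hne, h⟩)) _ a

lemma ML_dep {I : Finset (Fin d)} {f : Tup d m → ZMod 2} (hf : f ∈ ML m I) {x y : Tup d m}
    (hxy : ∀ i ∈ I, x i = y i) : f x = f y := by
  have key : ∀ T : Finset (Fin d), (∀ i ∈ T, i ∉ I) → f (T.piecewise y x) = f x := by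
    intro T
    induction T using Finset.induction_on with
    | empty => intro _; simp
    | insert a T ha ih =>
      intro h
      rw [Finset.piecewise_insert, hf.2 a (h a (by simp)), ih fun i hi => h i (by simp [hi])]
  have h := key (Finset.univ \ I) (by simp)
  rw [← h]
  congr 1
  ext i : 1
  by_cases hi : i ∈ I
  · rw [Finset.piecewise_eq_of_notMem _ _ _ (by simpa using hi), hxy i hi]
  · rw [Finset.piecewise_eq_of_mem _ _ _ (by simpa using hi)]

lemma ML_expand {I : Finset (Fin d)} {i : Fin d} (hi : i ∈ I) {f : Tup d m → ZMod 2}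
    (hf : f ∈ ML m I) (x : Tup d m) :
    f x = ∑ t, x i t * f (Function.update x i (Pi.single t 1)) := by
  let φ : (Fin (m i) → ZMod 2) →+ ZMod 2 :=
    AddMonoidHom.mk' (fun u => f (Function.update x i u)) (hf.1 i hi x)
  let ψ := φ.toZModLinearMap 2
  have h : ψ (x i) = f x := by
    change f (Function.update x i (x i)) = f x
    simp
  rw [← h]
  have hx : x i = ∑ t, x i t • (Pi.single t 1 : Fin (m i) → ZMod 2) := by
    ext s
    simp [Finset.sum_apply, Pi.single_apply]
  conv_lhs => rw [hx]
  rw [map_sum]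
  refine Finset.sum_congr rfl fun t _ => ?_
  rw [map_smul, smul_eq_mul]
  rfl

lemma ML_coord (i : Fin d) (t : Fin (m i)) : (fun x : Tup d m => x i t) ∈ ML m {i} := by
  refine ⟨fun j hj x a b => ?_, fun j hj x a => ?_⟩
  · rw [Finset.mem_singleton] at hj
    subst hj
    simp
  · rw [Finset.mem_singleton] at hj
    simp [Function.update_of_ne (Ne.symm hj)]

variable {U : Ultrafilter ℕ} {n : ℕ → Fin d → ℕ}

theorem BR_all : ∀ N : ℕ, ∀ J : Finset (Fin d), J.card = N → J.Nonempty → BR U n J := by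
  intro N
  induction N using Nat.strong_induction_on with
  | _ N ih =>
  intro J hJN hJ f hf η hη hb
  obtain ⟨i, hi⟩ := hJ
  by_cases hI : (J.erase i).Nonempty
  · have hlt : (J.erase i).card < J.card := Finset.card_erase_lt_of_mem hi
    obtain ⟨F, hF, hk⟩ := main_seq (U := U) (n := n) hI
      (fun J' hJ' hne => ih J'.card (by have := Finset.card_le_card hJ'; omega) J' rfl hne)
      (fun k => Set.range fun u => fun x => f k (Function.update x i u))
      (by rintro k _ ⟨u, rfl⟩; exact slice_ML (hf k) u) hη
      (by
        filter_upwards [hb] with k hk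
        rw [bias_eq hi (hf k)] at hk
        refine hk.trans (le_of_eq ?_)
        simp)
    have hG : ∀ k, ∃ G : PP n → Tup d (n k) → ZMod 2,
        (∀ p ∈ F, G p ∈ ML (n k) (J \ p.1)) ∧
        ((∀ φ ∈ Set.range (fun u => fun x => f k (Function.update x i u)),
          φ ∈ Idl n F k (J.erase i)) → f k = ∑ p ∈ F, p.2 k * G p) := by
      intro k
      by_cases h : (∀ φ ∈ Set.range (fun u => fun x => f k (Function.update x i u)),
          φ ∈ Idl n F k (J.erase i))
      · have h' : ∀ t : Fin (n k i), ∃ g : PP n → Tup d (n k) → ZMod 2,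
          (∀ p ∈ F, g p ∈ ML (n k) (J.erase i \ p.1)) ∧
          (fun x => f k (Function.update x i (Pi.single t 1))) = ∑ p ∈ F, p.2 k * g p :=
          fun t => h _ ⟨Pi.single t 1, rfl⟩
        choose g hg1 hg2 using h'
        refine ⟨fun p => ∑ t, (fun x : Tup d (n k) => x i t) * g t p, ?_, ?_⟩
        · intro p hp
          refine Submodule.sum_mem _ fun t _ => ?_
          have h3 := ML_mul (Finset.disjoint_left.2 fun j hj hj' => by
            rw [Finset.mem_singleton] at hj
            simp [hj] at hj') (ML_coord i t) (hg1 t p hp)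
          have h4 : {i} ∪ J.erase i \ p.1 = J \ p.1 := by
            have hip : i ∉ p.1 := fun hh => by
              have := (hF p hp).2.1 hh
              simp at this
            ext j
            by_cases hj : j = i
            · subst hj; simp [hip, hi]
            · simp [hj]
          rwa [h4] at h3
        · intro _
          ext x
          rw [ML_expand hi (hf k) x]
          simp only [Finset.sum_apply, Pi.mul_apply, Finset.mul_sum]
          rw [Finset.sum_comm]
          refine Finset.sum_congr rfl fun t _ => ?_
          have h5 := congrFun (hg2 t) x
          simp only [Finset.sum_apply, Pi.mul_apply] at h5
          rw [h5, Finset.mul_sum]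
          refine Finset.sum_congr rfl fun p _ => ?_
          ring
      · exact ⟨0, fun p _ => Submodule.zero_mem _, fun h' => absurd h' h⟩
    choose G hG1 hG2 using hG
    have hdec : f = (∑ p ∈ F, p.2 * (fun k => G k p))
        + (f - ∑ p ∈ F, p.2 * (fun k => G k p)) := by abel
    rw [hdec]
    refine Submodule.add_mem_sup (Submodule.sum_mem _ fun p hp => Submodule.subset_span ?_) ?_
    · refine ⟨p.1, ?_, (hF p hp).1, p.2, (hF p hp).2.2, _, fun k => hG1 k p hp, rfl⟩
      exact lt_of_le_of_lt (hF p hp).2.1 (Finset.erase_ssubset hi)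
    · change ∀ᶠ k in (U : Filter ℕ), _
      filter_upwards [hk] with k hk
      rw [Pi.sub_apply, hG2 k hk, Finset.sum_apply]
      simp
  · refine Submodule.mem_sup_right ?_
    change ∀ᶠ k in (U : Filter ℕ), _
    filter_upwards [hb] with k hk
    rw [bias_eq hi (hf k)] at hk
    have hpos : (0:ℝ) < (Finset.card (Finset.univ.filter fun x : Tup d (n k) =>
        ∀ u, f k (Function.update x i u) = 0) : ℝ) :=
      lt_of_lt_of_le (mul_pos hη (card_tup_pos (n k))) hk
    obtain ⟨x, hx⟩ := Finset.card_pos.1 (by exact_mod_cast hpos)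
    rw [Finset.mem_filter] at hx
    ext y
    rw [Pi.zero_apply, ← hx.2 (y i)]
    refine ML_dep (hf k) fun j hj => ?_
    by_cases hji : j = i
    · subst hji; simp
    · exact absurd ⟨j, Finset.mem_erase.2 ⟨hji, hj⟩⟩ hI

end four
end Prf

namespace Prf
open scoped Classical
open Filter

section five
variable {d : ℕ} {m : Fin d → ℕ}

lemma lin_expand (ℓ : Arr d m →ₗ[ZMod 2] ZMod 2) (r : Arr d m) :
    ℓ r = ∑ x, r x * ℓ (Pi.single x 1) := by
  have hx : r = ∑ x, r x • (Pi.single x 1 : Arr d m) := by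
    ext s
    simp [Finset.sum_apply, Pi.single_apply]
  conv_lhs => rw [hx]
  rw [map_sum]
  refine Finset.sum_congr rfl fun t _ => ?_
  rw [map_smul, smul_eq_mul]

lemma lin_ML (ℓ : Arr d m →ₗ[ZMod 2] ZMod 2) :
    (fun u => ℓ (tensorOf d m u)) ∈ ML m Finset.univ := by
  have h : (fun u => ℓ (tensorOf d m u))
      = ∑ x : ((i : Fin d) → Fin (m i)), ℓ (Pi.single x 1) • ∏ i, (fun u : Tup d m => u i (x i)) := by
    ext u
    rw [lin_expand ℓ]
    simp only [Finset.sum_apply, Pi.smul_apply, Finset.prod_apply, smul_eq_mul, tensorOf]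
    exact Finset.sum_congr rfl fun x _ => mul_comm _ _
  rw [h]
  refine Submodule.sum_mem _ fun x _ => Submodule.smul_mem _ _ ?_
  have h1 := ML_prod (m := m) Finset.univ (fun i : Fin d => ({i} : Finset (Fin d)))
    (fun i (u : Tup d m) => u i (x i)) (fun i _ => ML_coord i (x i))
    (by
      intro i _ j _ hij
      simpa [Function.onFun] using hij)
  convert h1
  ext i
  simp

def eps (x : (i : Fin d) → Fin (m i)) : Tup d m := fun i => Pi.single (x i) 1

lemma tensor_eps (x : (i : Fin d) → Fin (m i)) : tensorOf d m (eps x) = Pi.single x 1 := by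
  ext y
  rw [tensorOf]
  by_cases h : y = x
  · subst h
    simp [eps]
  · rw [Pi.single_eq_of_ne h]
    obtain ⟨i, hi⟩ := Function.ne_iff.1 h
    exact Finset.prod_eq_zero (Finset.mem_univ i) (by rw [eps, Pi.single_eq_of_ne hi])

def epsI (I : Finset (Fin d)) (y : (i : {x : Fin d // x ∈ I}) → Fin (m i.1)) : Tup d m :=
  fun i => if h : i ∈ I then Pi.single (y ⟨i, h⟩) 1 else 0

def epsO (I : Finset (Fin d)) (z : (i : {x : Fin d // x ∉ I}) → Fin (m i.1)) : Tup d m :=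
  fun i => if h : i ∈ I then 0 else Pi.single (z ⟨i, h⟩) 1

lemma sum_split (I : Finset (Fin d)) (r : Arr d m) {P g : Tup d m → ZMod 2} (hP : P ∈ ML m I)
    (hg : g ∈ ML m (Finset.univ \ I)) :
    ∑ x, r x * (P (eps x) * g (eps x)) =
      ∑ z, g (epsO I z) * ∑ y, arrSlice d m I r z y * P (epsI I y) := by
  rw [← Equiv.sum_comp (Equiv.piEquivPiSubtypeProd (fun i => i ∈ I) (fun i => Fin (m i))).symm,
    Fintype.sum_prod_type_right]
  refine Finset.sum_congr rfl fun z _ => ?_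
  rw [Finset.mul_sum]
  refine Finset.sum_congr rfl fun y _ => ?_
  have h1 : P (eps ((Equiv.piEquivPiSubtypeProd (fun i => i ∈ I) (fun i => Fin (m i))).symm (y, z)))
      = P (epsI I y) := by
    refine ML_dep hP fun i hi => ?_
    simp [eps, epsI, hi]
  have h2 : g (eps ((Equiv.piEquivPiSubtypeProd (fun i => i ∈ I) (fun i => Fin (m i))).symm (y, z)))
      = g (epsO I z) := by
    refine ML_dep hg fun i hi => ?_
    have hi' : i ∉ I := by simpa using hi
    simp [eps, epsO, hi']
  have h3 : r ((Equiv.piEquivPiSubtypeProd (fun i => i ∈ I) (fun i => Fin (m i))).symm (y, z))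
      = arrSlice d m I r z y := rfl
  rw [h1, h2, h3]
  ring

def TT {ι : Type*} (F : Finset ι) (L : ι → Finset (Fin d)) (P : ι → Tup d m → ZMod 2)
    (I : Finset (Fin d)) : F2I d m I →ₗ[ZMod 2] (F → ZMod 2) where
  toFun y := fun p => if L p = I then ∑ w, y w * P p (epsI I w) else 0
  map_add' := by
    intro y y'
    ext p
    by_cases h : L p = I <;> simp [h, add_mul, Finset.sum_add_distrib]
  map_smul' := by
    intro c y
    ext p
    by_cases h : L p = I <;> simp [h, mul_assoc, Finset.mul_sum]

lemma algebraic {ι : Type*} (F : Finset ι) (L : ι → Finset (Fin d)) (P : ι → Tup d m → ZMod 2)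
    (hL : ∀ p ∈ F, (L p).Nonempty) (hP : ∀ p ∈ F, P p ∈ ML m (L p))
    (V : Submodule (ZMod 2) (Arr d m))
    (hV : ∀ ℓ : Arr d m →ₗ[ZMod 2] ZMod 2, (∀ r ∈ V, ℓ r = 0) →
      ∃ g : ι → Tup d m → ZMod 2, (∀ p ∈ F, g p ∈ ML m (Finset.univ \ L p)) ∧
        (fun u => ℓ (tensorOf d m u)) = ∑ p ∈ F, P p * g p) :
    ∃ H : (I : Finset (Fin d)) → Submodule (ZMod 2) (F2I d m I),
      (∀ I : Finset (Fin d), I.Nonempty →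
        Module.finrank (ZMod 2) (F2I d m I) - Module.finrank (ZMod 2) (H I) ≤ F.card) ∧
      ∀ r : Arr d m, (∀ I : Finset (Fin d), I.Nonempty → r ∈ cylSub d m I (H I)) → r ∈ V := by
  refine ⟨fun I => LinearMap.ker (TT F L P I), fun I _ => ?_, fun r hr => ?_⟩
  · have h1 := LinearMap.finrank_range_add_finrank_ker (TT F L P I)
    have h2 := Submodule.finrank_le (LinearMap.range (TT F L P I))
    have h3 : Module.finrank (ZMod 2) (F → ZMod 2) = F.card := by simp
    beta_reduce
    omega
  · by_contra hrV
    obtain ⟨ℓ, hℓr, hℓV⟩ := Submodule.exists_le_ker_of_notMem hrV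
    obtain ⟨g, hg1, hg2⟩ := hV ℓ fun r hr => LinearMap.mem_ker.1 (hℓV hr)
    apply hℓr
    rw [lin_expand ℓ]
    have h1 : ∀ x, ℓ (Pi.single x 1) = ∑ p ∈ F, P p (eps x) * g p (eps x) := by
      intro x
      have := congrFun hg2 (eps x)
      rw [tensor_eps] at this
      rw [this]
      simp
    simp_rw [h1, Finset.mul_sum]
    rw [Finset.sum_comm]
    refine Finset.sum_eq_zero fun p hp => ?_
    rw [sum_split (L p) r (hP p hp) (hg1 p hp)]
    refine Finset.sum_eq_zero fun z _ => ?_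
    have h2 : TT F L P (L p) (arrSlice d m (L p) r z) = 0 := hr (L p) (hL p hp) z
    have h3 := congrFun h2 ⟨p, hp⟩
    simp only [TT, LinearMap.coe_mk, AddHom.coe_mk, if_true, Pi.zero_apply] at h3
    rw [h3, mul_zero]

lemma card_ge (hm : ∀ i, 0 < m i) :
    (1 / 2 ^ d : ℝ) * (Fintype.card (Tup d m) : ℝ) ≤ ∏ i, ((2:ℝ) ^ (m i) - 1) := by
  have h1 : (Fintype.card (Tup d m) : ℝ) = ∏ i, (2:ℝ) ^ (m i) := by
    rw [Fintype.card_pi]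
    simp
  have h2 : (1 / 2 ^ d : ℝ) = ∏ _i : Fin d, (1 / 2 : ℝ) := by simp
  rw [h1, h2, ← Finset.prod_mul_distrib]
  refine Finset.prod_le_prod (fun i _ => by positivity) fun i _ => ?_
  have : (2:ℝ) ≤ 2 ^ m i := by
    calc (2:ℝ) = 2 ^ 1 := by norm_num
      _ ≤ 2 ^ m i := pow_le_pow_right₀ (by norm_num) (hm i)
  linarith

theorem final (η : ℝ) (hη : 0 < η) (hd : 0 < d) :
    ∃ k : ℕ, 0 < k ∧
      ∀ n : Fin d → ℕ, (∀ i, 0 < n i) →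
        ∀ V : Submodule (ZMod 2) (Arr d n),
          (η * ∏ i, ((2:ℝ) ^ (n i) - 1) ≤
            (Set.ncard {u : Tup d n | (∀ i, u i ≠ 0) ∧ tensorOf d n u ∈ V} : ℝ)) →
          ∃ H : (I : Finset (Fin d)) → Submodule (ZMod 2) (F2I d n I),
            (∀ I : Finset (Fin d), I.Nonempty →
              Module.finrank (ZMod 2) (F2I d n I) - Module.finrank (ZMod 2) (H I) ≤ k) ∧
            ∀ r : Arr d n,
              (∀ I : Finset (Fin d), I.Nonempty → r ∈ cylSub d n I (H I)) → r ∈ V := by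
  by_contra hcon
  have hc : ∀ k : ℕ, ∃ n : Fin d → ℕ, (∀ i, 0 < n i) ∧ ∃ V : Submodule (ZMod 2) (Arr d n),
          (η * ∏ i, ((2:ℝ) ^ (n i) - 1) ≤
            (Set.ncard {u : Tup d n | (∀ i, u i ≠ 0) ∧ tensorOf d n u ∈ V} : ℝ)) ∧
          ¬ ∃ H : (I : Finset (Fin d)) → Submodule (ZMod 2) (F2I d n I),
            (∀ I : Finset (Fin d), I.Nonempty →
              Module.finrank (ZMod 2) (F2I d n I) - Module.finrank (ZMod 2) (H I) ≤ k + 1) ∧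
            ∀ r : Arr d n,
              (∀ I : Finset (Fin d), I.Nonempty → r ∈ cylSub d n I (H I)) → r ∈ V := by
    intro k
    by_contra hk
    refine hcon ⟨k + 1, Nat.succ_pos k, fun n hn V hV => ?_⟩
    by_contra hH
    exact hk ⟨n, hn, V, hV, hH⟩
  choose n hn V hV hH using hc
  let U : Ultrafilter ℕ := Filter.hyperfilter ℕ
  have hne : (Finset.univ : Finset (Fin d)).Nonempty := ⟨⟨0, hd⟩, Finset.mem_univ _⟩
  obtain ⟨F, hF, hk⟩ := main_seq (U := U) (n := n) hne (fun J _ hJ => BR_all J.card J rfl hJ)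
    (fun k => {φ | ∃ ℓ : Arr d (n k) →ₗ[ZMod 2] ZMod 2, (∀ r ∈ V k, ℓ r = 0) ∧
      φ = fun u => ℓ (tensorOf d (n k) u)})
    (by rintro k _ ⟨ℓ, _, rfl⟩; exact lin_ML ℓ)
    (η := η * (1 / 2 ^ d)) (by positivity)
    (by
      filter_upwards with k
      rw [mul_assoc]
      refine (mul_le_mul_of_nonneg_left (card_ge (hn k)) hη.le).trans ((hV k).trans ?_)
      norm_cast
      rw [← Set.ncard_coe_finset]
      refine Set.ncard_le_ncard ?_ (Finset.finite_toSet _)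
      rintro u ⟨_, hu⟩
      rw [Finset.mem_coe, Finset.mem_filter]
      refine ⟨Finset.mem_univ _, ?_⟩
      rintro _ ⟨ℓ, hℓ, rfl⟩
      exact hℓ _ hu)
  have hge : ∀ᶠ k in (U : Filter ℕ), F.card ≤ k :=
    (Filter.eventually_ge_atTop F.card).filter_mono Nat.hyperfilter_le_atTop
  obtain ⟨k, hk1, hk2⟩ := (hk.and hge).exists
  obtain ⟨H, hH1, hH2⟩ := algebraic F Prod.fst (fun p => p.2 k) (fun p hp => (hF p hp).1)
    (fun p hp => (hF p hp).2.2 k) (V k) (fun ℓ hℓ => hk1 _ ⟨ℓ, hℓ, rfl⟩)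
  exact hH k ⟨H, fun I hI => (hH1 I hI).trans (by omega), hH2⟩

end five
end Prf

end

theorem stmt6 (η : ℝ) (hη : 0 < η) (d : ℕ) (hd : 0 < d) :
    ∃ k : ℕ, 0 < k ∧
      ∀ n : Fin d → ℕ, (∀ i, 0 < n i) →
        ∀ V : Submodule (ZMod 2) (Arr d n),
          (η * ∏ i, ((2:ℝ) ^ (n i) - 1) ≤
            (Set.ncard {u : Tup d n | (∀ i, u i ≠ 0) ∧ tensorOf d n u ∈ V} : ℝ)) →
          ∃ H : (I : Finset (Fin d)) → Submodule (ZMod 2) (F2I d n I),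
            (∀ I : Finset (Fin d), I.Nonempty →
              Module.finrank (ZMod 2) (F2I d n I) - Module.finrank (ZMod 2) (H I) ≤ k) ∧
            ∀ r : Arr d n,
              (∀ I : Finset (Fin d), I.Nonempty → r ∈ cylSub d n I (H I)) → r ∈ V := by
  exact Prf.final η hη hd
end

section
/- For every positive integer d there exist a positive integer f_1 and a real number f_3 ∈ (0,1) such that for every δ > 0 there exists a positive integer f_2 with the following property: for all positive integers n_1,…,n_d and every submultiset ℬ' ⊆ ℬ with |ℬ'| ≥ δ|ℬ|, there exists a nonempty finite multiset Q of elements of f_1ℬ' that is (f_2, 1−f_3)-forcing; that is, there exist subspaces V_I ⊆ F_2^I of dimension at most f_2, one for each nonempty I ⊆ [d], such that every array r ∈ 𝒢 satisfying r·q = 0 for at least (1−f_3)|Q| elements q of Q (counted with multiplicity) lies in Σ_{∅≠I⊆[d]} V_I⊗F_2^{I^c}. -/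
open Finset

/-- The set `mℬ'`: elements of `𝒢` expressible as a sum of at most `m` rank-one tensors
with tuples from `B'`. -/
def sumAtMost (d : ℕ) (n : Fin d → ℕ) (m : ℕ) (B' : Finset (Tup d n)) : Set (Arr d n) :=
  {x | ∃ s : Multiset (Tup d n), Multiset.card s ≤ m ∧ (∀ u ∈ s, u ∈ B') ∧
    x = (s.map (tensorOf d n)).sum}

/-- The entrywise dot product of two arrays. -/
def arrDot (d : ℕ) (n : Fin d → ℕ) (r q : Arr d n) : ZMod 2 :=
  ∑ x, r x * q x


set_option linter.unusedSectionVars false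
set_option linter.unusedVariables false

namespace PF

variable {d : ℕ} {n : Fin d → ℕ}

/-- multilinear in the coordinates in `J`, independent of the others -/
def ML (J : Finset (Fin d)) (f : Tup d n → ZMod 2) : Prop :=
  (∀ u v : Tup d n, (∀ i ∈ J, u i = v i) → f u = f v) ∧
  ∀ i ∈ J, ∀ (u : Tup d n) (a b : Fin (n i) → ZMod 2),
    f (Function.update u i (a + b)) = f (Function.update u i a) + f (Function.update u i b)

/-- partition rank at most `L` -/
def Rk (J : Finset (Fin d)) (L : ℕ) (f : Tup d n → ZMod 2) : Prop :=
  ∃ k : ℕ, k ≤ L ∧ ∃ (K : Fin k → Finset (Fin d)) (v w : Fin k → Tup d n → ZMod 2),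
    (∀ l, (K l).Nonempty ∧ K l ⊂ J ∧ ML (K l) (v l) ∧ ML (J \ K l) (w l)) ∧
    f = ∑ l, v l * w l

/-- sign character -/
noncomputable def sg (a : ZMod 2) : ℝ := if a = 0 then 1 else -1

lemma zcases (a : ZMod 2) : a = 0 ∨ a = 1 := by
  revert a; decide

lemma sg_zero : sg 0 = 1 := by simp [sg]
lemma sg_one : sg 1 = -1 := by simp [sg]

lemma sg_add (a b : ZMod 2) : sg (a + b) = sg a * sg b := by
  rcases zcases a with rfl | rfl <;> rcases zcases b with rfl | rfl
  · simp [sg]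
  · simp [sg]
  · simp [sg]
  · have : (1 + 1 : ZMod 2) = 0 := by decide
    rw [this]; simp [sg]

lemma sg_abs (a : ZMod 2) : |sg a| = 1 := by
  unfold sg; split_ifs <;> simp

lemma sg_sum {ι : Type*} (S : Finset ι) (f : ι → ZMod 2) :
    sg (∑ x ∈ S, f x) = ∏ x ∈ S, sg (f x) := by
  classical
  induction S using Finset.induction_on with
  | empty => simp [sg]
  | insert a S ha ih => rw [Finset.sum_insert ha, Finset.prod_insert ha, sg_add, ih]

/-- average -/
noncomputable def ex {Ω : Type*} [Fintype Ω] (h : Ω → ℝ) : ℝ := (∑ u, h u) / (Fintype.card Ω : ℝ)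

section ex
variable {Ω : Type*} [Fintype Ω]

lemma cpos [Nonempty Ω] : (0 : ℝ) < (Fintype.card Ω : ℝ) := by
  exact_mod_cast Fintype.card_pos

lemma ex_mono {f g : Ω → ℝ} (h : ∀ u, f u ≤ g u) : ex f ≤ ex g := by
  unfold ex
  gcongr with u
  exact h u

lemma ex_add (f g : Ω → ℝ) : ex (fun u => f u + g u) = ex f + ex g := by
  unfold ex; rw [Finset.sum_add_distrib, add_div]

lemma ex_sub (f g : Ω → ℝ) : ex (fun u => f u - g u) = ex f - ex g := by
  unfold ex; rw [Finset.sum_sub_distrib, sub_div]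

lemma ex_mul (c : ℝ) (f : Ω → ℝ) : ex (fun u => c * f u) = c * ex f := by
  unfold ex; rw [← Finset.mul_sum, mul_div_assoc]

lemma ex_const [Nonempty Ω] (c : ℝ) : ex (fun _ : Ω => c) = c := by
  unfold ex
  have := cpos (Ω := Ω)
  rw [Finset.sum_const, Finset.card_univ, nsmul_eq_mul]
  field_simp

lemma ex_sum {ι : Type*} (S : Finset ι) (f : ι → Ω → ℝ) :
    ex (fun u => ∑ x ∈ S, f x u) = ∑ x ∈ S, ex (f x) := by
  unfold ex; rw [Finset.sum_comm, Finset.sum_div]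

lemma ex_nonneg {f : Ω → ℝ} (h : ∀ u, 0 ≤ f u) : 0 ≤ ex f := by
  unfold ex
  exact div_nonneg (Finset.sum_nonneg fun u _ => h u) (by positivity)

lemma ex_comm {Ω' : Type*} [Fintype Ω'] (f : Ω → Ω' → ℝ) :
    ex (fun u => ex (fun v => f u v)) = ex (fun v => ex (fun u => f u v)) := by
  unfold ex
  simp_rw [← Finset.sum_div]
  rw [Finset.sum_comm, div_div, div_div, mul_comm]

lemma ex_cs [Nonempty Ω] (f g : Ω → ℝ) :
    (ex (fun u => f u * g u)) ^ 2 ≤ ex (fun u => f u ^ 2) * ex (fun u => g u ^ 2) := by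
  unfold ex
  rw [div_pow, div_mul_div_comm, ← pow_two]
  gcongr
  exact Finset.sum_mul_sq_le_sq_mul_sq _ _ _

lemma ex_pow [Nonempty Ω] (f : Ω → ℝ) (k : ℕ) :
    (ex f) ^ (2 ^ k) ≤ ex (fun u => f u ^ (2 ^ k)) := by
  induction k generalizing f with
  | zero => simp
  | succ k ih =>
    have h1 : (ex f) ^ 2 ≤ ex (fun u => f u ^ 2) := by
      have := ex_cs (fun _ : Ω => (1 : ℝ)) f
      simpa [ex_const] using this
    rw [pow_succ', pow_mul]
    calc ((ex f) ^ 2) ^ 2 ^ k ≤ (ex (fun u => f u ^ 2)) ^ 2 ^ k := by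
          gcongr
      _ ≤ _ := ih _
      _ = _ := by simp_rw [← pow_mul]

lemma ex_shift [AddGroup Ω] (c : Ω) (f : Ω → ℝ) : ex (fun u => f (u + c)) = ex f := by
  unfold ex
  congr 1
  exact Equiv.sum_comp (Equiv.addRight c) f

end ex

lemma add_single (u : Tup d n) (i : Fin d) (w : Fin (n i) → ZMod 2) :
    u + Pi.single i w = Function.update u i (u i + w) := by
  ext j x
  by_cases h : j = i
  · subst h; simp
  · simp [h]

lemma ex_shiftT (c : Tup d n) (f : Tup d n → ℝ) : ex (fun u => f (u + c)) = ex f :=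
  ex_shift c f

section absgrp
variable {Ω W : Type*} [Fintype Ω] [Fintype W] [AddCommGroup Ω] [AddCommGroup W]

lemma csStep1 (φ : W → Ω) (hφ : ∀ a b, φ (a + b) = φ a + φ b) (F : Ω → ℝ) (u : Ω) (w : W) :
    ex (fun w' : W => F (u + φ w + φ w')) = ex (fun w' : W => F (u + φ w')) := by
  refine Eq.trans ?_ (ex_shift w (fun w' : W => F (u + φ w')))
  congr 1; ext w'
  rw [add_comm w' w, hφ, add_assoc]

lemma csStep2 (φ : W → Ω) (hφ : ∀ a b, φ (a + b) = φ a + φ b) (F : Ω → ℝ) :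
    ex (fun u : Ω => (ex (fun w : W => F (u + φ w))) ^ 2) =
      ex (fun w : W => ex (fun u => F u * F (u + φ w))) := by
  have h1 : ∀ u : Ω, (ex (fun w : W => F (u + φ w))) ^ 2 =
      ex (fun w : W => (fun v : Ω => ex (fun w' : W => F v * F (v + φ w'))) (u + φ w)) := by
    intro u
    simp only [ex_mul, csStep1 φ hφ]
    rw [pow_two, ← ex_mul]
    congr 1; ext w; rw [mul_comm]
  simp_rw [h1]
  rw [ex_comm]
  have h2 : ∀ w : W, ex (fun u : Ω => (fun v : Ω =>
        ex (fun w' : W => F v * F (v + φ w'))) (u + φ w)) =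
      ex (fun v : Ω => ex (fun w' : W => F v * F (v + φ w'))) :=
    fun w => ex_shift (φ w) (fun v : Ω => ex (fun w' : W => F v * F (v + φ w')))
  have h3 := congrArg (fun f : W → ℝ => ex f) (funext h2)
  refine h3.trans ?_
  rw [ex_const, ex_comm]

lemma csStepA (φ : W → Ω) (hφ : ∀ a b, φ (a + b) = φ a + φ b) (g F : Ω → ℝ) (hg : ∀ u, |g u| ≤ 1)
    (hi' : ∀ u w, g (u + φ w) = g u) :
    (ex (fun u => g u * F u)) ^ 2 ≤
      ex (fun w : W => ex (fun u => F u * F (u + φ w))) := by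
  rw [← csStep2 φ hφ]
  have h1 : ex (fun u => g u * F u) =
      ex (fun u => g u * ex (fun w : W => F (u + φ w))) := by
    have h0 : ∀ u, g u * ex (fun w : W => F (u + φ w))
        = ex (fun w : W => (fun v => g v * F v) (u + φ w)) := by
      intro u
      simp only [hi', ex_mul]
    simp_rw [h0]
    rw [ex_comm]
    have h2 : ∀ w : W, ex (fun u : Ω =>
        (fun v => g v * F v) (u + φ w)) = ex (fun u => g u * F u) :=
      fun w => ex_shift (φ w) (fun u => g u * F u)
    have h3 := congrArg (fun f : W → ℝ => ex f) (funext h2)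
    refine Eq.trans ?_ h3.symm
    rw [ex_const]
  have h2 : ex (fun u => g u ^ 2) ≤ 1 := by
    calc _ ≤ ex (fun _ : Ω => (1 : ℝ)) := ex_mono fun u => (sq_le_one_iff_abs_le_one _).2 (hg u)
      _ = 1 := ex_const 1
  rw [h1]
  have h4 := ex_cs g (fun u => ex (fun w : W => F (u + φ w)))
  have h5 : 0 ≤ ex (fun u : Ω => (ex (fun w : W => F (u + φ w))) ^ 2) :=
    ex_nonneg fun u => sq_nonneg _
  exact h4.trans (mul_le_of_le_one_left h5 h2)

end absgrp

lemma csStep (i : Fin d) (g F : Tup d n → ℝ) (hg : ∀ u, |g u| ≤ 1)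
    (hi : ∀ u a, g (Function.update u i a) = g u) :
    (ex (fun u => g u * F u)) ^ 2 ≤
      ex (fun w : Fin (n i) → ZMod 2 => ex (fun u => F u * F (u + Pi.single i w))) := by
  refine csStepA (fun w : Fin (n i) → ZMod 2 => (Pi.single i w : Tup d n)) ?_ g F hg ?_
  · intro a b; exact Pi.single_add (f := fun i => Fin (n i) → ZMod 2) i a b
  · intro u w
    rw [add_single, hi]

lemma ex_slice (i : Fin d) (F : Tup d n → ℝ) :
    ex (fun w : Fin (n i) → ZMod 2 => ex (fun u => F (Function.update u i w))) = ex F := by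
  rw [ex_comm]
  have h : ∀ u : Tup d n, ex (fun w : Fin (n i) → ZMod 2 => F (Function.update u i w)) =
      ex (fun w : Fin (n i) → ZMod 2 => F (u + Pi.single i w)) := by
    intro u
    rw [← ex_shift (u i) (fun w => F (Function.update u i w))]
    congr 1; ext w; rw [add_single, add_comm]
  simp_rw [h]
  rw [ex_comm]
  have h2 : ∀ w : Fin (n i) → ZMod 2, ex (fun u : Tup d n => F (u + Pi.single i w)) = ex F :=
    fun w => ex_shiftT _ _
  have h3 := congrArg (fun f : (Fin (n i) → ZMod 2) → ℝ => ex f) (funext h2)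
  refine h3.trans ?_
  rw [ex_const]

lemma ML.slice {J : Finset (Fin d)} {i : Fin d} (hi : i ∉ J) {q : Tup d n → ZMod 2}
    (hq : ML (insert i J) q) (w : Fin (n i) → ZMod 2) :
    ML J (fun u => q (Function.update u i w)) := by
  refine ⟨fun u v h => hq.1 _ _ fun j hj => ?_, fun j hj u a b => ?_⟩
  · by_cases hji : j = i
    · subst hji; simp
    · simp only [Function.update_of_ne hji]
      exact h j ((Finset.mem_insert.1 hj).resolve_left hji)
  · have hne : j ≠ i := fun h => hi (h ▸ hj)
    simp only [Function.update_comm hne]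
    exact hq.2 j (Finset.mem_insert_of_mem hj) _ a b

lemma cs (J : Finset (Fin d)) : ∀ q : Tup d n → ZMod 2, ML J q → ∀ h : Fin d → Tup d n → ℝ,
    (∀ j ∈ J, ∀ u, |h j u| ≤ 1) → (∀ j ∈ J, ∀ u a, h j (Function.update u j a) = h j u) →
    (ex fun u => sg (q u) * ∏ j ∈ J, h j u) ^ (2 ^ J.card) ≤ ex (fun u => sg (q u)) := by
  induction J using Finset.induction_on with
  | empty => intro q _ h _ _; simp
  | insert i J hi ih =>
    intro q hq h hb hc
    set F : Tup d n → ℝ := fun u => sg (q u) * ∏ j ∈ J, h j u with hF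
    have e1 : (ex fun u => sg (q u) * ∏ j ∈ insert i J, h j u) = ex (fun u => h i u * F u) := by
      congr 1; ext u; rw [Finset.prod_insert hi]; simp only [hF]; ring
    rw [e1, Finset.card_insert_of_notMem hi]
    have s1 := csStep i (h i) F (hb i (by simp)) (hc i (by simp))
    have key : ∀ a b : ℝ, a ^ 2 ≤ b → a ^ (2 ^ (J.card + 1)) ≤ b ^ (2 ^ J.card) := by
      intro a b hab
      rw [pow_succ', pow_mul]
      exact pow_le_pow_left₀ (sq_nonneg _) hab _
    refine (key _ _ s1).trans ((ex_pow _ _).trans ?_)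
    calc ex (fun w : Fin (n i) → ZMod 2 => (ex (fun u => F u * F (u + Pi.single i w))) ^ 2 ^ J.card)
      _ ≤ ex (fun w : Fin (n i) → ZMod 2 => ex (fun u => sg (q (Function.update u i w)))) := by
          apply ex_mono
          intro w
          have e2 : (fun u => F u * F (u + Pi.single i w)) =
              fun u => sg (q (Function.update u i w)) *
                ∏ j ∈ J, (h j u * h j (Function.update u i (u i + w))) := by
            ext u
            rw [add_single]
            simp only [hF]
            rw [hq.2 i (by simp), Function.update_eq_self, sg_add, Finset.prod_mul_distrib]
            have : sg (q u) * sg (q u) = 1 := by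
              rw [← abs_mul_abs_self, sg_abs]; norm_num
            linear_combination (sg (q (Function.update u i w)) * (∏ j ∈ J, h j u) *
              ∏ j ∈ J, h j (Function.update u i (u i + w))) * this
          rw [e2]
          refine ih _ (hq.slice hi w) (fun j u => h j u * h j (Function.update u i (u i + w))) ?_ ?_
          · intro j hj u
            rw [abs_mul]
            exact mul_le_one₀ (hb j (by simp [hj]) _) (abs_nonneg _) (hb j (by simp [hj]) _)
          · intro j hj u a
            have hne : i ≠ j := fun h => hi (h ▸ hj)
            rw [hc j (by simp [hj]), Function.update_of_ne hne, Function.update_comm hne.symm,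
              hc j (by simp [hj])]
      _ = _ := ex_slice i (fun u => sg (q u))

/-- typed forms -/
abbrev Pr (d : ℕ) (n : Fin d → ℕ) := Finset (Fin d) × (Tup d n → ZMod 2)

/-- validity of a system of forms -/
def Valid (s : ℕ) (P : Finset (Pr d n)) : Prop :=
  ∀ x ∈ P, x.1.Nonempty ∧ x.1.card ≤ s ∧ ML x.1 x.2

/-- regularity of a system of forms -/
def Reg (L : ℕ) (P : Finset (Pr d n)) : Prop :=
  ∀ S ⊆ P, S.Nonempty → ∀ K : Finset (Fin d), (∀ x ∈ S, x.1 = K) → ¬ Rk K L (∑ x ∈ S, x.2)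

lemma Rk.mono {J : Finset (Fin d)} {L L' : ℕ} (h : L ≤ L') {f : Tup d n → ZMod 2}
    (hf : Rk J L f) : Rk J L' f := by
  obtain ⟨k, hk, K, v, w, h1⟩ := hf
  exact ⟨k, hk.trans h, K, v, w, h1⟩

lemma Reg.mono {L L' : ℕ} (h : L ≤ L') {P : Finset (Pr d n)} (hP : Reg L' P) : Reg L P :=
  fun S hS hne K hK hr => hP S hS hne K hK (hr.mono h)

lemma ML.zero (J : Finset (Fin d)) : ML J (0 : Tup d n → ZMod 2) :=
  ⟨fun _ _ _ => rfl, fun _ _ _ _ _ => by simp⟩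

lemma ML.add {J : Finset (Fin d)} {f g : Tup d n → ZMod 2} (hf : ML J f) (hg : ML J g) :
    ML J (f + g) := by
  refine ⟨fun u v h => ?_, fun i hi u a b => ?_⟩
  · simp only [Pi.add_apply]; rw [hf.1 u v h, hg.1 u v h]
  · simp only [Pi.add_apply]; rw [hf.2 i hi u a b, hg.2 i hi u a b]; ring

lemma ML.sum {J : Finset (Fin d)} {ι : Type*} (S : Finset ι) (f : ι → Tup d n → ZMod 2)
    (h : ∀ x ∈ S, ML J (f x)) : ML J (∑ x ∈ S, f x) := by
  classical
  induction S using Finset.induction_on with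
  | empty => simpa using ML.zero J
  | insert a S ha ih =>
    rw [Finset.sum_insert ha]
    exact (h a (by simp)).add (ih fun x hx => h x (by simp [hx]))

lemma ML.mul {J K : Finset (Fin d)} (hd : Disjoint J K) {f g : Tup d n → ZMod 2} (hf : ML J f)
    (hg : ML K g) : ML (J ∪ K) (f * g) := by
  refine ⟨fun u v h => ?_, fun i hi u a b => ?_⟩
  · simp only [Pi.mul_apply]
    rw [hf.1 u v fun i hi => h i (by simp [hi]), hg.1 u v fun i hi => h i (by simp [hi])]
  · simp only [Pi.mul_apply]
    have key : ∀ (K : Finset (Fin d)) (g : Tup d n → ZMod 2), ML K g → i ∉ K → ∀ a b,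
        g (Function.update u i a) = g (Function.update u i b) := by
      intro K g hg hi a b
      refine hg.1 _ _ fun j hj => ?_
      have : j ≠ i := fun h => hi (h ▸ hj)
      simp [this]
    rcases Finset.mem_union.1 hi with hi | hi
    · have hK : i ∉ K := Finset.disjoint_left.1 hd hi
      rw [hf.2 i hi u a b, key K g hg hK (a + b) b, key K g hg hK a b]; ring
    · have hK : i ∉ J := Finset.disjoint_right.1 hd hi
      rw [hg.2 i hi u a b, key J f hf hK (a + b) b, key J f hf hK a b]; ring

lemma ML.update_of_notMem {K : Finset (Fin d)} {g : Tup d n → ZMod 2} (hg : ML K g) {i : Fin d}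
    (hi : i ∉ K) (u : Tup d n) (a : Fin (n i) → ZMod 2) : g (Function.update u i a) = g u := by
  refine hg.1 _ _ fun j hj => ?_
  have : j ≠ i := fun h => hi (h ▸ hj)
  simp [this]

lemma charBound (θ : ℝ) (h0 : 0 < θ) (h1 : θ ≤ 1) (s L : ℕ)
    (hb : ∀ K : Finset (Fin d), K.Nonempty → K.card ≤ s → ∀ f : Tup d n → ZMod 2, ML K f →
      θ ^ (2 ^ d) ≤ ex (fun u => sg (f u)) → Rk K L f)
    (P : Finset (Pr d n)) (hv : Valid s P) (hr : Reg L P) (S : Finset (Pr d n)) (hS : S ⊆ P)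
    (hne : S.Nonempty) : |ex (fun u => ∏ x ∈ S, sg (x.2 u))| ≤ θ := by
  classical
  by_contra hcon
  push Not at hcon
  obtain ⟨x0, hx0, hmax⟩ := Finset.exists_max_image S (fun x => x.1.card) hne
  set K := x0.1 with hK
  set S1 := S.filter (fun x => x.1 = K) with hS1
  set S2 := S.filter (fun x => ¬ x.1 = K) with hS2
  have hj : ∀ x : Pr d n, ∃ j : Fin d, x ∈ S2 → j ∈ K ∧ j ∉ x.1 := by
    intro x
    obtain ⟨j0, _⟩ := (hv x0 (hS hx0)).1
    by_cases hx : x ∈ S2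
    · by_contra hno
      push Not at hno
      have hsub : K ⊆ x.1 := fun j hj => by
        by_contra hjx
        exact hjx ((hno j).2 hj)
      have h2 := Finset.mem_filter.1 hx
      exact h2.2 (Finset.eq_of_subset_of_card_le hsub (hmax x h2.1)).symm
    · exact ⟨j0, fun h => absurd h hx⟩
  choose j hj using hj
  set h : Fin d → Tup d n → ℝ := fun i u => ∏ x ∈ S2.filter (fun x => j x = i), sg (x.2 u) with hh
  have hML : ML K (∑ x ∈ S1, x.2) := ML.sum _ _ fun x hx => by
    have h2 := Finset.mem_filter.1 hx
    rw [← h2.2]; exact (hv x (hS h2.1)).2.2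
  have hcs := cs K (∑ x ∈ S1, x.2) hML h ?_ ?_
  · have e : (fun u => sg ((∑ x ∈ S1, x.2) u) * ∏ i ∈ K, h i u) =
        fun u => ∏ x ∈ S, sg (x.2 u) := by
      ext u
      rw [Finset.sum_apply, sg_sum]
      simp only [hh]
      rw [Finset.prod_fiberwise_of_maps_to (g := j) (f := fun x => sg (x.2 u))
        (fun x hx => (hj x hx).1)]
      exact Finset.prod_filter_mul_prod_filter_not _ _ _
    rw [e] at hcs
    have hKn : K.Nonempty := (hv x0 (hS hx0)).1
    have hKd : K.card ≤ d := by simpa using Finset.card_le_univ K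
    have hev : Even (2 ^ K.card) := by
      have := hKn.card_pos.ne'
      exact (Nat.even_pow.2 ⟨even_two, this⟩)
    have c1 : θ ^ (2 ^ d) ≤ θ ^ (2 ^ K.card) :=
      pow_le_pow_of_le_one h0.le h1 (Nat.pow_le_pow_right (by norm_num) hKd)
    have c2 := pow_le_pow_left₀ h0.le hcon.le (2 ^ K.card)
    rw [hev.pow_abs] at c2
    have := hb K hKn (hv x0 (hS hx0)).2.1 _ hML (c1.trans (c2.trans hcs))
    exact hr S1 ((Finset.filter_subset _ _).trans hS)
      ⟨x0, Finset.mem_filter.2 ⟨hx0, rfl⟩⟩ K (fun x hx => (Finset.mem_filter.1 hx).2) this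
  · intro i _ u
    simp only [hh]
    rw [Finset.abs_prod]
    simp [sg_abs]
  · intro i _ u a
    simp only [hh]
    refine Finset.prod_congr rfl fun x hx => ?_
    have h2 := Finset.mem_filter.1 hx
    have h3 := (hj x h2.1).2
    rw [h2.2] at h3
    rw [(hv x (hS (Finset.mem_filter.1 h2.1).1)).2.2.update_of_notMem h3]

/-- valuation pattern -/
def val (P : Finset (Pr d n)) (u : Tup d n) : Finset (Pr d n) := P.filter (fun x => x.2 u = 1)

lemma val_sub (P : Finset (Pr d n)) (u : Tup d n) : val P u ⊆ P := Finset.filter_subset _ _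

lemma equi (P : Finset (Pr d n))
    (hc : ∀ S ⊆ P, S.Nonempty → |ex (fun u => ∏ x ∈ S, sg (x.2 u))| ≤ (2 ^ P.card : ℝ)⁻¹ / 3)
    (A : Finset (Pr d n)) (hA : A ⊆ P) :
    2 / 3 ≤ 2 ^ P.card * ex (fun u => if val P u = A then (1 : ℝ) else 0) ∧
    2 ^ P.card * ex (fun u => if val P u = A then (1 : ℝ) else 0) ≤ 4 / 3 := by
  set σ : Pr d n → ℝ := fun x => if x ∈ A then -1 else 1 with hσ
  have hσa : ∀ x, |σ x| = 1 := fun x => by simp only [hσ]; split_ifs <;> simp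
  have e1 : ∀ u : Tup d n, (2 ^ P.card : ℝ) * (if val P u = A then (1 : ℝ) else 0) =
      ∏ x ∈ P, (1 + σ x * sg (x.2 u)) := by
    intro u
    split_ifs with h
    · rw [mul_one, ← Finset.prod_const]
      refine Finset.prod_congr rfl fun x hx => ?_
      simp only [hσ]
      rcases zcases (x.2 u) with h0 | h0
      · have : x ∉ A := by rw [← h]; simp [val, h0]
        simp [this, h0, sg_zero]; norm_num
      · have : x ∈ A := by rw [← h]; simp [val, h0, hx]
        simp [this, h0, sg_one]; norm_num
    · rw [mul_zero]
      have : ∃ x ∈ P, ¬ (x ∈ val P u ↔ x ∈ A) := by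
        by_contra hno
        push Not at hno
        apply h
        ext x
        by_cases hx : x ∈ P
        · exact hno x hx
        · exact ⟨fun h' => absurd (val_sub P u h') hx, fun h' => absurd (hA h') hx⟩
      obtain ⟨x, hx, hne⟩ := this
      symm
      apply Finset.prod_eq_zero hx
      simp only [hσ]
      rcases zcases (x.2 u) with h0 | h0
      · have : x ∈ A := by
          by_contra hxA; exact hne (by simp [val, h0, hxA])
        simp [this, h0, sg_zero]
      · have : x ∉ A := by
          intro hxA; exact hne (by simp [val, h0, hxA, hx])
        simp [this, h0, sg_one]
  have e2 : 2 ^ P.card * ex (fun u => if val P u = A then (1 : ℝ) else 0) =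
      ∑ S ∈ P.powerset, (∏ x ∈ S, σ x) * ex (fun u => ∏ x ∈ S, sg (x.2 u)) := by
    rw [← ex_mul]
    simp_rw [e1, Finset.prod_one_add, Finset.prod_mul_distrib]
    rw [ex_sum]
    simp_rw [ex_mul]
  have e3 : |2 ^ P.card * ex (fun u => if val P u = A then (1 : ℝ) else 0) - 1| ≤ 1 / 3 := by
    rw [e2, ← Finset.sum_erase_add _ _ (Finset.empty_mem_powerset P)]
    simp only [Finset.prod_empty, ex_const, mul_one, add_sub_cancel_right]
    calc |∑ S ∈ P.powerset.erase ∅, (∏ x ∈ S, σ x) * ex (fun u => ∏ x ∈ S, sg (x.2 u))|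
        ≤ ∑ S ∈ P.powerset.erase ∅, |(∏ x ∈ S, σ x) * ex (fun u => ∏ x ∈ S, sg (x.2 u))| :=
          Finset.abs_sum_le_sum_abs _ _
      _ ≤ ∑ S ∈ P.powerset.erase ∅, (2 ^ P.card : ℝ)⁻¹ / 3 := by
          refine Finset.sum_le_sum fun S hS => ?_
          rw [abs_mul, Finset.abs_prod]
          simp only [hσa, Finset.prod_const_one, one_mul]
          have := Finset.mem_erase.1 hS
          exact hc S (Finset.mem_powerset.1 this.2) (Finset.nonempty_iff_ne_empty.2 this.1)
      _ ≤ ∑ S ∈ P.powerset, (2 ^ P.card : ℝ)⁻¹ / 3 :=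
          Finset.sum_le_sum_of_subset_of_nonneg (Finset.erase_subset _ _)
            (fun _ _ _ => by positivity)
      _ = 1 / 3 := by
          rw [Finset.sum_const, Finset.card_powerset, nsmul_eq_mul]
          push_cast
          field_simp
  rw [abs_le] at e3
  constructor <;> linarith [e3.1, e3.2]

/-- monomials of type `J` -/
def Mono (J : Finset (Fin d)) (S : Finset (Pr d n)) : Prop :=
  (∀ x ∈ S, x.1.Nonempty) ∧ (∀ x ∈ S, ∀ y ∈ S, x ≠ y → Disjoint x.1 y.1) ∧
    S.biUnion (fun x => x.1) = J

/-- multilinear polynomials of type `J` in the forms of `P` -/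
def polyS (P : Finset (Pr d n)) (J : Finset (Fin d)) :
    Submodule (ZMod 2) (Tup d n → ZMod 2) :=
  Submodule.span (ZMod 2) {f | ∃ S ⊆ P, Mono J S ∧ f = ∏ x ∈ S, x.2}

lemma poly_mem {P : Finset (Pr d n)} {x : Pr d n} (hx : x ∈ P) (hne : x.1.Nonempty) :
    x.2 ∈ polyS P x.1 := by
  refine Submodule.subset_span ⟨{x}, by simpa using hx, ⟨by simpa using hne, ?_, by simp⟩, by simp⟩
  intro a ha b hb hab
  rw [Finset.mem_singleton] at ha hb
  exact absurd (ha.trans hb.symm) hab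

lemma poly_mul {P : Finset (Pr d n)} {J K : Finset (Fin d)} (hJK : Disjoint J K)
    {f g : Tup d n → ZMod 2} (hf : f ∈ polyS P J) (hg : g ∈ polyS P K) :
    f * g ∈ polyS P (J ∪ K) := by
  have h1 := Submodule.mul_mem_mul hf hg
  unfold polyS at h1
  rw [Submodule.span_mul_span] at h1
  refine Submodule.span_mono ?_ h1
  intro z hz
  obtain ⟨a, ⟨S, hS, hSm, rfl⟩, b, ⟨S', hS', hSm', rfl⟩, rfl⟩ := Set.mem_mul.1 hz
  have hcross : ∀ x ∈ S, ∀ y ∈ S', Disjoint x.1 y.1 := by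
    intro x hx y hy
    refine Finset.disjoint_of_subset_left ?_ (Finset.disjoint_of_subset_right ?_ hJK)
    · rw [← hSm.2.2]; exact Finset.subset_biUnion_of_mem (fun x : Pr d n => x.1) hx
    · rw [← hSm'.2.2]; exact Finset.subset_biUnion_of_mem (fun x : Pr d n => x.1) hy
  have hdis : Disjoint S S' := by
    rw [Finset.disjoint_left]
    intro x hx hx'
    have := hcross x hx x hx'
    rw [disjoint_self] at this
    exact (hSm.1 x hx).ne_empty this
  refine ⟨S ∪ S', Finset.union_subset hS hS', ⟨?_, ?_, ?_⟩, ?_⟩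
  · intro x hx
    rcases Finset.mem_union.1 hx with h | h
    · exact hSm.1 x h
    · exact hSm'.1 x h
  · intro x hx y hy hxy
    rcases Finset.mem_union.1 hx with h | h <;> rcases Finset.mem_union.1 hy with h' | h'
    · exact hSm.2.1 x h y h' hxy
    · exact hcross x h y h'
    · exact (hcross y h' x h).symm
    · exact hSm'.2.1 x h y h' hxy
  · rw [Finset.union_biUnion, hSm.2.2, hSm'.2.2]
  · rw [Finset.prod_union hdis]

lemma poly_val {P : Finset (Pr d n)} {J : Finset (Fin d)} {f : Tup d n → ZMod 2}
    (hf : f ∈ polyS P J) {u v : Tup d n} (h : val P u = val P v) : f u = f v := by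
  have hx : ∀ x ∈ P, x.2 u = x.2 v := by
    intro x hx
    have : x ∈ val P u ↔ x ∈ val P v := by rw [h]
    simp only [val, Finset.mem_filter, hx, true_and] at this
    rcases zcases (x.2 u) with h1 | h1 <;> rcases zcases (x.2 v) with h2 | h2 <;>
      simp_all
  induction hf using Submodule.span_induction with
  | mem f hf =>
    obtain ⟨S, hS, _, rfl⟩ := hf
    simp only [Finset.prod_apply]
    exact Finset.prod_congr rfl fun x hxS => hx x (hS hxS)
  | zero => rfl
  | add f g _ _ hf hg => simp [hf, hg]
  | smul c f _ hf => simp [hf]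

/-- regularity statement -/
def RegA (d s0 s : ℕ) : Prop := ∀ T : ℕ → ℕ, Monotone T → ∀ m a : ℕ, ∃ D F0 : ℕ,
  ∀ (n : Fin d → ℕ) (G P : Finset (Pr d n)), Valid s0 G → Valid s0 P → G.card ≤ m → P.card ≤ a →
    (∀ x ∈ P, x.1.card ≤ s) → Reg F0 G →
    ∃ P' : Finset (Pr d n), Valid s0 P' ∧ G ⊆ P' ∧ P'.card ≤ D ∧ Reg (T P'.card) P' ∧
      ∀ x ∈ P, x.2 ∈ polyS P' x.1

/-- inner regularity statement -/
def RegB (d s0 s b : ℕ) : Prop := ∀ T : ℕ → ℕ, Monotone T → ∀ m a : ℕ, ∃ D F0 : ℕ,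
  ∀ (n : Fin d → ℕ) (G P : Finset (Pr d n)), Valid s0 G → Valid s0 P → G.card ≤ m → P.card ≤ a →
    (∀ x ∈ P, x.1.card ≤ s + 1) → (P.filter (fun x => x.1.card = s + 1)).card ≤ b → Reg F0 G →
    ∃ P' : Finset (Pr d n), Valid s0 P' ∧ G ⊆ P' ∧ P'.card ≤ D ∧ Reg (T P'.card) P' ∧
      ∀ x ∈ P, x.2 ∈ polyS P' x.1

lemma regA_zero (s0 : ℕ) : RegA d s0 0 := by
  intro T hT m a
  refine ⟨m, T m, fun n G P hG hP hm ha hc hr => ⟨G, hG, subset_rfl, hm, hr.mono (hT hm), ?_⟩⟩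
  intro x hx
  have h1 := (hP x hx).1.card_pos
  have := hc x hx
  omega

lemma regB_zero (s0 s : ℕ) (hA : RegA d s0 s) : RegB d s0 s 0 := by
  intro T hT m a
  obtain ⟨D, F0, h⟩ := hA T hT m a
  refine ⟨D, F0, fun n G P hG hP hm ha hc hb hr => h n G P hG hP hm ha ?_ hr⟩
  intro x hx
  have h1 := hc x hx
  have h2 := Finset.card_eq_zero.1 (Nat.le_zero.1 hb)
  have h3 : x.1.card ≠ s + 1 := fun h => by
    have : x ∈ P.filter (fun x => x.1.card = s + 1) := Finset.mem_filter.2 ⟨hx, h⟩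
    rw [h2] at this
    simp at this
  omega

lemma regB_succ (s0 s b : ℕ) (hA : RegA d s0 s) (hB : RegB d s0 s b) : RegB d s0 s (b + 1) := by
  classical
  intro T hT m a
  obtain ⟨D1, F1, h1⟩ := hA T hT (m + (b + 1)) a
  obtain ⟨D2, F2, h2⟩ := hB T hT m (a + 2 * F1)
  refine ⟨max D1 D2, max F1 F2, fun n G P hG hP hm ha hc hb hr => ?_⟩
  set top := P.filter (fun x => x.1.card = s + 1) with htop
  have htopP : top ⊆ P := Finset.filter_subset _ _
  by_cases hreg : Reg F1 (G ∪ top)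
  · obtain ⟨P', k1, k2, k3, k4, k5⟩ := h1 n (G ∪ top) (P.filter (fun x => ¬ x.1.card = s + 1))
      (fun x hx => (Finset.mem_union.1 hx).elim (hG x) (fun h => hP x (htopP h)))
      (fun x hx => hP x (Finset.mem_filter.1 hx).1)
      ((Finset.card_union_le _ _).trans (by omega))
      ((Finset.card_le_card (Finset.filter_subset _ _)).trans ha)
      (fun x hx => by
        have := Finset.mem_filter.1 hx
        have := hc x this.1
        omega) hreg
    refine ⟨P', k1, Finset.subset_union_left.trans k2, k3.trans (le_max_left _ _), k4, ?_⟩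
    intro x hx
    by_cases hxt : x.1.card = s + 1
    · exact poly_mem (k2 (Finset.mem_union_right _ (Finset.mem_filter.2 ⟨hx, hxt⟩))) (hP x hx).1
    · exact k5 x (Finset.mem_filter.2 ⟨hx, hxt⟩)
  · unfold Reg at hreg
    push Not at hreg
    obtain ⟨S, hS, hSn, K, hK, hrk⟩ := hreg
    have hx0 : ∃ x0 ∈ S, x0 ∉ G := by
      by_contra hno
      push Not at hno
      exact hr S hno hSn K hK (hrk.mono (le_max_left _ _))
    obtain ⟨x0, hx0S, hx0G⟩ := hx0
    have hx0t : x0 ∈ top := (Finset.mem_union.1 (hS hx0S)).resolve_left hx0G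
    have hx0P := htopP hx0t
    have hKc : K.card = s + 1 := by rw [← hK x0 hx0S]; exact (Finset.mem_filter.1 hx0t).2
    have hKs0 : K.card ≤ s0 := by rw [← hK x0 hx0S]; exact (hP x0 hx0P).2.1
    obtain ⟨k, hk, Kl, v, w, hvw, hsum⟩ := hrk
    set A1 : Finset (Pr d n) := Finset.univ.image (fun l : Fin k => (Kl l, v l)) with hA1
    set A2 : Finset (Pr d n) := Finset.univ.image (fun l : Fin k => (K \ Kl l, w l)) with hA2
    have hA1c : A1.card ≤ k := Finset.card_image_le.trans (by simp)
    have hA2c : A2.card ≤ k := Finset.card_image_le.trans (by simp)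
    have hlt1 : ∀ l, (Kl l).card < K.card := fun l => Finset.card_lt_card (hvw l).2.1
    have hlt2 : ∀ l, (K \ Kl l).card < K.card := fun l => by
      rw [Finset.card_sdiff_of_subset (hvw l).2.1.1]
      have := (hvw l).1.card_pos
      have := hlt1 l
      omega
    have hne2 : ∀ l, (K \ Kl l).Nonempty := fun l => by
      rw [← Finset.card_pos, Finset.card_sdiff_of_subset (hvw l).2.1.1]
      have := hlt1 l
      omega
    have hA : ∀ x ∈ A1 ∪ A2, x.1.Nonempty ∧ x.1.card < K.card ∧ ML x.1 x.2 := by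
      intro x hx
      rcases Finset.mem_union.1 hx with h | h
      · obtain ⟨l, _, rfl⟩ := Finset.mem_image.1 h
        exact ⟨(hvw l).1, hlt1 l, (hvw l).2.2.1⟩
      · obtain ⟨l, _, rfl⟩ := Finset.mem_image.1 h
        exact ⟨hne2 l, hlt2 l, (hvw l).2.2.2⟩
    have hpc : (P.erase x0).card ≤ a := (Finset.card_le_card (Finset.erase_subset _ _)).trans ha
    obtain ⟨P', k1, k2, k3, k4, k5⟩ := h2 n G (P.erase x0 ∪ (A1 ∪ A2)) hG
      (fun x hx => by
        rcases Finset.mem_union.1 hx with h | h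
        · exact hP x (Finset.mem_of_mem_erase h)
        · have := hA x h
          exact ⟨this.1, by omega, this.2.2⟩)
      hm
      (by
        have e1 := Finset.card_union_le (P.erase x0) (A1 ∪ A2)
        have e2 := Finset.card_union_le A1 A2
        omega)
      (fun x hx => by
        rcases Finset.mem_union.1 hx with h | h
        · exact hc x (Finset.mem_of_mem_erase h)
        · have := hA x h
          omega)
      (by
        have : (P.erase x0 ∪ (A1 ∪ A2)).filter (fun x => x.1.card = s + 1) ⊆ top.erase x0 := by
          intro x hx
          have hx' := Finset.mem_filter.1 hx
          rcases Finset.mem_union.1 hx'.1 with h | h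
          · have h' := Finset.mem_erase.1 h
            exact Finset.mem_erase.2 ⟨h'.1, Finset.mem_filter.2 ⟨h'.2, hx'.2⟩⟩
          · have := hA x h
            omega
        have e := Finset.card_le_card this
        rw [Finset.card_erase_of_mem hx0t] at e
        omega)
      (hr.mono (le_max_right _ _))
    refine ⟨P', k1, k2, k3.trans (le_max_right _ _), k4, ?_⟩
    intro x hx
    by_cases hxx : x = x0
    · subst hxx
      rw [hK x hx0S]
      have e1 := Finset.add_sum_erase S (fun x => x.2) hx0S
      have e2 : x.2 = (∑ l, v l * w l) - ∑ y ∈ S.erase x, y.2 := by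
        rw [← hsum, ← e1]; simp
      rw [e2]
      refine Submodule.sub_mem _ (Submodule.sum_mem _ fun l _ => ?_)
        (Submodule.sum_mem _ fun y hy => ?_)
      · have q1 : v l ∈ polyS P' (Kl l) := k5 (Kl l, v l) (Finset.mem_union_right _
          (Finset.mem_union_left _ (Finset.mem_image.2 ⟨l, Finset.mem_univ _, rfl⟩)))
        have q2 : w l ∈ polyS P' (K \ Kl l) := k5 (K \ Kl l, w l) (Finset.mem_union_right _
          (Finset.mem_union_right _ (Finset.mem_image.2 ⟨l, Finset.mem_univ _, rfl⟩)))
        have := poly_mul Finset.disjoint_sdiff q1 q2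
        rwa [Finset.union_sdiff_of_subset (hvw l).2.1.1] at this
      · have hy' := Finset.mem_erase.1 hy
        rw [← hK y hy'.2]
        rcases Finset.mem_union.1 (hS hy'.2) with h | h
        · exact poly_mem (k2 h) (hG y h).1
        · exact k5 y (Finset.mem_union_left _ (Finset.mem_erase.2 ⟨hy'.1, htopP h⟩))
    · exact k5 x (Finset.mem_union_left _ (Finset.mem_erase.2 ⟨hxx, hx⟩))

lemma regA (s0 s : ℕ) : RegA d s0 s := by
  induction s with
  | zero => exact regA_zero s0
  | succ s ih =>
    have hB : ∀ b, RegB d s0 s b := by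
      intro b
      induction b with
      | zero => exact regB_zero s0 s ih
      | succ b ihb => exact regB_succ s0 s b ih ihb
    intro T hT m a
    obtain ⟨D, F0, h⟩ := hB a T hT m a
    exact ⟨D, F0, fun n G P hG hP hm ha hc hr => h n G P hG hP hm ha hc
      ((Finset.card_le_card (Finset.filter_subset _ _)).trans ha) hr⟩

section energy
variable {Ω α β : Type*} [Fintype Ω] [DecidableEq α] [DecidableEq β]

/-- conditional expectation -/
noncomputable def ce (b : Ω → ℝ) (π : Ω → α) (u : Ω) : ℝ :=
  (∑ v, if π v = π u then b v else 0) / (∑ v, if π v = π u then (1 : ℝ) else 0)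

lemma ce_congr (b : Ω → ℝ) (π : Ω → α) {u v : Ω} (h : π u = π v) : ce b π u = ce b π v := by
  unfold ce; rw [h]

lemma fib_pos (π : Ω → α) (u : Ω) : 0 < ∑ v, if π v = π u then (1 : ℝ) else 0 := by
  have h : (1 : ℝ) ≤ ∑ v, if π v = π u then (1 : ℝ) else 0 := by
    calc (1 : ℝ) = if π u = π u then (1 : ℝ) else 0 := by simp
      _ ≤ _ := Finset.single_le_sum (f := fun v => if π v = π u then (1 : ℝ) else 0)
        (fun v _ => by split_ifs <;> norm_num) (Finset.mem_univ u)
  linarith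

lemma ce_proj (b φ : Ω → ℝ) (π : Ω → α) (hφ : ∀ u v, π u = π v → φ u = φ v) :
    ex (fun u => ce b π u * φ u) = ex (fun u => b u * φ u) := by
  unfold ex
  congr 1
  calc ∑ u, ce b π u * φ u
      = ∑ u, ∑ v, if π v = π u then
          b v * φ v / (∑ w, if π w = π v then (1 : ℝ) else 0) else 0 := by
        refine Finset.sum_congr rfl fun u _ => ?_
        unfold ce
        rw [div_mul_eq_mul_div, Finset.sum_mul, Finset.sum_div]
        refine Finset.sum_congr rfl fun v _ => ?_
        split_ifs with h
        · rw [hφ v u h, h]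
        · simp
    _ = ∑ v, ∑ u, if π v = π u then
          b v * φ v / (∑ w, if π w = π v then (1 : ℝ) else 0) else 0 := Finset.sum_comm
    _ = ∑ v, b v * φ v := by
        refine Finset.sum_congr rfl fun v _ => ?_
        have hp := fib_pos π v
        have : ∀ u, (if π v = π u then
          b v * φ v / (∑ w, if π w = π v then (1 : ℝ) else 0) else 0) =
          (b v * φ v / (∑ w, if π w = π v then (1 : ℝ) else 0)) *
            (if π u = π v then (1 : ℝ) else 0) := by
          intro u
          by_cases h : π v = π u
          · rw [if_pos h, if_pos h.symm, mul_one]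
          · rw [if_neg h, if_neg (fun h' => h h'.symm), mul_zero]
        simp_rw [this]
        rw [← Finset.mul_sum]
        field_simp

/-- energy -/
noncomputable def en (b : Ω → ℝ) (π : Ω → α) : ℝ := ex (fun u => ce b π u ^ 2)

lemma en_diff (b : Ω → ℝ) (π : Ω → α) (ρ : Ω → β) (h : ∀ u v, ρ u = ρ v → π u = π v) :
    ex (fun u => (ce b π u - ce b ρ u) ^ 2) = en b ρ - en b π := by
  have h1 := ce_proj b (ce b π) ρ (fun u v huv => ce_congr b π (h u v huv))
  have h2 := ce_proj b (ce b π) π (fun u v huv => ce_congr b π huv)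
  have e : (fun u => (ce b π u - ce b ρ u) ^ 2) =
      fun u => (ce b π u ^ 2 - 2 * (ce b ρ u * ce b π u)) + ce b ρ u ^ 2 := by
    ext u; ring
  rw [e, ex_add, ex_sub, ex_mul, h1, ← h2]
  have e2 : (fun u => ce b π u * ce b π u) = fun u => ce b π u ^ 2 := by ext u; ring
  rw [e2]
  unfold en
  ring

lemma en_mono (b : Ω → ℝ) (π : Ω → α) (ρ : Ω → β) (h : ∀ u v, ρ u = ρ v → π u = π v) :
    en b π ≤ en b ρ := by
  have := en_diff b π ρ h
  have h2 : 0 ≤ ex (fun u => (ce b π u - ce b ρ u) ^ 2) := ex_nonneg fun u => sq_nonneg _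
  linarith

lemma ce_nonneg (b : Ω → ℝ) (hb : ∀ u, 0 ≤ b u) (π : Ω → α) (u : Ω) : 0 ≤ ce b π u := by
  unfold ce
  refine div_nonneg (Finset.sum_nonneg fun v _ => ?_) (fib_pos π u).le
  split_ifs
  · exact hb v
  · exact le_rfl

lemma ce_le_one (b : Ω → ℝ) (hb : ∀ u, b u ≤ 1) (π : Ω → α) (u : Ω) : ce b π u ≤ 1 := by
  unfold ce
  rw [div_le_one (fib_pos π u)]
  refine Finset.sum_le_sum fun v _ => ?_
  split_ifs
  · exact hb v
  · exact le_rfl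

lemma en_le_one [Nonempty Ω] (b : Ω → ℝ) (hb : ∀ u, 0 ≤ b u) (hb1 : ∀ u, b u ≤ 1) (π : Ω → α) :
    en b π ≤ 1 := by
  unfold en
  calc _ ≤ ex (fun _ : Ω => (1 : ℝ)) := ex_mono fun u =>
        pow_le_one₀ (ce_nonneg b hb π u) (ce_le_one b hb1 π u)
    _ = 1 := ex_const 1

lemma incr [Nonempty Ω] (b φ : Ω → ℝ) (hb : ∀ u, 0 ≤ b u) (hφ : ∀ u, |φ u| ≤ 1) (π : Ω → α)
    (ρ : Ω → β) (h : ∀ u v, ρ u = ρ v → π u = π v) (hφρ : ∀ u v, ρ u = ρ v → φ u = φ v)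
    (c : ℝ) (hc : 0 ≤ c) (hcφ : ∀ u, c ≤ ce φ π u)
    (hbφ : ex (fun u => b u * φ u) ≤ c / 2 * ex b) :
    en b π + (c / 2 * ex b) ^ 2 ≤ en b ρ := by
  have h1 := ce_proj b φ ρ hφρ
  have h2 : c * ex b ≤ ex (fun u => ce b π u * φ u) := by
    have a1 := ce_proj φ (ce b π) π (fun u v huv => ce_congr b π huv)
    have a2 := ce_proj b (fun _ => (1 : ℝ)) π (fun u v huv => rfl)
    simp only [mul_one] at a2
    have a3 : (fun u => ce b π u * φ u) = fun u => φ u * ce b π u := by ext u; ring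
    rw [a3, ← a1]
    change c * ex (fun u => b u) ≤ _
    rw [← a2, ← ex_mul]
    exact ex_mono fun u => mul_le_mul_of_nonneg_right (hcφ u) (ce_nonneg b hb π u)
  have h3 := ex_cs (fun u => ce b π u - ce b ρ u) φ
  rw [en_diff b π ρ h] at h3
  have h4 : ex (fun u => φ u ^ 2) ≤ 1 := by
    calc _ ≤ ex (fun _ : Ω => (1 : ℝ)) := ex_mono fun u => (sq_le_one_iff_abs_le_one _).2 (hφ u)
      _ = 1 := ex_const 1
  have h5 : ex (fun u => (ce b π u - ce b ρ u) * φ u) =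
      ex (fun u => ce b π u * φ u) - ex (fun u => ce b ρ u * φ u) := by
    rw [← ex_sub]; congr 1; ext u; ring
  have h6 : c / 2 * ex b ≤ ex (fun u => (ce b π u - ce b ρ u) * φ u) := by
    rw [h5, h1]; linarith
  have h7 : 0 ≤ ex b := ex_nonneg hb
  have h8 : 0 ≤ en b ρ - en b π := sub_nonneg.2 (en_mono b π ρ h)
  have h9 : (c / 2 * ex b) ^ 2 ≤ ex (fun u => (ce b π u - ce b ρ u) * φ u) ^ 2 :=
    pow_le_pow_left₀ (by positivity) h6 2
  have h10 := mul_le_of_le_one_right h8 h4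
  linarith

end energy

lemma poly_nf {P : Finset (Pr d n)} {J : Finset (Fin d)} {f : Tup d n → ZMod 2}
    (hf : f ∈ polyS P J) : ∃ 𝒮 : Finset (Finset (Pr d n)), (∀ S ∈ 𝒮, S ⊆ P ∧ Mono J S) ∧
      f = ∑ S ∈ 𝒮, ∏ x ∈ S, x.2 := by
  induction hf using Submodule.span_induction with
  | mem f hf =>
    obtain ⟨S, hS, hm, rfl⟩ := hf
    exact ⟨{S}, by simpa using ⟨hS, hm⟩, by simp⟩
  | zero => exact ⟨∅, by simp, by simp⟩
  | add f g _ _ hf hg =>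
    obtain ⟨A, hA, rfl⟩ := hf
    obtain ⟨B, hB, rfl⟩ := hg
    refine ⟨(A \ B) ∪ (B \ A), ?_, ?_⟩
    · intro S hS
      rcases Finset.mem_union.1 hS with h | h
      · exact hA S (Finset.mem_sdiff.1 h).1
      · exact hB S (Finset.mem_sdiff.1 h).1
    · rw [Finset.sum_union (Finset.disjoint_of_subset_right Finset.sdiff_subset
        Finset.sdiff_disjoint)]
      rw [← Finset.sum_sdiff (Finset.inter_subset_left : A ∩ B ⊆ A),
        ← Finset.sum_sdiff (Finset.inter_subset_right : A ∩ B ⊆ B),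
        Finset.sdiff_inter_self_left, Finset.sdiff_inter_self_right]
      have : ∀ z : Tup d n → ZMod 2, z + z = 0 := fun z => by
        ext u; exact CharTwo.add_self_eq_zero _
      have h := this (∑ S ∈ A ∩ B, ∏ x ∈ S, x.2)
      rw [add_add_add_comm, h, add_zero]
  | smul c f _ hf =>
    rcases zcases c with rfl | rfl
    · exact ⟨∅, by simp, by simp⟩
    · simpa using hf

/-- the ideal -/
def idS (G : Finset (Pr d n)) (J : Finset (Fin d)) : Submodule (ZMod 2) (Tup d n → ZMod 2) :=
  Submodule.span (ZMod 2) {f | ∃ x ∈ G, x.1 ⊆ J ∧ ∃ w, ML (J \ x.1) w ∧ f = x.2 * w}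

lemma ML.prod (S : Finset (Pr d n)) (h1 : ∀ x ∈ S, ML x.1 x.2)
    (h2 : ∀ x ∈ S, ∀ y ∈ S, x ≠ y → Disjoint x.1 y.1) :
    ML (S.biUnion (fun x => x.1)) (∏ x ∈ S, x.2) := by
  induction S using Finset.induction_on with
  | empty => exact ⟨fun _ _ _ => by simp, fun i hi => by simp at hi⟩
  | insert a S ha ih =>
    rw [Finset.prod_insert ha, Finset.biUnion_insert]
    refine ML.mul ?_ (h1 a (by simp)) (ih (fun x hx => h1 x (by simp [hx]))
      (fun x hx y hy => h2 x (by simp [hx]) y (by simp [hy])))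
    rw [Finset.disjoint_biUnion_right]
    intro x hx
    exact h2 a (by simp) x (by simp [hx]) (fun h => ha (h ▸ hx))

lemma mem_id {s : ℕ} {P G : Finset (Pr d n)} (hP : Valid s P) {J : Finset (Fin d)}
    {𝒮 : Finset (Finset (Pr d n))} (h𝒮 : ∀ S ∈ 𝒮, S ⊆ P ∧ Mono J S)
    (hG : ∀ S ∈ 𝒮, ¬ Disjoint S G) : (∑ S ∈ 𝒮, ∏ x ∈ S, x.2) ∈ idS G J := by
  refine Submodule.sum_mem _ fun S hS => ?_
  obtain ⟨x, hxS, hxG⟩ := Finset.not_disjoint_iff.1 (hG S hS)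
  obtain ⟨hSP, hne, hdis, hun⟩ := h𝒮 S hS
  have hsub : x.1 ⊆ J := by
    rw [← hun]; exact Finset.subset_biUnion_of_mem (fun x : Pr d n => x.1) hxS
  refine Submodule.subset_span ⟨x, hxG, hsub, ∏ y ∈ S.erase x, y.2, ?_, ?_⟩
  · have := ML.prod (S.erase x) (fun y hy => (hP y (hSP (Finset.mem_of_mem_erase hy))).2.2)
      (fun y hy z hz => hdis y (Finset.mem_of_mem_erase hy) z (Finset.mem_of_mem_erase hz))
    convert this using 1
    ext i
    rw [← hun]
    simp only [Finset.mem_sdiff, Finset.mem_biUnion, Finset.mem_erase]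
    constructor
    · rintro ⟨⟨y, hy, hi⟩, hix⟩
      exact ⟨y, ⟨fun h => hix (h ▸ hi), hy⟩, hi⟩
    · rintro ⟨y, ⟨hyx, hy⟩, hi⟩
      exact ⟨⟨y, hy, hi⟩, Finset.disjoint_left.1 (hdis y hy x hxS hyx) hi⟩
  · exact (Finset.mul_prod_erase S (fun y => y.2) hxS).symm

/-- evaluation of the polynomial on a pattern -/
def pv (𝒮 : Finset (Finset (Pr d n))) (A : Finset (Pr d n)) : ZMod 2 :=
  ∑ S ∈ 𝒮, if S ⊆ A then 1 else 0

lemma pv_val {P : Finset (Pr d n)} {𝒮 : Finset (Finset (Pr d n))} (h𝒮 : ∀ S ∈ 𝒮, S ⊆ P)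
    (u : Tup d n) : (∑ S ∈ 𝒮, ∏ x ∈ S, x.2) u = pv 𝒮 (val P u) := by
  rw [Finset.sum_apply]
  unfold pv
  refine Finset.sum_congr rfl fun S hS => ?_
  rw [Finset.prod_apply]
  split_ifs with h
  · exact Finset.prod_eq_one fun x hx => (Finset.mem_filter.1 (h hx)).2
  · obtain ⟨x, hx, hxv⟩ := Finset.not_subset.1 h
    refine Finset.prod_eq_zero hx ?_
    rcases zcases (x.2 u) with h0 | h0
    · exact h0
    · exact absurd (Finset.mem_filter.2 ⟨h𝒮 S hS hx, h0⟩) hxv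

lemma mono_eq {J : Finset (Fin d)} {S0 S : Finset (Pr d n)} (h0 : Mono J S0) (h : Mono J S)
    (hsub : S0 ⊆ S) : S = S0 := by
  refine Finset.Subset.antisymm (fun x hx => ?_) hsub
  by_contra hx0
  obtain ⟨i, hi⟩ := h.1 x hx
  have hiJ : i ∈ J := by
    rw [← h.2.2]; exact Finset.mem_biUnion.2 ⟨x, hx, hi⟩
  rw [← h0.2.2] at hiJ
  obtain ⟨y, hy, hiy⟩ := Finset.mem_biUnion.1 hiJ
  exact Finset.disjoint_left.1 (h.2.1 x hx y (hsub hy) (fun e => hx0 (e ▸ hy))) hi hiy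

lemma pv_exists {J : Finset (Fin d)} {𝒮 : Finset (Finset (Pr d n))} (h𝒮 : ∀ S ∈ 𝒮, Mono J S)
    {S0 : Finset (Pr d n)} (hS0 : S0 ∈ 𝒮) (A : Finset (Pr d n)) :
    ∃ T ⊆ S0, pv 𝒮 ((A \ S0) ∪ T) = 1 := by
  by_contra hno
  push Not at hno
  have hz : ∑ T ∈ S0.powerset, pv 𝒮 ((A \ S0) ∪ T) = 0 := Finset.sum_eq_zero fun T hT =>
    (zcases _).resolve_right (hno T (Finset.mem_powerset.1 hT))
  have h1 : ∑ T ∈ S0.powerset, pv 𝒮 ((A \ S0) ∪ T) = 1 := by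
    unfold pv
    rw [Finset.sum_comm, Finset.sum_eq_single_of_mem S0 hS0]
    · rw [Finset.sum_eq_single_of_mem S0 (Finset.mem_powerset_self _)]
      · simp
      · intro T hT hne
        rw [if_neg]
        intro hsub
        refine hne (Finset.Subset.antisymm (Finset.mem_powerset.1 hT) fun x hx => ?_)
        rcases Finset.mem_union.1 (hsub hx) with h | h
        · exact absurd hx (Finset.mem_sdiff.1 h).2
        · exact h
    · intro S hS hne
      have : ∃ y ∈ S0, y ∉ S := by
        by_contra hcon
        push Not at hcon
        exact hne (mono_eq (h𝒮 S0 hS0) (h𝒮 S hS) hcon)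
      obtain ⟨y, hy, hyS⟩ := this
      have key : ∀ (X T : Finset (Pr d n)), (S ⊆ X ∪ insert y T) ↔ S ⊆ X ∪ T := by
        intro X T
        constructor
        · intro h x hx
          rcases Finset.mem_union.1 (h hx) with h' | h'
          · exact Finset.mem_union_left _ h'
          · rcases Finset.mem_insert.1 h' with h'' | h''
            · exact absurd hx (h'' ▸ hyS)
            · exact Finset.mem_union_right _ h''
        · intro h
          exact h.trans (Finset.union_subset_union_right (Finset.subset_insert _ _))
      have e := Finset.sum_powerset_insert (s := S0.erase y) (a := y) (by simp)
        (fun T => if S ⊆ (A \ S0) ∪ T then (1 : ZMod 2) else 0)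
      rw [Finset.insert_erase hy] at e
      rw [e]
      simp_rw [key]
      exact CharTwo.add_self_eq_zero _
  rw [hz] at h1
  exact absurd h1 (by decide)

lemma dens_count {P G : Finset (Pr d n)} {J : Finset (Fin d)}
    {𝒮 : Finset (Finset (Pr d n))} (h𝒮 : ∀ S ∈ 𝒮, S ⊆ P ∧ Mono J S)
    {S0 : Finset (Pr d n)} (hS0 : S0 ∈ 𝒮) (hdis : Disjoint S0 G) (a : Finset (Pr d n)) :
    (P.powerset.filter (fun A => A ∩ G = a)).card ≤
      2 ^ d * (P.powerset.filter (fun A => A ∩ G = a ∧ pv 𝒮 A = 1)).card := by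
  have hex : ∀ A : Finset (Pr d n), ∃ T ⊆ S0, pv 𝒮 ((A \ S0) ∪ T) = 1 :=
    pv_exists (fun S hS => (h𝒮 S hS).2) hS0
  choose T hT hpv using hex
  have hcard : S0.card ≤ d := by
    have hm := (h𝒮 S0 hS0).2
    have := Finset.card_le_card_biUnion (s := S0) (f := fun x : Pr d n => x.1)
      (fun x hx y hy hxy => hm.2.1 x hx y hy hxy) hm.1
    refine this.trans ?_
    simpa using Finset.card_le_univ (S0.biUnion fun x : Pr d n => x.1)
  have h1 : (P.powerset.filter (fun A => A ∩ G = a)).card ≤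
      (S0.powerset ×ˢ P.powerset.filter (fun A => A ∩ G = a ∧ pv 𝒮 A = 1)).card := by
    refine Finset.card_le_card_of_injOn (fun A => (A ∩ S0, (A \ S0) ∪ T A)) ?_ ?_
    · intro A hA
      have hA' := Finset.mem_filter.1 (Finset.mem_coe.1 hA)
      have hAP := Finset.mem_powerset.1 hA'.1
      refine Finset.mem_coe.2 (Finset.mem_product.2 ⟨Finset.mem_powerset.2 Finset.inter_subset_right,
        Finset.mem_filter.2 ⟨Finset.mem_powerset.2 ?_, ?_, hpv A⟩⟩)
      · exact Finset.union_subset (Finset.sdiff_subset.trans hAP) ((hT A).trans (h𝒮 S0 hS0).1)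
      · rw [← hA'.2]
        ext x
        simp only [Finset.mem_inter, Finset.mem_union, Finset.mem_sdiff]
        constructor
        · rintro ⟨h | h, hG⟩
          · exact ⟨h.1, hG⟩
          · exact absurd hG (Finset.disjoint_left.1 hdis (hT A h))
        · rintro ⟨h, hG⟩
          exact ⟨Or.inl ⟨h, Finset.disjoint_right.1 hdis hG⟩, hG⟩
    · intro A _ B _ hAB
      simp only [Prod.mk.injEq] at hAB
      have hs : ∀ A : Finset (Pr d n), ((A \ S0) ∪ T A) \ S0 = A \ S0 := by
        intro A
        ext x
        simp only [Finset.mem_union, Finset.mem_sdiff]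
        constructor
        · rintro ⟨h | h, h'⟩
          · exact h
          · exact absurd (hT A h) h'
        · intro h; exact ⟨Or.inl h, h.2⟩
      have e2 : A \ S0 = B \ S0 := by rw [← hs A, ← hs B, hAB.2]
      rw [← Finset.sdiff_union_inter A S0, ← Finset.sdiff_union_inter B S0, e2, hAB.1]
  rw [Finset.card_product, Finset.card_powerset] at h1
  exact h1.trans (Nat.mul_le_mul_right _ (Nat.pow_le_pow_right (by norm_num) hcard))

lemma val_inter {P G : Finset (Pr d n)} (hG : G ⊆ P) (u : Tup d n) : val G u = val P u ∩ G := by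
  ext x
  simp only [val, Finset.mem_filter, Finset.mem_inter]
  constructor
  · rintro ⟨h, h'⟩; exact ⟨⟨hG h, h'⟩, h⟩
  · rintro ⟨⟨_, h'⟩, h⟩; exact ⟨h, h'⟩

lemma sum_fib (P : Finset (Pr d n)) (p : Finset (Pr d n) → Prop) [DecidablePred p] :
    (∑ u : Tup d n, if p (val P u) then (1 : ℝ) else 0) =
      ∑ A ∈ P.powerset.filter p, ∑ u : Tup d n, if val P u = A then (1 : ℝ) else 0 := by
  rw [Finset.sum_comm]
  refine Finset.sum_congr rfl fun u _ => ?_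
  rw [Finset.sum_ite_eq]
  simp [val_sub]

lemma dens {P G : Finset (Pr d n)} (hG : G ⊆ P) {J : Finset (Fin d)}
    (hequi : ∀ A ⊆ P, 2 / 3 ≤ 2 ^ P.card * ex (fun u => if val P u = A then (1 : ℝ) else 0) ∧
      2 ^ P.card * ex (fun u => if val P u = A then (1 : ℝ) else 0) ≤ 4 / 3)
    {𝒮 : Finset (Finset (Pr d n))} (h𝒮 : ∀ S ∈ 𝒮, S ⊆ P ∧ Mono J S)
    {S0 : Finset (Pr d n)} (hS0 : S0 ∈ 𝒮) (hdis : Disjoint S0 G) (r : Tup d n → ZMod 2)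
    (hr : r = ∑ S ∈ 𝒮, ∏ x ∈ S, x.2) (u : Tup d n) :
    1 / 2 ^ (d + 1) ≤ ce (fun v => if r v = 0 then (0 : ℝ) else 1) (val G) u := by
  have hrv : ∀ v, r v = pv 𝒮 (val P v) := fun v => by
    rw [hr]; exact pv_val (fun S hS => (h𝒮 S hS).1) v
  set a := val G u with ha
  have hpos := fib_pos (val G) u
  have hc := dens_count h𝒮 hS0 hdis a
  set M : ℝ := (Fintype.card (Tup d n) : ℝ) / 2 ^ P.card with hM
  have hcp : (0 : ℝ) < (Fintype.card (Tup d n) : ℝ) := cpos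
  have hMp : 0 < M := by positivity
  have hN : ∀ A ⊆ P, 2 / 3 * M ≤ (∑ u : Tup d n, if val P u = A then (1 : ℝ) else 0) ∧
      (∑ u : Tup d n, if val P u = A then (1 : ℝ) else 0) ≤ 4 / 3 * M := by
    intro A hA
    obtain ⟨e1, e2⟩ := hequi A hA
    have : (∑ u : Tup d n, if val P u = A then (1 : ℝ) else 0) =
        (2 ^ P.card * ex (fun u => if val P u = A then (1 : ℝ) else 0)) * M := by
      unfold ex
      rw [hM]
      field_simp
    rw [this]
    exact ⟨mul_le_mul_of_nonneg_right e1 hMp.le, mul_le_mul_of_nonneg_right e2 hMp.le⟩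
  have hden : (∑ v, if val G v = a then (1 : ℝ) else 0) ≤
      ((P.powerset.filter (fun A => A ∩ G = a)).card : ℝ) * (4 / 3 * M) := by
    simp_rw [val_inter hG]
    rw [sum_fib P (fun A => A ∩ G = a), ← nsmul_eq_mul]
    refine Finset.sum_le_card_nsmul _ _ _ fun A hA => ?_
    exact (hN A (Finset.mem_powerset.1 (Finset.mem_filter.1 hA).1)).2
  have hnum : ((P.powerset.filter (fun A => A ∩ G = a ∧ pv 𝒮 A = 1)).card : ℝ) * (2 / 3 * M) ≤
      (∑ v, if val G v = a then (if r v = 0 then (0 : ℝ) else 1) else 0) := by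
    have : ∀ v, (if val G v = a then (if r v = 0 then (0 : ℝ) else 1) else 0) =
        if (val P v ∩ G = a ∧ pv 𝒮 (val P v) = 1) then (1 : ℝ) else 0 := by
      intro v
      rw [val_inter hG, hrv]
      rcases zcases (pv 𝒮 (val P v)) with h | h <;> simp [h]
    simp_rw [this]
    rw [sum_fib P (fun A => A ∩ G = a ∧ pv 𝒮 A = 1), ← nsmul_eq_mul]
    refine Finset.card_nsmul_le_sum _ _ _ fun A hA => ?_
    exact (hN A (Finset.mem_powerset.1 (Finset.mem_filter.1 hA).1)).1
  unfold ce
  rw [le_div_iff₀ hpos]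
  refine le_trans ?_ hnum
  have hc' : ((P.powerset.filter (fun A => A ∩ G = a)).card : ℝ) ≤
      2 ^ d * ((P.powerset.filter (fun A => A ∩ G = a ∧ pv 𝒮 A = 1)).card : ℝ) := by
    exact_mod_cast hc
  calc 1 / 2 ^ (d + 1) * (∑ v, if val G v = a then (1 : ℝ) else 0)
      ≤ 1 / 2 ^ (d + 1) * ((2 ^ d *
        ((P.powerset.filter (fun A => A ∩ G = a ∧ pv 𝒮 A = 1)).card : ℝ)) * (4 / 3 * M)) := by
        refine mul_le_mul_of_nonneg_left (hden.trans ?_) (by positivity)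
        exact mul_le_mul_of_nonneg_right hc' (by positivity)
    _ = _ := by
        rw [pow_succ]; field_simp; ring

/-- bias implies low rank, up to order `s` -/
def Bias (d s : ℕ) : Prop := ∀ δ : ℝ, 0 < δ → ∃ L : ℕ, ∀ (n : Fin d → ℕ) (J : Finset (Fin d)),
  J.Nonempty → J.card ≤ s → ∀ f : Tup d n → ZMod 2, ML J f → δ ≤ ex (fun u => sg (f u)) → Rk J L f

/-- indicator -/
noncomputable def ind (B : Finset (Tup d n)) (u : Tup d n) : ℝ := if u ∈ B then 1 else 0

/-- indicator of nonvanishing -/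
noncomputable def nz (r : Tup d n → ZMod 2) (u : Tup d n) : ℝ := if r u = 0 then 0 else 1

/-- `G` captures all forms vanishing on most of `B` -/
def Cap (s : ℕ) (B : Finset (Tup d n)) (G : Finset (Pr d n)) : Prop :=
  ∀ J : Finset (Fin d), J.card ≤ s → ∀ r : Tup d n → ZMod 2, ML J r →
    ex (fun u => ind B u * nz r u) ≤ 1 / 2 ^ (d + 1) / 2 * ex (ind B) → r ∈ idS G J

/-- main statement -/
def Main (d s : ℕ) : Prop := ∀ δ : ℝ, 0 < δ → ∃ L : ℕ, ∀ (n : Fin d → ℕ) (B : Finset (Tup d n)),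
  δ ≤ ex (ind B) → ∃ G : Finset (Pr d n), Valid s G ∧ G.card ≤ L ∧ Cap s B G

lemma le_sumr (F : ℕ → ℕ) {i m : ℕ} (h : i ≤ m) : F i ≤ ∑ j ∈ Finset.range (m + 1), F j :=
  Finset.single_le_sum (f := F) (fun _ _ => Nat.zero_le _) (Finset.mem_range.2 (by omega))

lemma mono_sumr (F : ℕ → ℕ) : Monotone (fun m => ∑ j ∈ Finset.range (m + 1), F j) := by
  intro a b hab
  exact Finset.sum_le_sum_of_subset (Finset.range_mono (by omega))

lemma exT {s : ℕ} (hB : Bias d s) : ∃ T : ℕ → ℕ, Monotone T ∧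
    ∀ (n : Fin d → ℕ) (P : Finset (Pr d n)), Valid s P → Reg (T P.card) P → ∀ A ⊆ P,
      2 / 3 ≤ 2 ^ P.card * ex (fun u => if val P u = A then (1 : ℝ) else 0) ∧
      2 ^ P.card * ex (fun u => if val P u = A then (1 : ℝ) else 0) ≤ 4 / 3 := by
  have h : ∀ j : ℕ, ∃ L : ℕ, ∀ (n : Fin d → ℕ) (J : Finset (Fin d)), J.Nonempty → J.card ≤ s →
      ∀ f : Tup d n → ZMod 2, ML J f → ((2 ^ j : ℝ)⁻¹ / 3) ^ (2 ^ d) ≤ ex (fun u => sg (f u)) →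
      Rk J L f := fun j => hB _ (by positivity)
  choose L hL using h
  refine ⟨_, mono_sumr L, fun n P hv hr A hA => equi P (fun S hS hne => ?_) A hA⟩
  refine charBound _ (by positivity) ?_ s (L P.card)
    (fun K hK hKs f hf hb => hL P.card n K hK hKs f hf hb) P hv (hr.mono (le_sumr L le_rfl)) S hS hne
  have : (2 ^ P.card : ℝ)⁻¹ ≤ 1 := inv_le_one_of_one_le₀ (one_le_pow₀ (by norm_num))
  linarith

lemma reg_empty (L : ℕ) : Reg L (∅ : Finset (Pr d n)) := by
  intro S hS hne
  rw [Finset.subset_empty.1 hS] at hne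
  exact absurd hne (by simp)

lemma ind_nonneg (B : Finset (Tup d n)) (u : Tup d n) : 0 ≤ ind B u := by
  unfold ind; split_ifs <;> norm_num

lemma ind_le (B : Finset (Tup d n)) (u : Tup d n) : ind B u ≤ 1 := by
  unfold ind; split_ifs <;> norm_num

lemma nz_abs (r : Tup d n → ZMod 2) (u : Tup d n) : |nz r u| ≤ 1 := by
  unfold nz; split_ifs <;> norm_num

lemma cap_empty {δ : ℝ} (hδ : 0 < δ) {B : Finset (Tup d n)} (hB : δ ≤ ex (ind B))
    {r : Tup d n → ZMod 2} (hr : ML ∅ r)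
    (h : ex (fun u => ind B u * nz r u) ≤ 1 / 2 ^ (d + 1) / 2 * ex (ind B)) : r = 0 := by
  by_contra hne
  have h1 : ∀ u, r u = 1 := by
    intro u
    refine (zcases (r u)).resolve_left fun h0 => hne ?_
    ext v
    rw [hr.1 v u (by simp), h0]; rfl
  have h2 : (fun u => ind B u * nz r u) = ind B := by
    ext u; simp [nz, h1]
  rw [h2] at h
  have h3 : (1 : ℝ) / 2 ^ (d + 1) / 2 ≤ 1 / 2 := by
    have : (1 : ℝ) / 2 ^ (d + 1) ≤ 1 := by
      rw [div_le_one (by positivity)]; exact one_le_pow₀ (by norm_num)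
    linarith
  have h4 := mul_le_mul_of_nonneg_right h3 (hδ.le.trans hB)
  linarith

lemma step {s : ℕ} (T : ℕ → ℕ)
    (hT : ∀ (n : Fin d → ℕ) (P : Finset (Pr d n)), Valid s P → Reg (T P.card) P → ∀ A ⊆ P,
      2 / 3 ≤ 2 ^ P.card * ex (fun u => if val P u = A then (1 : ℝ) else 0) ∧
      2 ^ P.card * ex (fun u => if val P u = A then (1 : ℝ) else 0) ≤ 4 / 3)
    (m D F0 : ℕ) (hD : ∀ (n : Fin d → ℕ) (G P : Finset (Pr d n)), Valid s G → Valid s P →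
      G.card ≤ m → P.card ≤ 1 →
      (∀ x ∈ P, x.1.card ≤ s) → Reg F0 G →
      ∃ P' : Finset (Pr d n), Valid s P' ∧ G ⊆ P' ∧ P'.card ≤ D ∧ Reg (T P'.card) P' ∧
      ∀ x ∈ P, x.2 ∈ polyS P' x.1)
    {δ : ℝ} (hδ : 0 < δ) (B : Finset (Tup d n)) (hB : δ ≤ ex (ind B))
    (G : Finset (Pr d n)) (hG : Valid s G) (hm : G.card ≤ m) (hr : Reg F0 G) (hcap : ¬ Cap s B G) :
    ∃ P' : Finset (Pr d n), Valid s P' ∧ P'.card ≤ D ∧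
      en (ind B) (val G) + (1 / 2 ^ (d + 1) / 2 * δ) ^ 2 ≤ en (ind B) (val P') := by
  unfold Cap at hcap
  push Not at hcap
  obtain ⟨J, hJ, r, hrM, hrB, hrn⟩ := hcap
  have hJn : J.Nonempty := by
    rw [Finset.nonempty_iff_ne_empty]
    rintro rfl
    rw [cap_empty hδ hB hrM hrB] at hrn
    exact hrn (Submodule.zero_mem _)
  obtain ⟨P', k1, k2, k3, k4, k5⟩ := hD n G {(J, r)} hG
    (fun x hx => by rw [Finset.mem_singleton.1 hx]; exact ⟨hJn, hJ, hrM⟩) hm (by simp)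
    (fun x hx => by rw [Finset.mem_singleton.1 hx]; exact hJ) hr
  have hpoly : r ∈ polyS P' J := k5 (J, r) (Finset.mem_singleton_self _)
  refine ⟨P', k1, k3, ?_⟩
  obtain ⟨𝒮, h𝒮, hsum⟩ := poly_nf hpoly
  have hS0 : ∃ S0 ∈ 𝒮, Disjoint S0 G := by
    by_contra hno
    push Not at hno
    apply hrn
    rw [hsum]
    exact mem_id k1 h𝒮 hno
  obtain ⟨S0, hS0, hdis⟩ := hS0
  have hi := incr (ind B) (nz r) (ind_nonneg B) (nz_abs r) (val G) (val P')
    (fun u v h => by rw [val_inter k2, val_inter k2, h])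
    (fun u v h => by unfold nz; rw [poly_val hpoly h])
    (1 / 2 ^ (d + 1)) (by positivity)
    (fun u => dens k2 (hT n P' k1 k4) h𝒮 hS0 hdis r hsum u) hrB
  refine le_trans ?_ hi
  have : (1 / 2 ^ (d + 1) / 2 * δ) ^ 2 ≤ (1 / 2 ^ (d + 1) / 2 * ex (ind B)) ^ 2 :=
    pow_le_pow_left₀ (by positivity) (mul_le_mul_of_nonneg_left hB (by positivity)) 2
  linarith

lemma main_of_bias {s : ℕ} (hB : Bias d s) : Main d s := by
  intro δ hδ
  obtain ⟨T, hTm, hT⟩ := exT hB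
  have h1 := fun m => regA (d := d) s s T hTm m 1
  choose D F0 hDF using h1
  have h2 := fun a => regA (d := d) s s _ (mono_sumr F0) 0 a
  choose D' F0' hDF' using h2
  set η : ℝ := (1 / 2 ^ (d + 1) / 2 * δ) ^ 2 with hη
  have hηp : 0 < η := by positivity
  have hcl : ∀ j m : ℕ, ∃ L : ℕ, ∀ (n : Fin d → ℕ) (B : Finset (Tup d n)), δ ≤ ex (ind B) →
      ∀ G : Finset (Pr d n), Valid s G → G.card ≤ m →
      Reg (∑ i ∈ Finset.range (G.card + 1), F0 i) G → 1 - j * η ≤ en (ind B) (val G) →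
      ∃ G' : Finset (Pr d n), Valid s G' ∧ G'.card ≤ L ∧ Cap s B G' := by
    intro j
    induction j with
    | zero =>
      intro m
      refine ⟨m, fun n B hBd G hG hm hr he => ⟨G, hG, hm, ?_⟩⟩
      by_contra hcap
      obtain ⟨P', _, _, k3⟩ := step T hT G.card (D G.card) (F0 G.card) (hDF G.card) hδ B hBd G hG
        le_rfl (hr.mono (le_sumr F0 le_rfl)) hcap
      have := en_le_one (ind B) (ind_nonneg B) (ind_le B) (val P')
      push_cast at he
      rw [← hη] at k3
      linarith
    | succ j ih =>
      intro m
      set a := ∑ i ∈ Finset.range (m + 1), D i with ha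
      obtain ⟨L, hL⟩ := ih (D' a)
      refine ⟨max m L, fun n B hBd G hG hm hr he => ?_⟩
      by_cases hcap : Cap s B G
      · exact ⟨G, hG, hm.trans (le_max_left _ _), hcap⟩
      · obtain ⟨P', k1, k2, k3⟩ := step T hT G.card (D G.card) (F0 G.card) (hDF G.card) hδ B hBd G
          hG le_rfl (hr.mono (le_sumr F0 le_rfl)) hcap
        rw [← hη] at k3
        obtain ⟨G', g1, _, g2, g3, g4⟩ := hDF' a n ∅ P' (fun x hx => by simp at hx) k1 (by simp)
          (k2.trans (le_sumr D hm)) (fun x hx => (k1 x hx).2.1) (reg_empty _)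
        have hmono := en_mono (ind B) (val P') (val G') (fun u v h => by
          unfold val
          refine Finset.filter_congr fun x hx => ?_
          rw [poly_val (g4 x hx) h])
        obtain ⟨G'', q1, q2, q3⟩ := hL n B hBd G' g1 g2 g3 (by
          push_cast at he
          linarith)
        exact ⟨G'', q1, q2.trans (le_max_right _ _), q3⟩
  obtain ⟨j, hj⟩ := exists_nat_ge (1 / η)
  obtain ⟨L, hL⟩ := hcl j 0
  refine ⟨L, fun n B hBd => hL n B hBd ∅ (fun x hx => by simp at hx) (by simp) (reg_empty _) ?_⟩
  have e1 : 1 ≤ j * η := by rwa [div_le_iff₀ hηp] at hj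
  have e2 : 0 ≤ en (ind B) (val (∅ : Finset (Pr d n))) := ex_nonneg fun u => sq_nonneg _
  linarith

lemma ML.smul {J : Finset (Fin d)} {f : Tup d n → ZMod 2} (c : ZMod 2) (hf : ML J f) :
    ML J (c • f) := by
  rcases zcases c with rfl | rfl
  · rw [zero_smul]; exact ML.zero J
  · rwa [one_smul]

/-- proper ideal -/
def idP (G : Finset (Pr d n)) (J : Finset (Fin d)) : Submodule (ZMod 2) (Tup d n → ZMod 2) :=
  Submodule.span (ZMod 2) {f | ∃ x ∈ G, x.1 ⊂ J ∧ ∃ w, ML (J \ x.1) w ∧ f = x.2 * w}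

lemma idP_nf {G : Finset (Pr d n)} {J : Finset (Fin d)} {f : Tup d n → ZMod 2}
    (hf : f ∈ idP G J) : ∃ W : Pr d n → Tup d n → ZMod 2, (∀ x, ML (J \ x.1) (W x)) ∧
      f = ∑ x ∈ G.filter (fun x => x.1 ⊂ J), x.2 * W x := by
  induction hf using Submodule.span_induction with
  | mem f hf =>
    obtain ⟨x, hx, hxJ, w, hw, rfl⟩ := hf
    refine ⟨fun y => if y = x then w else 0, fun y => ?_, ?_⟩
    · by_cases h : y = x
      · simp only [h, if_true]; exact hw
      · simp only [h, if_false]; exact ML.zero _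
    · rw [Finset.sum_eq_single_of_mem x (Finset.mem_filter.2 ⟨hx, hxJ⟩)]
      · simp
      · intro y _ hy; simp [hy]
  | zero => exact ⟨fun _ => 0, fun _ => ML.zero _, by simp⟩
  | add f g _ _ hf hg =>
    obtain ⟨W, hW, rfl⟩ := hf
    obtain ⟨W', hW', rfl⟩ := hg
    refine ⟨fun x => W x + W' x, fun x => (hW x).add (hW' x), ?_⟩
    rw [← Finset.sum_add_distrib]
    refine Finset.sum_congr rfl fun x _ => by ring
  | smul c f _ hf =>
    obtain ⟨W, hW, rfl⟩ := hf
    refine ⟨fun x => c • W x, fun x => (hW x).smul c, ?_⟩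
    rw [Finset.smul_sum]
    refine Finset.sum_congr rfl fun x _ => ?_
    rw [mul_smul_comm]

lemma idP_rk {s L : ℕ} {G : Finset (Pr d n)} (hG : Valid s G) (hL : G.card ≤ L)
    {J : Finset (Fin d)} {f : Tup d n → ZMod 2} (hf : f ∈ idP G J) : Rk J L f := by
  obtain ⟨W, hW, hsum⟩ := idP_nf hf
  set A := G.filter (fun x => x.1 ⊂ J) with hA
  refine ⟨A.card, (Finset.card_le_card (Finset.filter_subset _ _)).trans hL,
    fun l => (A.equivFin.symm l).1.1, fun l => (A.equivFin.symm l).1.2,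
    fun l => W (A.equivFin.symm l).1, fun l => ?_, ?_⟩
  · have h := Finset.mem_filter.1 (A.equivFin.symm l).2
    have h' := hG _ h.1
    exact ⟨h'.1, h.2, h'.2.2, hW _⟩
  · rw [hsum, Equiv.sum_comp A.equivFin.symm (fun x : A => x.1.2 * W x.1)]
    exact (Finset.sum_coe_sort A (fun x => x.2 * W x)).symm

lemma ML_coord (i : Fin d) (k : Fin (n i)) : ML {i} (fun u : Tup d n => u i k) := by
  refine ⟨fun u v h => congrFun (h i (by simp)) k, fun j hj u a b => ?_⟩
  have hj' := Finset.mem_singleton.1 hj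
  subst hj'
  simp

lemma id_mul {G : Finset (Pr d n)} {J : Finset (Fin d)} {i : Fin d} (hi : i ∈ J)
    {r c : Tup d n → ZMod 2} (hc : ML {i} c) (hr : r ∈ idS G (J.erase i)) : c * r ∈ idP G J := by
  induction hr using Submodule.span_induction with
  | mem f hf =>
    obtain ⟨x, hx, hxJ, w, hw, rfl⟩ := hf
    have hix : i ∉ x.1 := fun h => by simpa using hxJ h
    refine Submodule.subset_span ⟨x, hx, ?_, c * w, ?_, by ring⟩
    · exact lt_of_le_of_lt hxJ (Finset.erase_ssubset hi)
    · have := ML.mul (J := {i}) (K := J.erase i \ x.1) (by simp) hc hw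
      convert this using 1
      ext j
      simp only [Finset.mem_sdiff, Finset.mem_union, Finset.mem_singleton, Finset.mem_erase]
      constructor
      · rintro ⟨h, h'⟩
        by_cases e : j = i
        · exact Or.inl e
        · exact Or.inr ⟨⟨e, h⟩, h'⟩
      · rintro (rfl | h)
        · exact ⟨hi, hix⟩
        · exact ⟨h.1.2, h.2⟩
  | zero => simp
  | add f g _ _ hf hg => rw [mul_add]; exact Submodule.add_mem _ hf hg
  | smul a f _ hf => rw [mul_smul_comm]; exact Submodule.smul_mem _ _ hf

lemma ML_expand {J : Finset (Fin d)} {f : Tup d n → ZMod 2} (hf : ML J f) {i : Fin d}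
    (hi : i ∈ J) : f = ∑ k : Fin (n i), (fun u : Tup d n => u i k) *
      (fun u : Tup d n => f (Function.update u i (Pi.single k 1))) := by
  ext u
  rw [Finset.sum_apply]
  set g : (Fin (n i) → ZMod 2) →+ ZMod 2 :=
    AddMonoidHom.mk' (fun y => f (Function.update u i y)) (fun a b => hf.2 i hi u a b) with hg
  have h1 : f u = g (u i) := by simp [hg]
  have h2 : g (u i) = ∑ k, g (Pi.single k (u i k)) := by
    rw [← map_sum, Finset.univ_sum_single]
  rw [h1, h2]
  refine Finset.sum_congr rfl fun k _ => ?_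
  simp only [Pi.mul_apply]
  change _ = u i k * g (Pi.single k 1)
  rcases zcases (u i k) with h | h
  · rw [h]; simp
  · rw [h, one_mul]

lemma avg_char {W : Type*} [Fintype W] [AddCommGroup W] (g : W → ZMod 2)
    (hg : ∀ a b, g (a + b) = g a + g b) {y : W} (hy : g y = 1) : ex (fun w => sg (g w)) = 0 := by
  have h := ex_shift y (fun w => sg (g w))
  have e : (fun w => sg (g (w + y))) = fun w => (-1) * sg (g w) := by
    ext w; rw [hg, sg_add, hy, sg_one]; ring
  rw [e, ex_mul] at h
  linarith

lemma bias_succ {s : ℕ} (hM : Main d s) : Bias d (s + 1) := by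
  intro δ hδ
  obtain ⟨L, hL⟩ := hM δ hδ
  refine ⟨L, fun n J hJn hJ f hf hb => ?_⟩
  obtain ⟨i, hi⟩ := hJn
  set B : Finset (Tup d n) := Finset.univ.filter
    (fun u => ∀ y : Fin (n i) → ZMod 2, f (Function.update u i y) = 0) with hB
  have hex : ex (fun u => sg (f u)) = ex (ind B) := by
    rw [← ex_slice i (fun u => sg (f u)), ex_comm]
    congr 1
    ext u
    unfold ind
    split_ifs with h
    · have h' := (Finset.mem_filter.1 h).2
      simp only [h', sg_zero, ex_const]
    · have : ∃ y : Fin (n i) → ZMod 2, f (Function.update u i y) = 1 := by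
        by_contra hno
        push Not at hno
        exact h (Finset.mem_filter.2 ⟨Finset.mem_univ _, fun y => (zcases _).resolve_right (hno y)⟩)
      obtain ⟨y, hy⟩ := this
      exact avg_char (fun w : Fin (n i) → ZMod 2 => f (Function.update u i w))
        (fun a b => hf.2 i hi u a b) hy
  rw [hex] at hb
  obtain ⟨G, hG, hGL, hcap⟩ := hL n B hb
  refine idP_rk hG hGL ?_
  rw [ML_expand hf hi]
  refine Submodule.sum_mem _ fun k _ => id_mul hi (ML_coord i k) ?_
  refine hcap (J.erase i) ?_ _ (ML.slice (by simp) (by rwa [Finset.insert_erase hi]) _) ?_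
  · rw [Finset.card_erase_of_mem hi]; omega
  · have : (fun u => ind B u * nz (fun u : Tup d n =>
        f (Function.update u i (Pi.single k 1))) u) = fun _ => (0 : ℝ) := by
      ext u
      unfold ind nz
      split_ifs with h1 h2 h2
      · simp
      · exact absurd ((Finset.mem_filter.1 h1).2 _) h2
      · simp
      · simp
    rw [this, ex_const]
    have := hδ.le.trans hb
    positivity

lemma bias_all (s : ℕ) : Bias d s := by
  induction s with
  | zero =>
    intro δ _
    refine ⟨0, fun n J hJ hc => ?_⟩
    have := hJ.card_pos
    omega
  | succ s ih => exact bias_succ (main_of_bias ih)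

/-- basis tuple -/
def eT (x : (i : Fin d) → Fin (n i)) : Tup d n := fun i => Pi.single (x i) 1

/-- evaluation at basis tuples -/
def evL : (Tup d n → ZMod 2) →ₗ[ZMod 2] Arr d n where
  toFun f := fun x => f (eT x)
  map_add' _ _ := rfl
  map_smul' _ _ := rfl

lemma tensor_update (u : Tup d n) (i : Fin d) (c : Fin (n i) → ZMod 2)
    (x : (i : Fin d) → Fin (n i)) : tensorOf d n (Function.update u i c) x =
      c (x i) * ∏ j ∈ Finset.univ.erase i, u j (x j) := by
  unfold tensorOf
  rw [← Finset.mul_prod_erase _ _ (Finset.mem_univ i)]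
  congr 1
  · simp
  · refine Finset.prod_congr rfl fun j hj => ?_
    rw [Function.update_of_ne (Finset.ne_of_mem_erase hj)]

lemma ML_dot (r : Arr d n) : ML Finset.univ (fun u => arrDot d n r (tensorOf d n u)) := by
  refine ⟨fun u v h => ?_, fun i _ u a b => ?_⟩
  · have : u = v := funext fun i => h i (Finset.mem_univ i)
    rw [this]
  · unfold arrDot
    rw [← Finset.sum_add_distrib]
    refine Finset.sum_congr rfl fun x _ => ?_
    rw [tensor_update, tensor_update, tensor_update, Pi.add_apply]
    ring

lemma ev_dot (r : Arr d n) : evL (fun u => arrDot d n r (tensorOf d n u)) = r := by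
  ext x
  change arrDot d n r (tensorOf d n (eT x)) = r x
  unfold arrDot
  rw [Finset.sum_eq_single_of_mem x (Finset.mem_univ x)]
  · have : tensorOf d n (eT x) x = 1 := by simp [tensorOf, eT]
    rw [this, mul_one]
  · intro y _ hy
    have : tensorOf d n (eT x) y = 0 := by
      obtain ⟨i, hi⟩ := Function.ne_iff.1 hy
      exact Finset.prod_eq_zero (Finset.mem_univ i) (by simp [eT, hi])
    rw [this, mul_zero]

/-- restriction of a form of type `I` to an array over `I` -/
def resI (I : Finset (Fin d)) (v : Tup d n → ZMod 2) : F2I d n I :=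
  fun y => v (fun i => if h : i ∈ I then Pi.single (y ⟨i, h⟩) 1 else 0)

/-- the subspaces -/
def VI (G : Finset (Pr d n)) (I : Finset (Fin d)) : Submodule (ZMod 2) (F2I d n I) :=
  Submodule.span (ZMod 2) ((fun x : Pr d n => resI I x.2) '' (G : Set (Pr d n)))

lemma rank_im {M ι : Type*} [AddCommGroup M] [Module (ZMod 2) M] (G : Finset ι) (g : ι → M) :
    Module.finrank (ZMod 2) (Submodule.span (ZMod 2) (g '' (G : Set ι))) ≤ G.card := by
  classical
  have h := finrank_span_finset_le_card (R := ZMod 2) (G.image g)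
  rw [Finset.coe_image] at h
  exact h.trans Finset.card_image_le

lemma VI_rank (G : Finset (Pr d n)) (I : Finset (Fin d)) :
    Module.finrank (ZMod 2) (VI G I) ≤ G.card :=
  rank_im G (fun x : Pr d n => resI I x.2)

lemma ev_id {s : ℕ} {G : Finset (Pr d n)} (hG : Valid s G) {f : Tup d n → ZMod 2}
    (hf : f ∈ idS G Finset.univ) :
    evL f ∈ ⨆ (I : Finset (Fin d)) (_ : I.Nonempty), cylSub d n I (VI G I) := by
  induction hf using Submodule.span_induction with
  | mem f hf =>
    obtain ⟨x, hx, _, w, hw, rfl⟩ := hf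
    obtain ⟨hne, _, hv⟩ := hG x hx
    refine Submodule.mem_iSup_of_mem x.1 (Submodule.mem_iSup_of_mem hne ?_)
    intro z
    set c : ZMod 2 := w (fun i => if h : i ∈ x.1 then 0 else Pi.single (z ⟨i, h⟩) 1) with hc
    have e : arrSlice d n x.1 (evL (x.2 * w)) z = c • resI x.1 x.2 := by
      ext y
      change x.2 (eT _) * w (eT _) = c * x.2 _
      rw [mul_comm]
      congr 1
      · refine hw.1 _ _ fun i hi => ?_
        have hi' : i ∉ x.1 := (Finset.mem_sdiff.1 hi).2
        simp [eT, hi']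
      · refine hv.1 _ _ fun i hi => ?_
        simp [eT, hi]
    rw [e]
    refine Submodule.smul_mem _ _ (Submodule.subset_span ?_)
    exact ⟨x, Finset.mem_coe.2 hx, rfl⟩
  | zero => rw [map_zero]; exact Submodule.zero_mem _
  | add f g _ _ hf hg => rw [map_add]; exact Submodule.add_mem _ hf hg
  | smul c f _ hf => rw [map_smul]; exact Submodule.smul_mem _ _ hf

lemma ex_ind (B : Finset (Tup d n)) :
    ex (ind B) = (B.card : ℝ) / (Fintype.card (Tup d n) : ℝ) := by
  unfold ex ind
  congr 1
  simp

lemma ex_ind_nz (B : Finset (Tup d n)) (r : Tup d n → ZMod 2) :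
    ex (fun u => ind B u * nz r u) =
      ((B.card : ℝ) - ((B.filter (fun u => r u = 0)).card : ℝ)) /
        (Fintype.card (Tup d n) : ℝ) := by
  unfold ex
  congr 1
  have h1 : ((B.filter (fun u => r u = 0)).card : ℝ) + ((B.filter (fun u => ¬ r u = 0)).card : ℝ) =
      (B.card : ℝ) := by
    exact_mod_cast Finset.card_filter_add_card_filter_not (s := B) (fun u => r u = 0)
  have h2 : ∑ u, ind B u * nz r u = ((B.filter (fun u => ¬ r u = 0)).card : ℝ) := by
    rw [Finset.card_filter, Nat.cast_sum]
    have : ∀ u, ind B u * nz r u = if u ∈ B then nz r u else 0 := by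
      intro u; unfold ind; split_ifs <;> simp
    simp_rw [this]
    rw [Finset.sum_ite_mem, Finset.univ_inter]
    refine Finset.sum_congr rfl fun u _ => ?_
    unfold nz
    split_ifs <;> simp
  rw [h2]; linarith

lemma card_tup : (Fintype.card (Tup d n) : ℝ) = 2 ^ (∑ i, n i) := by
  have : Fintype.card (Tup d n) = 2 ^ (∑ i, n i) := by
    rw [Fintype.card_pi]
    simp [ZMod.card, Finset.prod_pow_eq_pow_sum]
  rw [this]; push_cast; rfl

end PF

theorem stmt7 (d : ℕ) (hd : 0 < d) :
    ∃ f₁ : ℕ, 0 < f₁ ∧ ∃ f₃ : ℝ, 0 < f₃ ∧ f₃ < 1 ∧ ∀ δ : ℝ, 0 < δ → ∃ f₂ : ℕ, 0 < f₂ ∧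
      ∀ n : Fin d → ℕ, (∀ i, 0 < n i) →
        ∀ B' : Finset (Tup d n), δ * 2 ^ (∑ i, n i) ≤ (B'.card : ℝ) →
          ∃ Q : Multiset (Arr d n), Q ≠ 0 ∧ (∀ q ∈ Q, q ∈ sumAtMost d n f₁ B') ∧
            ∃ V : (I : Finset (Fin d)) → Submodule (ZMod 2) (F2I d n I),
              (∀ I : Finset (Fin d), I.Nonempty → Module.finrank (ZMod 2) (V I) ≤ f₂) ∧
              ∀ r : Arr d n,
                ((1 - f₃) * Multiset.card Q ≤
                  ((Multiset.card (Q.filter (fun q => arrDot d n r q = 0))) : ℝ)) →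
                r ∈ ⨆ (I : Finset (Fin d)) (_ : I.Nonempty), cylSub d n I (V I) := by
  refine ⟨1, one_pos, 1 / 2 ^ (d + 1) / 2, by positivity, ?_, fun δ hδ => ?_⟩
  · have : (1 : ℝ) / 2 ^ (d + 1) ≤ 1 := by
      rw [div_le_one (by positivity)]; exact one_le_pow₀ (by norm_num)
    linarith
  · obtain ⟨L, hL⟩ := PF.main_of_bias (PF.bias_all (d := d) d) δ hδ
    refine ⟨L + 1, Nat.succ_pos _, fun n _ B' hB' => ?_⟩
    have hcp : (0 : ℝ) < (Fintype.card (Tup d n) : ℝ) := PF.cpos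
    have hcard : (0 : ℝ) < (B'.card : ℝ) := lt_of_lt_of_le (by positivity) hB'
    obtain ⟨G, hG, hGL, hcap⟩ := hL n B' (by
      rw [PF.ex_ind, le_div_iff₀ hcp, PF.card_tup]; exact hB')
    refine ⟨B'.val.map (tensorOf d n), ?_, ?_, PF.VI G, ?_, ?_⟩
    · intro h0
      have h1 := congrArg Multiset.card h0
      rw [Multiset.card_map, Multiset.card_zero] at h1
      have h2 : B'.card = 0 := h1
      rw [h2] at hcard
      simp at hcard
    · intro q hq
      obtain ⟨u, hu, rfl⟩ := Multiset.mem_map.1 hq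
      exact ⟨{u}, by simp, fun v hv => by rw [Multiset.mem_singleton.1 hv]; exact hu, by simp⟩
    · intro I _
      exact (PF.VI_rank G I).trans (by omega)
    · intro r hr
      rw [← PF.ev_dot r]
      refine PF.ev_id hG (hcap Finset.univ (by simp) _ (PF.ML_dot r) ?_)
      rw [Multiset.filter_map, Multiset.card_map, Multiset.card_map] at hr
      have e1 : Multiset.card B'.val = B'.card := rfl
      have e2 : Multiset.card (Multiset.filter
          ((fun q => arrDot d n r q = 0) ∘ tensorOf d n) B'.val) =
          (B'.filter (fun u => arrDot d n r (tensorOf d n u) = 0)).card := rfl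
      rw [e1, e2] at hr
      rw [PF.ex_ind_nz, PF.ex_ind, mul_div_assoc']
      refine div_le_div_of_nonneg_right ?_ hcp.le
      linarith
end

section
/- There exists an absolute constant ε > 0 such that for every positive integer k there exists a positive integer K with the following property. Let n_1, n_2 be positive integers, let U ⊆ F_2^{n_1} be a subspace of codimension at most k, and for each u ∈ U let V_u ⊆ F_2^{n_2} be a subspace of codimension at most k, with all the V_u having the same codimension. Let Q be the multiset of matrices u⊗v indexed by pairs (u,v) with u ∈ U and v ∈ V_u, so |Q| = Σ_{u∈U}|V_u|. Then there exist subspaces W_{12} ⊆ 𝒢, W_1 ⊆ F_2^{n_1}, and W_2 ⊆ F_2^{n_2}, each of dimension at most K, such that every r ∈ 𝒢 satisfying r·(u⊗v) = 0 for at least (1−ε)|Q| of the pairs (u,v) with u ∈ U, v ∈ V_u lies in W_{12} + W_1⊗F_2^{n_2} + F_2^{n_1}⊗W_2. -/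
/-- The entrywise dot product of two matrices over `F_2`. -/
def matDot (n₁ n₂ : ℕ) (r q : Matrix (Fin n₁) (Fin n₂) (ZMod 2)) : ZMod 2 :=
  ∑ i, ∑ j, r i j * q i j

/-- The subspace `W ⊗ F_2^{n₂}` of matrices all of whose columns lie in `W`. -/
def colCyl (n₁ n₂ : ℕ) (W : Submodule (ZMod 2) (Fin n₁ → ZMod 2)) :
    Submodule (ZMod 2) (Matrix (Fin n₁) (Fin n₂) (ZMod 2)) where
  carrier := {r | ∀ j, (fun i => r i j) ∈ W}
  add_mem' := fun ha hb j => W.add_mem (ha j) (hb j)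
  zero_mem' := fun j => W.zero_mem
  smul_mem' := fun c _ hr j => W.smul_mem c (hr j)

/-- The subspace `F_2^{n₁} ⊗ W` of matrices all of whose rows lie in `W`. -/
def rowCyl (n₁ n₂ : ℕ) (W : Submodule (ZMod 2) (Fin n₂ → ZMod 2)) :
    Submodule (ZMod 2) (Matrix (Fin n₁) (Fin n₂) (ZMod 2)) where
  carrier := {r | ∀ i, (fun j => r i j) ∈ W}
  add_mem' := fun ha hb i => W.add_mem (ha i) (hb i)
  zero_mem' := fun i => W.zero_mem
  smul_mem' := fun c _ hr i => W.smul_mem c (hr i)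

/-- The number of pairs `(u, v)` indexing the multiset `Q = {u ⊗ v : u ∈ U, v ∈ V_u}`
that satisfy the predicate `p`. -/
noncomputable def qCount (n₁ n₂ : ℕ) (U : Submodule (ZMod 2) (Fin n₁ → ZMod 2))
    (V : (Fin n₁ → ZMod 2) → Submodule (ZMod 2) (Fin n₂ → ZMod 2))
    (p : (Fin n₁ → ZMod 2) → (Fin n₂ → ZMod 2) → Prop) : ℕ :=
  Set.ncard {q : (Fin n₁ → ZMod 2) × (Fin n₂ → ZMod 2) |
    q.1 ∈ U ∧ q.2 ∈ V q.1 ∧ p q.1 q.2}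

open Classical in
lemma half_card {E : Type*} [AddCommGroup E] [Module (ZMod 2) E] [Fintype E]
    (H : Submodule (ZMod 2) E) (h : H ≠ ⊤) :
    2 * (Finset.univ.filter (fun u => u ∈ H)).card ≤ Fintype.card E := by
  have h1 := H.toAddSubgroup.card_mul_index
  have h2 : H.toAddSubgroup.index ≠ 1 := by
    intro h3
    apply h
    rw [AddSubgroup.index_eq_one] at h3
    exact Submodule.toAddSubgroup_injective (by simpa using h3)
  have h3 : H.toAddSubgroup.index ≠ 0 := AddSubgroup.index_ne_zero_of_finite
  have h4 : Nat.card H.toAddSubgroup = (Finset.univ.filter (fun u => u ∈ H)).card := by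
    rw [Nat.card_eq_fintype_card, Fintype.card_subtype]; simp
  rw [← h4, ← Nat.card_eq_fintype_card, ← h1, mul_comm]
  apply Nat.mul_le_mul_left
  omega

open Classical in
noncomputable def gcount {E N : Type*} [AddCommGroup E] [Module (ZMod 2) E] [Fintype E]
    [AddCommGroup N] [Module (ZMod 2) N] (A : E → Submodule (ZMod 2) N)
    (θ : E →ₗ[ZMod 2] N) : ℕ := (Finset.univ.filter (fun u => θ u ∈ A u)).card

open Classical in
lemma lemB {E N : Type*} [AddCommGroup E] [Module (ZMod 2) E] [Fintype E]
    [AddCommGroup N] [Module (ZMod 2) N] [Finite N] (A : E → Submodule (ZMod 2) N) (k ρ : ℕ)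
    (hA : ∀ u, Module.finrank (ZMod 2) (A u) ≤ k) :
    ∃ W : Submodule (ZMod 2) N, Module.finrank (ZMod 2) W ≤ ρ * (4 * k + 1) ∧
      ∀ θ : E →ₗ[ZMod 2] N, Module.finrank (ZMod 2) (LinearMap.range θ) ≤ ρ →
        3 * Fintype.card E ≤ 4 * gcount A θ → LinearMap.range θ ≤ W := by
  by_contra! hcon
  have key : ∀ n : ℕ, n ≤ 4 * k + 1 → ∃ W : Submodule (ZMod 2) N,
      Module.finrank (ZMod 2) W ≤ ρ * n ∧
      n * Fintype.card E ≤ 4 * ∑ u, Module.finrank (ZMod 2) (A u ⊓ W : Submodule (ZMod 2) N) := by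
    intro n
    induction n with
    | zero => intro _; exact ⟨⊥, by simp, by simp⟩
    | succ n ih =>
      intro hn
      obtain ⟨W, hW, hs⟩ := ih (by omega)
      obtain ⟨θ, h1, h2, h3⟩ := hcon W (hW.trans (Nat.mul_le_mul_left _ (by omega)))
      refine ⟨W ⊔ LinearMap.range θ, ?_, ?_⟩
      · have := Submodule.finrank_add_le_finrank_add_finrank W (LinearMap.range θ)
        rw [mul_add, mul_one]; omega
      · have hbad := half_card (W.comap θ) (by
          intro h; apply h3; rintro _ ⟨x, rfl⟩
          have : x ∈ W.comap θ := h ▸ Submodule.mem_top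
          exact this)
        have hu : ∀ u, Module.finrank (ZMod 2) (A u ⊓ W : Submodule (ZMod 2) N)
            + (if θ u ∈ A u then 1 else 0) ≤
            Module.finrank (ZMod 2) (A u ⊓ (W ⊔ LinearMap.range θ) : Submodule (ZMod 2) N)
              + (if u ∈ W.comap θ then 1 else 0) := by
          intro u
          have hle : A u ⊓ W ≤ A u ⊓ (W ⊔ LinearMap.range θ) := inf_le_inf_left _ le_sup_left
          have := Submodule.finrank_mono hle
          by_cases ha : θ u ∈ A u
          · by_cases hw : u ∈ W.comap θ
            · simp [ha, hw, this]
            · have hlt : A u ⊓ W < A u ⊓ (W ⊔ LinearMap.range θ) := by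
                refine lt_of_le_of_ne hle ?_
                intro he
                apply hw
                have : θ u ∈ A u ⊓ (W ⊔ LinearMap.range θ) :=
                  ⟨ha, (le_sup_right : LinearMap.range θ ≤ _) ⟨u, rfl⟩⟩
                rw [← he] at this
                exact this.2
              have := Submodule.finrank_lt_finrank_of_lt hlt
              simp only [ha, hw, if_true, if_false]; omega
          · simp only [ha, if_false]; omega
        have hsum := Finset.sum_le_sum (fun u (_ : u ∈ Finset.univ) => hu u)
        rw [Finset.sum_add_distrib, Finset.sum_add_distrib, ← Finset.card_filter,
          ← Finset.card_filter] at hsum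
        unfold gcount at h2
        rw [add_mul, one_mul]
        omega
  obtain ⟨W, _, hs⟩ := key _ le_rfl
  have hb : ∑ u, Module.finrank (ZMod 2) (A u ⊓ W : Submodule (ZMod 2) N) ≤
      ∑ u : E, k := Finset.sum_le_sum fun u _ => (Submodule.finrank_mono inf_le_left).trans (hA u)
  simp only [Finset.sum_const, Finset.card_univ, smul_eq_mul] at hb
  have : 0 < Fintype.card E := Fintype.card_pos
  nlinarith

lemma card_ker {E N : Type*} [AddCommGroup E] [Module (ZMod 2) E] [Fintype E]
    [AddCommGroup N] [Module (ZMod 2) N] [Finite N] (θ : E →ₗ[ZMod 2] N) :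
    2 ^ Module.finrank (ZMod 2) (LinearMap.range θ) * Nat.card (LinearMap.ker θ)
     = Fintype.card E := by
  have h := θ.finrank_range_add_finrank_ker
  have h1 := Module.natCard_eq_pow_finrank (K := ZMod 2) (V := E)
  have h2 := Module.natCard_eq_pow_finrank (K := ZMod 2) (V := LinearMap.ker θ)
  rw [← Nat.card_eq_fintype_card, h1, h2, ← h, pow_add]
  simp

open Classical in
lemma lemA1 {E N : Type*} [AddCommGroup E] [Module (ZMod 2) E] [Fintype E]
    [AddCommGroup N] [Module (ZMod 2) N] [Finite N] (A : E → Submodule (ZMod 2) N) (k : ℕ)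
    (hA : ∀ u, Module.finrank (ZMod 2) (A u) ≤ k) (T : Finset (E →ₗ[ZMod 2] N))
    (hT : ∀ t ∈ T, 7 * Fintype.card E ≤ 8 * gcount A t)
    (hp : ∀ t ∈ T, ∀ s ∈ T, t ≠ s →
      2 * k + 5 < Module.finrank (ZMod 2) (LinearMap.range (t - s))) :
    T.card ≠ 2 ^ (k + 2) := by
  intro hc
  have hu : ∀ u, (T.filter (fun t => t u ∈ A u)).card ≤ 2 ^ k +
      T.card * (if ∃ p ∈ T.offDiag, p.1 u = p.2 u then 1 else 0) := by
    intro u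
    split_ifs with h
    · have := Finset.card_filter_le T (fun t => t u ∈ A u)
      rw [mul_one]
      exact this.trans (Nat.le_add_left _ _)
    · simp only [mul_zero, add_zero]
      push Not at h
      have : Nat.card (A u) ≤ 2 ^ k := by
        rw [Module.natCard_eq_pow_finrank (K := ZMod 2)]
        simp only [Nat.card_eq_fintype_card, ZMod.card]
        exact Nat.pow_le_pow_right (by norm_num) (hA u)
      refine le_trans ?_ this
      rw [← Fintype.card_coe, ← Nat.card_eq_fintype_card]
      refine Nat.card_le_card_of_injective
        (fun t : (T.filter (fun t => t u ∈ A u)) =>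
          (⟨t.1 u, (Finset.mem_filter.1 t.2).2⟩ : A u)) ?_
      intro t s hts
      by_contra hne
      refine h (t.1, s.1) ?_ (congrArg Subtype.val hts)
      rw [Finset.mem_offDiag]
      exact ⟨(Finset.mem_filter.1 t.2).1, (Finset.mem_filter.1 s.2).1,
        fun h => hne (Subtype.ext h)⟩
  have hsum := Finset.sum_le_sum (fun u (_ : u ∈ Finset.univ) => hu u)
  have hswap : ∑ u, (T.filter (fun t => t u ∈ A u)).card = ∑ t ∈ T, gcount A t := by
    simp only [gcount, Finset.card_filter]
    exact Finset.sum_comm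
  have hg : T.card * (7 * Fintype.card E) ≤ 8 * ∑ t ∈ T, gcount A t := by
    rw [Finset.mul_sum, ← smul_eq_mul]
    exact Finset.card_nsmul_le_sum _ _ _ hT
  rw [hswap, Finset.sum_add_distrib, ← Finset.mul_sum, Finset.sum_const, smul_eq_mul,
    Finset.card_univ] at hsum
  have hC : (∑ u : E, if ∃ p ∈ T.offDiag, p.1 u = p.2 u then 1 else 0) ≤
      ∑ p ∈ T.offDiag, Nat.card (LinearMap.ker (p.1 - p.2)) := by
    have : ∀ p : (E →ₗ[ZMod 2] N) × (E →ₗ[ZMod 2] N), Nat.card (LinearMap.ker (p.1 - p.2)) =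
        ∑ u : E, if p.1 u = p.2 u then 1 else 0 := by
      intro p
      rw [Nat.card_eq_fintype_card, Fintype.card_subtype, Finset.card_filter]
      simp [sub_eq_zero]
    simp only [this]
    rw [Finset.sum_comm]
    refine Finset.sum_le_sum fun u _ => ?_
    split_ifs with h
    · obtain ⟨p, hp, hpu⟩ := h
      refine le_trans ?_ (Finset.single_le_sum (fun _ _ => Nat.zero_le _) hp)
      simp [hpu]
    · simp
  have hD : ∀ p ∈ T.offDiag, 2 ^ (2 * k + 6) * Nat.card (LinearMap.ker (p.1 - p.2)) ≤
      Fintype.card E := by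
    intro p hpT
    rw [Finset.mem_offDiag] at hpT
    rw [← card_ker (p.1 - p.2)]
    exact Nat.mul_le_mul_right _ (Nat.pow_le_pow_right (by norm_num)
      (hp _ hpT.1 _ hpT.2.1 hpT.2.2))
  have hD2 := Finset.sum_le_card_nsmul _ _ _ hD
  rw [← Finset.mul_sum, smul_eq_mul, Finset.offDiag_card] at hD2
  set C := (∑ u : E, if ∃ p ∈ T.offDiag, p.1 u = p.2 u then 1 else 0)
  set D := ∑ p ∈ T.offDiag, Nat.card (LinearMap.ker (p.1 - p.2))
  have hE : 0 < Fintype.card E := Fintype.card_pos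
  have hD3 : 2 ^ (2 * k + 6) * D ≤ T.card * T.card * Fintype.card E :=
    hD2.trans (Nat.mul_le_mul_right _ (Nat.sub_le _ _))
  rw [hc] at hD3 hg hsum
  have hpos : 0 < 2 ^ k := by positivity
  generalize ∑ t ∈ T, gcount A t = G at *
  have e1 : 2 ^ (2 * k + 6) = 64 * (2 ^ k * 2 ^ k) := by ring
  have e2 : 2 ^ (k + 2) = 4 * 2 ^ k := by ring
  rw [e1, e2] at hD3
  rw [e2] at hg hsum
  generalize 2 ^ k = M at *
  have hD4 : 4 * D ≤ Fintype.card E := by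
    have : (16 * (M * M)) * (4 * D) ≤ (16 * (M * M)) * Fintype.card E := by nlinarith
    exact Nat.le_of_mul_le_mul_left this (by positivity)
  have hf : M * (28 * Fintype.card E) ≤ M * (8 * Fintype.card E + 32 * C) := by nlinarith
  have := Nat.le_of_mul_le_mul_left hf hpos
  omega

open Classical in
lemma lemA {E N : Type*} [AddCommGroup E] [Module (ZMod 2) E] [Fintype E]
    [AddCommGroup N] [Module (ZMod 2) N] [Finite N] (A : E → Submodule (ZMod 2) N) (k : ℕ)
    (hA : ∀ u, Module.finrank (ZMod 2) (A u) ≤ k) :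
    ∃ T : Finset (E →ₗ[ZMod 2] N), T.card ≤ 2 ^ (k + 2) ∧
    (∀ t ∈ T, 7 * Fintype.card E ≤ 8 * gcount A t) ∧
    ∀ θ : E →ₗ[ZMod 2] N, 7 * Fintype.card E ≤ 8 * gcount A θ → ∃ t ∈ T, 
      Module.finrank (ZMod 2) (LinearMap.range (θ - t)) ≤ 2 * k + 5 := by
  by_contra! hcon
  have key : ∀ n : ℕ, n ≤ 2 ^ (k + 2) → ∃ T : Finset (E →ₗ[ZMod 2] N), T.card = n ∧
      (∀ t ∈ T, 7 * Fintype.card E ≤ 8 * gcount A t) ∧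
      (∀ t ∈ T, ∀ s ∈ T, t ≠ s →
        2 * k + 5 < Module.finrank (ZMod 2) (LinearMap.range (t - s))) := by
    intro n
    induction n with
    | zero => intro _; exact ⟨∅, by simp⟩
    | succ n ih =>
      intro hn
      obtain ⟨T, h1, h2, h3⟩ := ih (by omega)
      obtain ⟨θ, g1, g2⟩ := hcon T (by omega) h2
      refine ⟨insert θ T, ?_, ?_, ?_⟩
      · rw [Finset.card_insert_of_notMem, h1]
        intro h
        have := g2 θ h
        rw [sub_self, LinearMap.range_zero, finrank_bot] at this
        omega
      · intro t ht
        rcases Finset.mem_insert.1 ht with rfl | ht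
        · exact g1
        · exact h2 t ht
      · intro t ht s hs hne
        rcases Finset.mem_insert.1 ht with rfl | htT <;>
        rcases Finset.mem_insert.1 hs with rfl | hsT
        · exact absurd rfl hne
        · exact g2 _ hsT
        · rw [← neg_sub, LinearMap.range_neg]; exact g2 _ htT
        · exact h3 t htT s hsT hne
  obtain ⟨T, h1, h2, h3⟩ := key _ le_rfl
  exact lemA1 A k hA T h2 h3 h1

open Classical in
lemma lemC {E N : Type*} [AddCommGroup E] [Module (ZMod 2) E] [Fintype E]
    [AddCommGroup N] [Module (ZMod 2) N] [Finite N] (A : E → Submodule (ZMod 2) N) (k : ℕ)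
    (hA : ∀ u, Module.finrank (ZMod 2) (A u) ≤ k) :
    ∃ T : Finset (E →ₗ[ZMod 2] N), T.card ≤ 2 ^ (k + 2) ∧
    ∃ W : Submodule (ZMod 2) N, Module.finrank (ZMod 2) W ≤ (2 * k + 5) * (4 * k + 1) ∧
    ∀ θ : E →ₗ[ZMod 2] N, 7 * Fintype.card E ≤ 8 * gcount A θ → ∃ t ∈ T, 
      LinearMap.range (θ - t) ≤ W := by
  obtain ⟨T, h1, h2, h3⟩ := lemA A k hA
  obtain ⟨W, w1, w2⟩ := lemB A k (2 * k + 5) hA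
  refine ⟨T, h1, W, w1, fun θ hθ => ?_⟩
  obtain ⟨t, ht, hr⟩ := h3 θ hθ
  refine ⟨t, ht, w2 _ hr ?_⟩
  have ht' := h2 t ht
  have : gcount A θ + gcount A t ≤ gcount A (θ - t) + Fintype.card E := by
    unfold gcount
    rw [← Finset.card_union_add_card_inter, add_comm]
    refine Nat.add_le_add (Finset.card_le_card ?_) (Finset.card_le_univ _)
    intro u hu
    simp only [Finset.mem_inter, Finset.mem_filter, Finset.mem_univ, true_and] at hu ⊢
    exact (A u).sub_mem hu.1 hu.2
  omega

/-- orthogonal complement for the dot product -/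
def perp (n : ℕ) (V : Submodule (ZMod 2) (Fin n → ZMod 2)) :
    Submodule (ZMod 2) (Fin n → ZMod 2) :=
  V.dualAnnihilator.comap (dotProductEquiv (ZMod 2) (Fin n)).toLinearMap

lemma mem_perp (n : ℕ) (V : Submodule (ZMod 2) (Fin n → ZMod 2)) (w : Fin n → ZMod 2) :
    w ∈ perp n V ↔ ∀ v ∈ V, w ⬝ᵥ v = 0 := by
  simp [perp, Submodule.mem_dualAnnihilator]

lemma finrank_perp (n : ℕ) (V : Submodule (ZMod 2) (Fin n → ZMod 2)) :
    Module.finrank (ZMod 2) (perp n V) = n - Module.finrank (ZMod 2) V := by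
  have h := Subspace.finrank_add_finrank_dualAnnihilator_eq V
  have h2 : Module.finrank (ZMod 2) (perp n V) =
      Module.finrank (ZMod 2) V.dualAnnihilator :=
    LinearEquiv.finrank_eq
      (LinearEquiv.ofSubmodule' (dotProductEquiv (ZMod 2) (Fin n)) V.dualAnnihilator)
  rw [Module.finrank_fin_fun] at h
  omega

lemma matDot_vecMulVec (n₁ n₂ : ℕ) (r : Matrix (Fin n₁) (Fin n₂) (ZMod 2))
    (u : Fin n₁ → ZMod 2) (v : Fin n₂ → ZMod 2) :
    matDot n₁ n₂ r (Matrix.vecMulVec u v) = Matrix.vecMul u r ⬝ᵥ v := by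
  simp only [matDot, Matrix.vecMulVec_apply, Matrix.vecMul, dotProduct, Finset.sum_mul]
  rw [Finset.sum_comm]
  refine Finset.sum_congr rfl fun j _ => Finset.sum_congr rfl fun i _ => by ring

open Classical in
lemma qCount_eq (n₁ n₂ : ℕ) (U : Submodule (ZMod 2) (Fin n₁ → ZMod 2))
    (V : (Fin n₁ → ZMod 2) → Submodule (ZMod 2) (Fin n₂ → ZMod 2))
    (p : (Fin n₁ → ZMod 2) → (Fin n₂ → ZMod 2) → Prop) :
    qCount n₁ n₂ U V p = ∑ u : U, (Finset.univ.filter (fun v : V u => p u v)).card := by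
  have e : {q : (Fin n₁ → ZMod 2) × (Fin n₂ → ZMod 2) |
      q.1 ∈ U ∧ q.2 ∈ V q.1 ∧ p q.1 q.2} ≃ Σ u : U, {v : V u // p u v} :=
    { toFun := fun q => ⟨⟨q.1.1, q.2.1⟩, ⟨⟨q.1.2, q.2.2.1⟩, q.2.2.2⟩⟩
      invFun := fun x => ⟨(x.1.1, x.2.1.1), x.1.2, x.2.1.2, x.2.2⟩
      left_inv := fun _ => rfl
      right_inv := fun _ => rfl }
  unfold qCount
  rw [← Nat.card_coe_set_eq, Nat.card_congr e, Nat.card_eq_fintype_card, Fintype.card_sigma]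
  simp only [Fintype.card_subtype]

open Classical in
lemma good_of (n₁ n₂ : ℕ) (U : Submodule (ZMod 2) (Fin n₁ → ZMod 2))
    (V : (Fin n₁ → ZMod 2) → Submodule (ZMod 2) (Fin n₂ → ZMod 2))
    (hV : ∀ u ∈ U, ∀ u' ∈ U,
      Module.finrank (ZMod 2) (V u) = Module.finrank (ZMod 2) (V u'))
    (r : Matrix (Fin n₁) (Fin n₂) (ZMod 2))
    (h : ((1 - 1 / 16) * qCount n₁ n₂ U V (fun _ _ => True) ≤
      (qCount n₁ n₂ U V (fun u v => matDot n₁ n₂ r (Matrix.vecMulVec u v) = 0) : ℝ))) :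
    7 * Fintype.card U ≤ 8 * gcount (fun u : U => perp n₂ (V u))
      (r.vecMulLinear ∘ₗ U.subtype) := by
  set m := Fintype.card (V 0) with hm
  have hcard : ∀ u : U, Fintype.card (V u) = m := by
    intro u
    rw [hm, Module.card_eq_pow_finrank (K := ZMod 2), Module.card_eq_pow_finrank (K := ZMod 2)
      (V := V 0), hV u u.2 0 U.zero_mem]
  have hmpos : 0 < m := Fintype.card_pos
  have hT : qCount n₁ n₂ U V (fun _ _ => True) = Fintype.card U * m := by
    rw [qCount_eq]
    simp [hcard]
  have hZ : 2 * qCount n₁ n₂ U V (fun u v => matDot n₁ n₂ r (Matrix.vecMulVec u v) = 0) ≤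
      m * Fintype.card U + m * gcount (fun u : U => perp n₂ (V u))
        (r.vecMulLinear ∘ₗ U.subtype) := by
    rw [qCount_eq, Finset.mul_sum]
    unfold gcount
    rw [Finset.card_filter, Finset.mul_sum]
    have : m * Fintype.card U = ∑ u : U, m := by simp [mul_comm]
    rw [this, ← Finset.sum_add_distrib]
    refine Finset.sum_le_sum fun u _ => ?_
    split_ifs with hu
    · rw [mul_one, ← two_mul]
      refine Nat.mul_le_mul_left 2 ((Finset.card_le_univ _).trans (le_of_eq ?_))
      exact hcard u
    · have := half_card (LinearMap.ker
        ((dotProductEquiv (ZMod 2) (Fin n₂) (Matrix.vecMul u r)) ∘ₗ (V u).subtype)) (by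
          intro htop
          apply hu
          rw [mem_perp]
          intro v hv
          have : (⟨v, hv⟩ : V u) ∈ LinearMap.ker
            ((dotProductEquiv (ZMod 2) (Fin n₂) (Matrix.vecMul u r)) ∘ₗ (V u).subtype) :=
            htop ▸ Submodule.mem_top
          simpa using this)
      rw [hcard] at this
      simp only [mul_zero, add_zero]
      refine le_trans (le_of_eq ?_) this
      congr 2
      ext v
      simp [matDot_vecMulVec]
  have hZ' : (2 : ℝ) * qCount n₁ n₂ U V
      (fun u v => matDot n₁ n₂ r (Matrix.vecMulVec u v) = 0) ≤
      m * Fintype.card U + m * gcount (fun u : U => perp n₂ (V u))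
        (r.vecMulLinear ∘ₗ U.subtype) := by exact_mod_cast hZ
  rw [hT] at h
  push_cast at h
  generalize gcount (fun u : U => perp n₂ (V u)) (r.vecMulLinear ∘ₗ U.subtype) = g at *
  have hf : (m : ℝ) * (7 * Fintype.card U) ≤ m * (8 * g) := by nlinarith
  have := le_of_mul_le_mul_left hf (by exact_mod_cast hmpos)
  exact_mod_cast this

lemma exists_mat (n₁ n₂ : ℕ) (U : Submodule (ZMod 2) (Fin n₁ → ZMod 2))
    (W : Submodule (ZMod 2) (Fin n₂ → ZMod 2)) (t : U →ₗ[ZMod 2] (Fin n₂ → ZMod 2))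
    (ht : LinearMap.range t ≤ W) :
    ∃ r : Matrix (Fin n₁) (Fin n₂) (ZMod 2), r ∈ rowCyl n₁ n₂ W ∧
      ∀ u : U, Matrix.vecMul (u : Fin n₁ → ZMod 2) r = t u := by
  obtain ⟨g, hg⟩ := LinearMap.exists_extend (t.codRestrict W fun u => ht ⟨u, rfl⟩)
  refine ⟨Matrix.of fun i => (g (Pi.single i 1) : Fin n₂ → ZMod 2), ?_, ?_⟩
  · intro i
    exact (g (Pi.single i 1)).2
  · intro u
    have h1 : g u = t.codRestrict W (fun u => ht ⟨u, rfl⟩) u := by rw [← hg]; rfl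
    have h2 : (g u : Fin n₂ → ZMod 2) = t u := by rw [h1]; rfl
    rw [← h2]
    have h3 : (u : Fin n₁ → ZMod 2) = ∑ i, (u : Fin n₁ → ZMod 2) i • Pi.single i (1 : ZMod 2) := by
      ext j; simp [Finset.sum_apply, Pi.single_apply]
    conv_rhs => rw [h3]
    rw [map_sum]
    ext j
    simp [Matrix.vecMul, dotProduct, Finset.sum_apply]

theorem stmt9 :
    ∃ ε : ℝ, 0 < ε ∧ ∀ k : ℕ, 0 < k → ∃ K : ℕ, 0 < K ∧
      ∀ n₁ n₂ : ℕ, 0 < n₁ → 0 < n₂ →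
        ∀ U : Submodule (ZMod 2) (Fin n₁ → ZMod 2), n₁ - Module.finrank (ZMod 2) U ≤ k →
          ∀ V : (Fin n₁ → ZMod 2) → Submodule (ZMod 2) (Fin n₂ → ZMod 2),
            (∀ u ∈ U, n₂ - Module.finrank (ZMod 2) (V u) ≤ k) →
            (∀ u ∈ U, ∀ u' ∈ U,
              Module.finrank (ZMod 2) (V u) = Module.finrank (ZMod 2) (V u')) →
            ∃ W₁₂ : Submodule (ZMod 2) (Matrix (Fin n₁) (Fin n₂) (ZMod 2)),
              ∃ W₁ : Submodule (ZMod 2) (Fin n₁ → ZMod 2),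
                ∃ W₂ : Submodule (ZMod 2) (Fin n₂ → ZMod 2),
                  Module.finrank (ZMod 2) W₁₂ ≤ K ∧ Module.finrank (ZMod 2) W₁ ≤ K ∧
                  Module.finrank (ZMod 2) W₂ ≤ K ∧
                  ∀ r : Matrix (Fin n₁) (Fin n₂) (ZMod 2),
                    ((1 - ε) * qCount n₁ n₂ U V (fun _ _ => True) ≤
                      (qCount n₁ n₂ U V
                        (fun u v => matDot n₁ n₂ r (Matrix.vecMulVec u v) = 0) : ℝ)) →
                    r ∈ W₁₂ ⊔ colCyl n₁ n₂ W₁ ⊔ rowCyl n₁ n₂ W₂ := by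
  classical
  refine ⟨1 / 16, by norm_num, fun k _ => ?_⟩
  refine ⟨2 ^ (k + 2) + (2 * k + 5) * (4 * k + 1) + k, by positivity, ?_⟩
  intro n₁ n₂ _ _ U hU V hV1 hV2
  obtain ⟨T, hT, W, hW, hmain⟩ := lemC (fun u : U => perp n₂ (V u)) k (by
    intro u
    rw [finrank_perp]
    exact hV1 u u.2)
  choose f _ hf using fun t : U →ₗ[ZMod 2] (Fin n₂ → ZMod 2) => exists_mat n₁ n₂ U ⊤ t le_top
  refine ⟨Submodule.span (ZMod 2) ((T.image f : Finset _) : Set _), perp n₁ U, W, ?_, ?_, ?_, ?_⟩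
  · have := (finrank_span_finset_le_card (R := ZMod 2) (T.image f)).trans Finset.card_image_le
    unfold Set.finrank at this
    omega
  · rw [finrank_perp]; omega
  · omega
  · intro r hr
    obtain ⟨t, ht, hrange⟩ := hmain _ (good_of n₁ n₂ U V hV2 r hr)
    obtain ⟨s, hs1, hs2⟩ := exists_mat n₁ n₂ U W _ hrange
    have e : r = f t + (r - f t - s) + s := by abel
    rw [e]
    refine Submodule.add_mem_sup (Submodule.add_mem_sup ?_ ?_) hs1
    · exact Submodule.subset_span (by simpa using ⟨t, ht, rfl⟩)
    · intro j
      rw [mem_perp]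
      intro u hu
      have h0 : Matrix.vecMul u (r - f t - s) = 0 := by
        rw [Matrix.vecMul_sub, Matrix.vecMul_sub, hf t ⟨u, hu⟩, hs2 ⟨u, hu⟩]
        simp
      have := congrFun h0 j
      rw [dotProduct_comm]
      exact this
end
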